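/- Let n ≥ 5 with n ≠ 6, and let N be a group of order n! such that N is not isomorphic to Sₙ and not isomorphic to Aₙ × C₂. Then E(Sₙ, N) is empty, i.e., there is no regular subgroup of Perm(Sₙ) normalized by λ(Sₙ) that is isomorphic to N. -/

import Mathlib

set_option linter.all false

/-- A subgroup `H` of `Perm G` is regular if the evaluation map `η ↦ η 1` is bijective. -/
def IsRegularSubgroup {G : Type*} [Group G] (H : Subgroup (Equiv.Perm G)) : Prop :=
  Function.Bijective fun η : H => (η : Equiv.Perm G) 1

/-- A subgroup `H` of `Perm G` is normalized by the image `λ(G)` of the left regular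
representation. -/
def IsNormalizedByLeft {G : Type*} [Group G] (H : Subgroup (Equiv.Perm G)) : Prop :=
  ∀ σ : G, ∀ η ∈ H, Equiv.mulLeft σ * η * (Equiv.mulLeft σ)⁻¹ ∈ H



namespace Reg

def Inv (S G : Type) [Group S] [Group G] : Prop :=
  ∃ (H : Subgroup G) (φ : H →* S), Function.Surjective φ

section
variable {S : Type} [Group S]

theorem Inv.of_injective {G Q : Type} [Group G] [Group Q] (f : G →* Q)
    (hf : Function.Injective f) (h : Inv S G) : Inv S Q := by
  obtain ⟨H, φ, hφ⟩ := h
  refine ⟨H.map f, φ.comp (H.equivMapOfInjective f hf).symm.toMonoidHom, ?_⟩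
  exact hφ.comp (H.equivMapOfInjective f hf).symm.surjective

theorem Inv.of_surjective {G Q : Type} [Group G] [Group Q] (f : G →* Q)
    (hf : Function.Surjective f) (h : Inv S Q) : Inv S G := by
  obtain ⟨H, φ, hφ⟩ := h
  refine ⟨H.comap f, φ.comp (f.subgroupComap H), ?_⟩
  exact hφ.comp (f.subgroupComap_surjective_of_surjective H hf)

theorem Inv.of_le {X : Type} [Group X] {A B : Subgroup X} (h : A ≤ B) (hA : Inv S A) : Inv S B :=
  hA.of_injective (Subgroup.inclusion h) (Subgroup.inclusion_injective h)

theorem Inv.of_subgroup {X : Type} [Group X] {A : Subgroup X} (hA : Inv S A) : Inv S X :=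
  hA.of_injective A.subtype A.subtype_injective

theorem Inv.ext [IsSimpleGroup S] {G Q : Type} [Group G] [Group Q] (f : G →* Q)
    (h : Inv S G) : Inv S f.ker ∨ Inv S Q := by
  obtain ⟨H, φ, hφ⟩ := h
  have hn : ((f.ker.subgroupOf H).map φ).Normal := Subgroup.Normal.map inferInstance φ hφ
  rcases hn.eq_bot_or_eq_top with h0 | h1
  · right
    have hk : (f.comp H.subtype).rangeRestrict.ker ≤ φ.ker := by
      intro x hx
      have : φ x ∈ (f.ker.subgroupOf H).map φ := by
        refine ⟨x, ?_, rfl⟩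
        simp only [SetLike.mem_coe, Subgroup.mem_subgroupOf, MonoidHom.mem_ker]
        rw [MonoidHom.ker_rangeRestrict] at hx
        exact hx
      rw [h0] at this
      exact this
    let r := (f.comp H.subtype).rangeRestrict
    have hr : Function.Surjective r := MonoidHom.rangeRestrict_surjective _
    refine ⟨(f.comp H.subtype).range, MonoidHom.liftOfRightInverse r
      (Function.surjInv hr) (Function.rightInverse_surjInv hr) ⟨φ, hk⟩, ?_⟩
    intro s
    obtain ⟨x, rfl⟩ := hφ s
    exact ⟨r x, MonoidHom.liftOfRightInverse_comp_apply _ _ _ ⟨φ, hk⟩ x⟩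
  · left
    refine ⟨H.subgroupOf f.ker, φ.comp
      (((f.ker.subtype).comp (H.subgroupOf f.ker).subtype).codRestrict H (fun x => x.2)), ?_⟩
    intro s
    have : s ∈ (f.ker.subgroupOf H).map φ := by rw [h1]; trivial
    obtain ⟨x, hx, rfl⟩ := this
    exact ⟨⟨⟨x.1, hx⟩, x.2⟩, rfl⟩

theorem not_inv_of_comm (hS : ¬ ∀ a b : S, a * b = b * a) {G : Type} [Group G]
    (hG : ∀ a b : G, a * b = b * a) : ¬ Inv S G := by
  rintro ⟨H, φ, hφ⟩
  apply hS
  intro a b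
  obtain ⟨x, rfl⟩ := hφ a
  obtain ⟨y, rfl⟩ := hφ b
  rw [← map_mul, ← map_mul]
  congr 1
  exact Subtype.ext (hG _ _)

theorem Inv.card_dvd {G : Type} [Group G] (h : Inv S G) :
    Nat.card S ∣ Nat.card G := by
  obtain ⟨H, φ, hφ⟩ := h
  exact (Subgroup.card_dvd_of_surjective φ hφ).trans (Subgroup.card_subgroup_dvd_card H)

theorem not_inv_of_solvable (hS : ¬ Group.IsSolvable S) {G : Type} [Group G]
    [Group.IsSolvable G] : ¬ Inv S G := by
  rintro ⟨H, φ, hφ⟩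
  exact hS (solvable_of_surjective hφ)

end

def PP (S L : Type) [Group S] [Group L] : Prop :=
  ∀ (Q : Type) [Group Q] (f : L →* Q), ¬ Inv S Q → ∀ x, f x = 1

section
variable {S : Type} [Group S]

theorem PP.hom {L Q : Type} [Group L] [Group Q] (hL : PP S L) (f : L →* Q)
    (h : ¬ Inv S f.range) (x : L) : f x = 1 := by
  have := hL f.range f.rangeRestrict h x
  simpa [Subtype.ext_iff] using this

theorem PP.of_surjective {L M : Type} [Group L] [Group M] (hL : PP S L) (f : L →* M)
    (hf : Function.Surjective f) : PP S M := by
  intro Q _ g hQ x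
  obtain ⟨y, rfl⟩ := hf x
  exact hL Q (g.comp f) hQ y

theorem PP.map {X Q : Type} [Group X] [Group Q]
  {L : Subgroup X} (hL : PP S L) (f : X →* Q) : PP S (L.map f) :=
  hL.of_surjective (f.subgroupMap L) (f.subgroupMap_surjective L)

theorem PP.range {L Q : Type} [Group L] [Group Q] (hL : PP S L) (f : L →* Q) :
    PP S f.range :=
  hL.of_surjective f.rangeRestrict f.rangeRestrict_surjective

theorem PP.equiv {L M : Type} [Group L] [Group M] (hL : PP S L) (f : L ≃* M) : PP S M :=
  hL.of_surjective f.toMonoidHom f.surjective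

theorem pp_simple [IsSimpleGroup S] : PP S S := by
  intro Q _ f hQ x
  rcases (inferInstance : f.ker.Normal).eq_bot_or_eq_top with h | h
  · exfalso
    apply hQ
    have hi : Function.Injective f := (MonoidHom.ker_eq_bot_iff f).1 h
    refine Inv.of_injective f hi ⟨⊤, (⊤ : Subgroup S).subtype, fun s => ⟨⟨s, trivial⟩, rfl⟩⟩
  · have : x ∈ f.ker := by rw [h]; trivial
    exact this

def O (S : Type) [Group S] {X : Type} [Group X] (Γ : Subgroup X) : Subgroup X :=
  sSup {L | L ≤ Γ ∧ PP S L}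

variable {X : Type} [Group X]

theorem O_le (Γ : Subgroup X) : O S Γ ≤ Γ := sSup_le fun _ h => h.1

theorem le_O {L Γ : Subgroup X} (h : L ≤ Γ) (hL : PP S L) : L ≤ O S Γ := le_sSup ⟨h, hL⟩

theorem pp_O (Γ : Subgroup X) : PP S (O S Γ) := by
  intro Q _ f hQ x
  have : O S Γ ≤ f.ker.map (O S Γ).subtype := by
    apply sSup_le
    rintro L ⟨h1, h2⟩ y hy
    refine ⟨⟨y, le_O h1 h2 hy⟩, ?_, rfl⟩
    exact h2 Q (f.comp (Subgroup.inclusion (le_O h1 h2))) hQ ⟨y, hy⟩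
  obtain ⟨z, hz, hzx⟩ := this x.2
  have : z = x := Subtype.ext hzx
  rw [← this]; exact hz

theorem O_mono {Γ Δ : Subgroup X} (h : Γ ≤ Δ) : O S Γ ≤ O S Δ :=
  le_O ((O_le Γ).trans h) (pp_O Γ)

theorem O_conj (Γ : Subgroup X) (x : X) : (O S Γ).map (MulAut.conj x).toMonoidHom
    ≤ O S (Γ.map (MulAut.conj x).toMonoidHom) :=
  le_O (Subgroup.map_mono (O_le Γ)) ((pp_O Γ).map _)

theorem conj_mem_O {Γ : Subgroup X} {x y : X} (hx : ∀ z ∈ Γ, x * z * x⁻¹ ∈ Γ) (hy : y ∈ O S Γ) :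
    x * y * x⁻¹ ∈ O S Γ := by
  have h1 : x * y * x⁻¹ ∈ (O S Γ).map (MulAut.conj x).toMonoidHom := ⟨y, hy, rfl⟩
  refine O_mono ?_ (O_conj Γ x h1)
  rintro _ ⟨z, hz, rfl⟩
  exact hx z hz

theorem exists_pp_lift {G Q : Type} [Group G] [Finite G] [Group Q] (f : G →* Q)
    (L : Subgroup Q) (hL : L ≤ f.range) (hpp : PP S L) :
    ∃ H : Subgroup G, PP S H ∧ H.map f = L := by
  classical
  have hex : ∃ k, ∃ H : Subgroup G, Nat.card H = k ∧ H.map f = L :=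
    ⟨_, L.comap f, rfl, Subgroup.map_comap_eq_self hL⟩
  obtain ⟨H, hHk, hH⟩ := Nat.find_spec hex
  refine ⟨H, ?_, hH⟩
  intro D _ h hD
  let K : Subgroup G := h.ker.map H.subtype
  have hKH : K ≤ H := Subgroup.map_subtype_le _
  let fH : H →* L := (f.comp H.subtype).codRestrict L (fun x => hH ▸ ⟨x.1, x.2, rfl⟩)
  have hfs : Function.Surjective fH := by
    rintro ⟨y, hy⟩
    rw [← hH] at hy
    obtain ⟨x, hx, rfl⟩ := hy
    exact ⟨⟨x, hx⟩, rfl⟩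
  let M : Subgroup L := h.ker.map fH
  haveI : M.Normal := Subgroup.Normal.map inferInstance fH hfs
  have hq : ¬ Inv S (L ⧸ M) := by
    intro hi
    let g : h.range →* L ⧸ M := MonoidHom.liftOfRightInverse h.rangeRestrict
      (Function.surjInv h.rangeRestrict_surjective)
      (Function.rightInverse_surjInv h.rangeRestrict_surjective)
      ⟨(QuotientGroup.mk' M).comp fH, by
        intro x hx
        rw [MonoidHom.ker_rangeRestrict] at hx
        simp only [MonoidHom.mem_ker, MonoidHom.comp_apply, QuotientGroup.mk'_apply,
          QuotientGroup.eq_one_iff]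
        exact ⟨x, hx, rfl⟩⟩
    have hg : Function.Surjective g := by
      intro y
      obtain ⟨l, rfl⟩ := QuotientGroup.mk'_surjective M y
      obtain ⟨x, rfl⟩ := hfs l
      exact ⟨h.rangeRestrict x, MonoidHom.liftOfRightInverse_comp_apply _ _ _ _ x⟩
    exact hD ((hi.of_surjective g hg).of_subgroup)
  have hM : M = ⊤ := by
    rw [eq_top_iff]
    intro l _
    have := hpp _ (QuotientGroup.mk' M) hq l
    simpa [QuotientGroup.eq_one_iff] using this
  have hKf : K.map f = L := by
    apply le_antisymm
    · rw [← hH]; exact Subgroup.map_mono hKH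
    · intro l hl
      have : (⟨l, hl⟩ : L) ∈ M := by rw [hM]; trivial
      obtain ⟨x, hx, hxl⟩ := this
      exact ⟨x, ⟨x, hx, rfl⟩, congrArg Subtype.val hxl⟩
  have hcard : Nat.card H ≤ Nat.card K := by
    rw [hHk]; exact Nat.find_min' hex ⟨K, rfl, hKf⟩
  have hKeq : K = H := Subgroup.eq_of_le_of_card_ge hKH hcard
  intro x
  have : x.1 ∈ K := by rw [hKeq]; exact x.2
  obtain ⟨z, hz, hzx⟩ := this
  have : z = x := Subtype.ext hzx
  rw [← this]; exact hz

theorem PP.le_O_mul [Finite X] {Γ T L : Subgroup X} (hΓ : Γ ≤ Subgroup.normalizer (T : Set X))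
    (hLT : ∀ l ∈ L, ∃ γ ∈ Γ, ∃ t ∈ T, l = γ * t) (hL : PP S L) :
    ∀ l ∈ L, ∃ γ ∈ O S Γ, ∃ t ∈ T, l = γ * t := by
  let Nz := Subgroup.normalizer (T : Set X)
  have hTN : T ≤ Nz := Subgroup.le_normalizer
  have hLN : L ≤ Nz := by
    intro l hl
    obtain ⟨γ, h1, t, h2, rfl⟩ := hLT l hl
    exact Nz.mul_mem (hΓ h1) (hTN h2)
  haveI : (T.subgroupOf Nz).Normal := Subgroup.normal_in_normalizer
  let q : Nz →* Nz ⧸ (T.subgroupOf Nz) := QuotientGroup.mk' _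
  let f : Γ →* Nz ⧸ (T.subgroupOf Nz) := q.comp (Subgroup.inclusion hΓ)
  let fl : L →* Nz ⧸ (T.subgroupOf Nz) := q.comp (Subgroup.inclusion hLN)
  have hle : fl.range ≤ f.range := by
    rintro _ ⟨l, rfl⟩
    obtain ⟨γ, h1, t, h2, h3⟩ := hLT l l.2
    refine ⟨⟨γ, h1⟩, ?_⟩
    simp only [f, fl, q, MonoidHom.comp_apply, QuotientGroup.mk'_apply]
    rw [QuotientGroup.eq, Subgroup.mem_subgroupOf]
    simpa [h3] using h2
  obtain ⟨H, hH, hHm⟩ := exists_pp_lift f fl.range hle (hL.range fl)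
  intro l hl
  have : fl ⟨l, hl⟩ ∈ H.map f := by rw [hHm]; exact ⟨_, rfl⟩
  obtain ⟨h, hh, hhl⟩ := this
  simp only [f, fl, q, MonoidHom.comp_apply, QuotientGroup.mk'_apply] at hhl
  rw [QuotientGroup.eq, Subgroup.mem_subgroupOf] at hhl
  refine ⟨h.1, ?_, h.1⁻¹ * l, by simpa using hhl, by simp⟩
  have hH' : PP S (H.map Γ.subtype) := hH.map _
  exact le_O (Subgroup.map_subtype_le _) hH' ⟨h, hh, rfl⟩

end
end Reg



namespace Reg
open Subgroup

section
variable {S : Type} [Group S] {X : Type} [Group X]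

theorem PP.comm_trick {L : Subgroup X} (hL : PP S L) (A : Subgroup X) (hA : ¬ Inv S A)
    (hc : ∀ l ∈ L, ∀ a ∈ A, l * a = a * l) (t : X) (h : ∀ l ∈ L, t * l * t⁻¹ * l⁻¹ ∈ A) :
    ∀ l ∈ L, t * l = l * t := by
  let f : L →* A := MonoidHom.mk' (fun l => ⟨t * l * t⁻¹ * (l : X)⁻¹, h l l.2⟩) (by
    intro a b
    apply Subtype.ext
    have h1 := hc a a.2 _ (h b b.2)
    simp only [Subgroup.coe_mul]
    have h2 : t * (a * b : X) * t⁻¹ * (a * b : X)⁻¹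
      = t * a * t⁻¹ * ((t * b * t⁻¹ * (b:X)⁻¹) * (a:X)⁻¹) := by group
    have h3 : (t * b * t⁻¹ * (b:X)⁻¹) * (a:X)⁻¹ = (a:X)⁻¹ * (t * b * t⁻¹ * (b:X)⁻¹) := by
      exact (Commute.inv_left (show Commute (a:X) _ from h1)).symm
    rw [h2, h3]; simp only [mul_assoc])
  intro l hl
  have := hL A f hA ⟨l, hl⟩
  have h2 : t * l * t⁻¹ * l⁻¹ = 1 := congrArg Subtype.val this
  rw [mul_inv_eq_one, mul_inv_eq_iff_eq_mul] at h2
  exact h2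

theorem PP.eq_of_central (hS : ¬ ∀ a b : S, a * b = b * a) {L M A : Subgroup X} (hL : PP S L)
    (hML : M ≤ L) (hc : ∀ l ∈ L, ∀ a ∈ A, l * a = a * l)
    (hAL : A ≤ L)
    (h : ∀ l ∈ L, ∃ m ∈ M, ∃ a ∈ A, l = m * a) : L ≤ M := by
  have : (M.subgroupOf L).Normal := by
    constructor
    rintro ⟨m, hm⟩ hm' ⟨l, hl⟩
    rw [mem_subgroupOf] at hm' ⊢
    simp only [Subgroup.coe_mul, Subgroup.coe_inv] at hm' ⊢
    obtain ⟨k, hk, a, ha, rfl⟩ := h l hl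
    have e : k * a * m * (k * a)⁻¹ = k * m * k⁻¹ := by
      have := hc m hm a ha
      rw [mul_assoc k a m, ← this]; group
    rw [e]
    exact M.mul_mem (M.mul_mem hk hm') (M.inv_mem hk)
  have hcomm : ∀ a b : L ⧸ M.subgroupOf L, a * b = b * a := by
    intro p q
    obtain ⟨⟨x, hx⟩, rfl⟩ := QuotientGroup.mk'_surjective _ p
    obtain ⟨⟨y, hy⟩, rfl⟩ := QuotientGroup.mk'_surjective _ q
    obtain ⟨k, hk, a, ha, rfl⟩ := h x hx
    obtain ⟨k', hk', b, hb, rfl⟩ := h y hy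
    rw [← map_mul, ← map_mul]
    simp only [QuotientGroup.mk'_apply]
    rw [QuotientGroup.eq, mem_subgroupOf]
    simp only [Subgroup.coe_mul, Subgroup.coe_inv]
    have e1 : k * a * (k' * b) = k * k' * (a * b) := by
      have := hc k' (hML hk') a ha
      rw [mul_assoc k a, ← mul_assoc a, ← this]; group
    have e2 : k' * b * (k * a) = k' * k * (a * b) := by
      have := hc k (hML hk) b hb
      have h2 := hc a (hAL ha) b hb
      rw [mul_assoc k' b, ← mul_assoc b, ← this, h2]; group
    rw [e1, e2]
    have e3 : (k * k' * (a * b))⁻¹ * (k' * k * (a * b)) =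
      (a * b)⁻¹ * (((k * k')⁻¹ * (k' * k)) * (a * b)) := by group
    have e4 : ((k * k')⁻¹ * (k' * k)) ∈ M :=
      M.mul_mem (M.inv_mem (M.mul_mem hk hk')) (M.mul_mem hk' hk)
    rw [e3, hc _ (hML e4) _ (A.mul_mem ha hb), inv_mul_cancel_left]
    exact e4
  intro l hl
  have := hL _ (QuotientGroup.mk' (M.subgroupOf L)) (not_inv_of_comm hS hcomm) ⟨l, hl⟩
  simpa [QuotientGroup.eq_one_iff, mem_subgroupOf] using this

theorem mem_normalizer_of_conj [Finite X] {R : Subgroup X} {g : X}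
    (h : ∀ y ∈ R, g * y * g⁻¹ ∈ R) : g ∈ normalizer (R : Set X) := by
  have h1 : R.map (MulAut.conj g).toMonoidHom ≤ R := by
    rintro _ ⟨y, hy, rfl⟩; exact h y hy
  have h2 : R.map (MulAut.conj g).toMonoidHom = R := by
    apply Subgroup.eq_of_le_of_card_ge h1
    rw [← Nat.card_congr (R.equivMapOfInjective _ (MulAut.conj g).injective).toEquiv]
  rw [mem_normalizer_iff]
  intro y
  refine ⟨fun hy => h y hy, fun hy => ?_⟩
  have : g * y * g⁻¹ ∈ R.map (MulAut.conj g).toMonoidHom := by rw [h2]; exact hy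
  obtain ⟨z, hz, hzy⟩ := this
  have : z = y := by simpa using hzy
  rwa [← this]

theorem conj_mem_of_mem_normalizer {R : Subgroup X} {g y : X} (h : g ∈ normalizer (R : Set X))
    (hy : y ∈ R) : g * y * g⁻¹ ∈ R := ((mem_normalizer_iff.1 h) y).1 hy

theorem frattini_elt [Finite X] {U : Subgroup X} {r : ℕ} [Fact r.Prime] (P : Sylow r U) {γ : X}
    (hγ : γ ∈ normalizer (U : Set X)) :
    ∃ u ∈ U, u * γ ∈ normalizer ((P.toSubgroup.map U.subtype : Subgroup X) : Set X) := by
  let α : U →* U := ((MulAut.conj γ).toMonoidHom.comp U.subtype).codRestrict U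
    (fun x => conj_mem_of_mem_normalizer hγ x.2)
  have hα : Function.Surjective α := by
    apply Finite.injective_iff_surjective.1
    intro a b hab
    have := congrArg Subtype.val hab
    simp [α] at this
    exact this
  obtain ⟨u, hu⟩ := MulAction.exists_smul_eq U (P.mapSurjective hα) P
  refine ⟨u, u.2, mem_normalizer_of_conj ?_⟩
  rintro _ ⟨y, hy, rfl⟩
  have h1 : α y ∈ P.mapSurjective hα := by
    exact ⟨y, hy, rfl⟩
  have h2 : u * α y * u⁻¹ ∈ u • P.mapSurjective hα := by
    rw [← MulAut.conj_apply]
    exact ⟨α y, h1, rfl⟩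
  rw [hu] at h2
  refine ⟨_, h2, ?_⟩
  simp [α, mul_assoc]

theorem mem_of_primepow_aux (K : Subgroup X) (m : ℕ) :
    ∀ x : X, orderOf x = m → m ≠ 0 → (∀ y ∈ zpowers x, (∃ r k, Nat.Prime r ∧ orderOf y = r ^ k) → y ∈ K) →
    x ∈ K := by
  induction m using Nat.recOnPrimeCoprime with
  | zero => intro x _ h; exact absurd rfl h
  | prime_pow p n hp => intro x hx _ h; exact h x (mem_zpowers x) ⟨p, n, hp, hx⟩
  | coprime a b ha hb hab iha ihb =>
    intro x hx _ h
    have h1 : x ^ a ∈ K := by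
      apply ihb _ _ (by omega)
      · intro y hy; exact h y (zpowers_le.2 (npow_mem_zpowers x a) hy)
      · rw [orderOf_pow_of_dvd (by omega) (by rw [hx]; exact Dvd.intro _ rfl), hx]
        exact Nat.mul_div_cancel_left b (by omega)
    have h2 : x ^ b ∈ K := by
      apply iha _ _ (by omega)
      · intro y hy; exact h y (zpowers_le.2 (npow_mem_zpowers x b) hy)
      · rw [orderOf_pow_of_dvd (by omega) (by rw [hx]; exact Dvd.intro_left _ rfl), hx]
        exact Nat.mul_div_cancel a (by omega)
    have hb := Nat.gcd_eq_gcd_ab a b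
    rw [hab] at hb
    have : x = (x ^ a) ^ (Nat.gcdA a b) * (x ^ b) ^ (Nat.gcdB a b) := by
      rw [← zpow_natCast, ← zpow_natCast, ← zpow_mul, ← zpow_mul, ← zpow_add, ← hb]; simp
    rw [this]
    exact K.mul_mem (K.zpow_mem h1 _) (K.zpow_mem h2 _)

theorem mem_of_primepow [Finite X] (K : Subgroup X) (x : X)
    (h : ∀ y ∈ zpowers x, (∃ r k, Nat.Prime r ∧ orderOf y = r ^ k) → y ∈ K) : x ∈ K :=
  mem_of_primepow_aux K _ x rfl (orderOf_pos x).ne' h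

theorem burnside_unique {U Ω : Type} [Group U] [Finite U] [Finite Ω] [Nonempty Ω] [MulAction U Ω]
    (Z : Subgroup U) (hZ : ∀ z ∈ Z, ∀ ω : Ω, z • ω = ω)
    (h1 : ∀ u ∉ Z, ∃! ω : Ω, u • ω = ω)
    (h2 : ∀ ω : Ω, ∃ u ∉ Z, u • ω = ω) : ∀ u : U, ∀ ω : Ω, u • ω = ω := by
  classical
  have := Fintype.ofFinite U
  have := Fintype.ofFinite Ω
  have := Fintype.ofFinite (Quotient (MulAction.orbitRel U Ω))
  have hb := MulAction.sum_card_fixedBy_eq_card_orbits_mul_card_group U Ω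
  have hzc : Fintype.card Z = (Finset.univ.filter (fun u : U => u ∈ Z)).card := by
    rw [Fintype.card_subtype]
  have hsum : ∑ a : U, Fintype.card (MulAction.fixedBy Ω a) =
      Fintype.card Z * Fintype.card Ω + (Fintype.card U - Fintype.card Z) := by
    rw [← Finset.sum_filter_add_sum_filter_not Finset.univ (fun u : U => u ∈ Z)]
    congr 1
    · rw [Finset.sum_congr rfl (g := fun _ => Fintype.card Ω), Finset.sum_const, smul_eq_mul, hzc]
      intro z hz
      have hz' : z ∈ Z := by simpa using hz
      rw [Fintype.card_eq_nat_card, Fintype.card_eq_nat_card]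
      refine Nat.card_congr (Equiv.subtypeUnivEquiv ?_)
      intro ω; exact hZ z hz' ω
    · rw [Finset.sum_congr rfl (g := fun _ => 1), Finset.sum_const, smul_eq_mul, mul_one, hzc,
        Finset.filter_not, Finset.card_sdiff_of_subset (Finset.filter_subset _ _)]
      · rfl
      · intro u hu
        have hu' : u ∉ Z := by simpa using hu
        obtain ⟨ω, hω, hω'⟩ := h1 u hu'
        rw [Fintype.card_eq_one_iff]
        exact ⟨⟨ω, hω⟩, fun y => Subtype.ext (hω' y.1 y.2)⟩
  have hst : ∑ a : U, Fintype.card (MulAction.fixedBy Ω a) =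
      ∑ ω : Ω, Fintype.card (MulAction.stabilizer U ω) := by
    have e1 : ∀ a : U, Fintype.card (MulAction.fixedBy Ω a) = ∑ ω : Ω, if a • ω = ω then 1 else 0 := by
      intro a
      rw [← Finset.card_filter, ← Fintype.card_subtype]
      rfl
    have e2 : ∀ ω : Ω, Fintype.card (MulAction.stabilizer U ω) = ∑ a : U, if a • ω = ω then 1 else 0 := by
      intro a
      rw [← Finset.card_filter, ← Fintype.card_subtype]
      rfl
    rw [Finset.sum_congr rfl (fun a _ => e1 a), Finset.sum_comm, Finset.sum_congr rfl (fun a _ => (e2 a).symm)]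
  have hge : ∀ ω : Ω, 2 * Fintype.card Z ≤ Fintype.card (MulAction.stabilizer U ω) := by
    intro ω
    obtain ⟨u, hu, huω⟩ := h2 ω
    have hle : Z ≤ MulAction.stabilizer U ω := fun z hz => hZ z hz ω
    have hne : Z ≠ MulAction.stabilizer U ω := by
      intro h; apply hu; rw [h]; exact huω
    rw [Fintype.card_eq_nat_card, Fintype.card_eq_nat_card]
    obtain ⟨k, hk⟩ := Subgroup.card_dvd_of_le hle
    have hpos : 0 < Nat.card (MulAction.stabilizer U ω) := Nat.card_pos
    have : k ≠ 0 := by rintro rfl; omega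
    have : k ≠ 1 := by
      rintro rfl
      apply hne
      apply Subgroup.eq_of_le_of_card_ge hle
      omega
    rw [hk, mul_comm]
    exact Nat.mul_le_mul_left _ (by omega)
  have hge' : Fintype.card Ω * (2 * Fintype.card Z) ≤ ∑ ω : Ω, Fintype.card (MulAction.stabilizer U ω) := by
    have := Finset.card_nsmul_le_sum Finset.univ (fun ω : Ω => Fintype.card (MulAction.stabilizer U ω)) _
      (fun ω _ => hge ω)
    simpa using this
  have hzpos : 0 < Fintype.card Z := Fintype.card_pos
  have hωpos : 0 < Fintype.card Ω := Fintype.card_pos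
  have hzu : Fintype.card Z ≤ Fintype.card U := Fintype.card_subtype_le _
  rw [← hst, hsum] at hge'
  rw [hsum] at hb
  set o := Fintype.card (Quotient (MulAction.orbitRel U Ω))
  have hone : Fintype.card Ω ≤ 1 := by
    set z := Fintype.card Z
    set a := Fintype.card Ω
    set u := Fintype.card U
    have hlt : o * u < 2 * u := by
      have : a * (2 * z) = z * a + z * a := by ring
      omega
    have ho : o < 2 := lt_of_mul_lt_mul_right hlt (Nat.zero_le _)
    have : o * u ≤ 1 * u := Nat.mul_le_mul_right _ (by omega)
    have h3 : z * a ≤ z * 1 := by omega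
    exact Nat.le_of_mul_le_mul_left h3 hzpos
  intro u ω
  exact (Fintype.card_le_one_iff.1 hone) _ _

end
end Reg



namespace Reg
open Subgroup

section
variable {S : Type} [Group S] {X : Type} [Group X]

def HH (S : Type) [Group S] {X : Type} [Group X] (U : Subgroup X) : Prop :=
  ∀ r : ℕ, r.Prime → ∀ B : Subgroup X, B ≤ U → IsPGroup r B →
    ∀ l ∈ O S (normalizer (B : Set X)), ∀ b ∈ B, l * b = b * l

def LL (S : Type) [Group S] {X : Type} [Group X] (U : Subgroup X) (x : X) : Subgroup X :=
  O S (normalizer (U : Set X) ⊓ centralizer {x})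

theorem LL_comm {U : Subgroup X} {x l : X} (hl : l ∈ LL S U x) : l * x = x * l :=
  (mem_centralizer_singleton_iff.1 (O_le _ hl).2)

theorem LL_norm {U : Subgroup X} {x l : X} (hl : l ∈ LL S U x) : l ∈ normalizer (U : Set X) :=
  (O_le _ hl).1

theorem LL_le {U : Subgroup X} {x : X} : LL S U x ≤ O S (normalizer (U : Set X)) :=
  O_mono inf_le_left

theorem LL_conj_le {U : Subgroup X} {x u : X} (hu : u ∈ normalizer (U : Set X)) :
    (LL S U x).map (MulAut.conj u).toMonoidHom ≤ LL S U (u * x * u⁻¹) := by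
  refine (O_conj _ u).trans (O_mono ?_)
  rintro _ ⟨y, ⟨hy1, hy2⟩, rfl⟩
  refine ⟨?_, ?_⟩
  · exact (normalizer (U : Set X)).mul_mem ((normalizer (U : Set X)).mul_mem hu hy1)
      ((normalizer (U : Set X)).inv_mem hu)
  · have := mem_centralizer_singleton_iff.1 hy2
    apply mem_centralizer_singleton_iff.2
    simp only [MulEquiv.coe_toMonoidHom, MulAut.conj_apply]
    have e : u * y * u⁻¹ * (u * x * u⁻¹) = u * (y * x) * u⁻¹ := by group
    rw [e, this]; group

theorem LL_conj {U : Subgroup X} {x u : X} (hu : u ∈ normalizer (U : Set X)) :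
    (LL S U x).map (MulAut.conj u).toMonoidHom = LL S U (u * x * u⁻¹) := by
  apply le_antisymm (LL_conj_le hu)
  intro y hy
  have h1 : u⁻¹ * y * u⁻¹⁻¹ ∈ LL S U (u⁻¹ * (u * x * u⁻¹) * u⁻¹⁻¹) :=
    LL_conj_le ((normalizer (U : Set X)).inv_mem hu) ⟨y, hy, rfl⟩
  have e : u⁻¹ * (u * x * u⁻¹) * u⁻¹⁻¹ = x := by group
  rw [e] at h1
  refine ⟨_, h1, ?_⟩
  simp only [MulEquiv.coe_toMonoidHom, MulAut.conj_apply]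
  group

theorem LL_of_comm_le {U : Subgroup X} {x y : X} (h : ∀ l ∈ LL S U x, l * y = y * l) :
    LL S U x ≤ LL S U y :=
  le_O (fun l hl => ⟨LL_norm hl, mem_centralizer_singleton_iff.2 (h l hl)⟩) (pp_O _)

theorem le_LL_mul [Finite X] {U : Subgroup X} (hh : HH S U) {x : X} (hx : x ∈ U)
    (hxp : ∃ r k, Nat.Prime r ∧ orderOf x = r ^ k) :
    ∀ l ∈ O S (normalizer (U : Set X)), ∃ γ ∈ LL S U x, ∃ t ∈ U, l = γ * t := by
  obtain ⟨r, k, hr, hk⟩ := hxp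
  have : Fact r.Prime := ⟨hr⟩
  have hpg : IsPGroup r (zpowers (⟨x, hx⟩ : U)) := by
    apply IsPGroup.of_card (n := k)
    rw [Nat.card_zpowers, Subgroup.orderOf_mk, hk]
  obtain ⟨P, hP⟩ := hpg.exists_le_sylow
  set R : Subgroup X := P.toSubgroup.map U.subtype with hR
  have hRU : R ≤ U := map_subtype_le _
  have hxR : x ∈ R := ⟨⟨x, hx⟩, hP (mem_zpowers _), rfl⟩
  have hRp : IsPGroup r R := P.2.map _
  have key := PP.le_O_mul (S := S) (Γ := normalizer (U : Set X) ⊓ normalizer (R : Set X)) (T := U)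
    (L := O S (normalizer (U : Set X))) inf_le_left (by
      intro l hl
      have hlN := O_le _ hl
      obtain ⟨u, hu, huR⟩ := frattini_elt P ((normalizer (U : Set X)).inv_mem hlN)
      have huN : u ∈ normalizer (U : Set X) := le_normalizer hu
      refine ⟨(u * l⁻¹)⁻¹, mem_inf.2 ⟨inv_mem (mul_mem huN (inv_mem hlN)), inv_mem huR⟩, u, hu, by group⟩)
    (pp_O _)
  intro l hl
  obtain ⟨γ, hγ, t, ht, rfl⟩ := key l hl
  refine ⟨γ, ?_, t, ht, rfl⟩
  refine le_O (L := O S (normalizer (U : Set X) ⊓ normalizer (R : Set X))) ?_ (pp_O _) hγ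
  intro g hg
  refine ⟨(O_le _ hg).1, mem_centralizer_singleton_iff.2 ?_⟩
  exact hh r hr R hRU hRp g (O_mono inf_le_right hg) x hxR

@[reducible] def conjActSet (U : Subgroup X) (W : Set (Subgroup X))
    (hW : ∀ u ∈ U, ∀ L ∈ W, L.map (MulAut.conj u).toMonoidHom ∈ W) : MulAction U W where
  smul u L := ⟨L.1.map (MulAut.conj u.1).toMonoidHom, hW u.1 u.2 L.1 L.2⟩
  one_smul L := by
    apply Subtype.ext
    change L.1.map (MulAut.conj (1 : X)).toMonoidHom = L.1
    ext y; simp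
  mul_smul a b L := by
    apply Subtype.ext
    change L.1.map (MulAut.conj ((a * b : U) : X)).toMonoidHom =
      (L.1.map (MulAut.conj (b : X)).toMonoidHom).map (MulAut.conj (a : X)).toMonoidHom
    rw [Subgroup.map_map]
    congr 1
    ext y
    simp [mul_assoc]

theorem lemmaC [IsSimpleGroup S] (hS : ¬ ∀ a b : S, a * b = b * a) [Finite X] :
    ∀ (m : ℕ) (U : Subgroup X), Nat.card U = m → ¬ Inv S U → HH S U →
    ∀ l ∈ O S (normalizer (U : Set X)), ∀ u ∈ U, l * u = u * l := by
  intro m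
  induction m using Nat.strong_induction_on with
  | _ m IH =>
  intro U hm hU hh
  set L0 := O S (normalizer (U : Set X)) with hL0
  set Z : Subgroup X := U ⊓ centralizer (U : Set X) with hZ
  have hcen : ∀ z ∈ Z, ∀ l ∈ L0, l * z = z * l := by
    intro z hz l hl
    have : z ∈ centralizer {l} ⊓ Z := by
      apply mem_of_primepow
      intro y hy hyp
      have hyZ : y ∈ Z := (zpowers_le.2 hz) hy
      refine ⟨mem_centralizer_singleton_iff.2 ?_, hyZ⟩
      obtain ⟨γ, hγ, t, ht, rfl⟩ := le_LL_mul hh hyZ.1 hyp l hl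
      have h1 := LL_comm hγ
      have h2 : t * y = y * t := (mem_centralizer_iff.1 hyZ.2) t ht
      rw [← mul_assoc y, ← h1, mul_assoc, ← h2, mul_assoc]
    exact (mem_centralizer_singleton_iff.1 this.1).symm
  by_cases hab : ∀ x ∈ U, (∃ r k, Nat.Prime r ∧ orderOf x = r ^ k) → x ∈ Z
  · have hUZ : ∀ u ∈ U, u ∈ Z := by
      intro u hu
      apply mem_of_primepow
      intro y hy hyp
      exact hab y (zpowers_le.2 hu hy) hyp
    intro l hl u hu
    exact hcen u (hUZ u hu) l hl
  push Not at hab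
  let good : X → Prop := fun x => x ∈ U ∧ (∃ r k, Nat.Prime r ∧ orderOf x = r ^ k) ∧ x ∉ Z
  obtain ⟨x0, hx0U, hx0p, hx0Z⟩ := hab
  have hg0 : good x0 := ⟨hx0U, hx0p, hx0Z⟩
  have hcx : ∀ x, good x → ∀ l ∈ LL S U x, ∀ y ∈ U, y * x = x * y → l * y = y * l := by
    intro x hx l hl y hy hyx
    set Ux : Subgroup X := U ⊓ centralizer {x}
    have hlt : Nat.card Ux < m := by
      rw [← hm]
      by_contra hcon
      have hle : Ux ≤ U := inf_le_left
      have := Subgroup.eq_of_le_of_card_ge hle (not_lt.1 hcon)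
      apply hx.2.2
      refine ⟨hx.1, mem_centralizer_iff.2 ?_⟩
      intro z hz
      have hz' : z ∈ Ux := by rw [this]; exact hz
      exact mem_centralizer_singleton_iff.1 hz'.2
    refine IH _ hlt Ux rfl (fun h => hU (h.of_le inf_le_left))
      (fun r hr B hB => hh r hr B (hB.trans inf_le_left)) l ?_ y
      ⟨hy, mem_centralizer_singleton_iff.2 hyx⟩
    refine O_mono ?_ hl
    intro g hg
    apply mem_normalizer_of_conj
    rintro z ⟨hz1, hz2⟩
    refine mem_inf.2 ⟨conj_mem_of_mem_normalizer hg.1 hz1, ?_⟩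
    exact mul_mem (mul_mem hg.2 hz2) (inv_mem hg.2)
  have hint : ∀ x, good x → ∀ l ∈ LL S U x, ∀ y ∈ LL S U x ⊓ U, l * y = y * l := by
    intro x hx l hl y hy
    exact hcx x hx l hl y hy.2 (LL_comm hy.1)
  have claimA : ∀ x y, good x → good y → (∀ l ∈ LL S U x, l * y = y * l) →
      LL S U x = LL S U y := by
    intro x y hx hy h
    apply le_antisymm (LL_of_comm_le h)
    apply PP.eq_of_central hS (A := LL S U y ⊓ U) (pp_O _) (LL_of_comm_le h) (hint y hy) inf_le_left
    intro l hl
    obtain ⟨γ, hγ, t, ht, rfl⟩ := le_LL_mul hh hx.1 hx.2.1 l (LL_le hl)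
    refine ⟨γ, hγ, t, ⟨?_, ht⟩, rfl⟩
    have := mul_mem (inv_mem (LL_of_comm_le h hγ)) hl
    simpa using this
  have claimB : ∀ x, good x → ∀ t ∈ U, (LL S U x).map (MulAut.conj t).toMonoidHom = LL S U x →
      ∀ l ∈ LL S U x, t * l = l * t := by
    intro x hx t ht hfix
    apply PP.comm_trick (pp_O _) (LL S U x ⊓ U)
    · apply not_inv_of_comm hS
      intro a b
      exact Subtype.ext (hint x hx a a.2.1 b b.2)
    · exact fun l hl a ha => hint x hx l hl a ha
    · intro l hl
      refine mem_inf.2 ⟨?_, ?_⟩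
      · have : t * l * t⁻¹ ∈ LL S U x := by rw [← hfix]; exact ⟨l, hl, rfl⟩
        exact mul_mem this (inv_mem hl)
      · have := conj_mem_of_mem_normalizer (LL_norm hl) (inv_mem ht)
        have h2 := mul_mem ht this
        simpa [mul_assoc] using h2
  let W : Set (Subgroup X) := {L | ∃ x, good x ∧ L = LL S U x}
  have hgc : ∀ u ∈ U, ∀ x, good x → good (u * x * u⁻¹) := by
    rintro u hu x ⟨h1, ⟨r, k, hr, hk⟩, h3⟩
    refine ⟨mul_mem (mul_mem hu h1) (inv_mem hu), ⟨r, k, hr, ?_⟩, ?_⟩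
    · rw [← hk]
      exact orderOf_injective (MulAut.conj u).toMonoidHom (MulAut.conj u).injective x
    · intro hz
      apply h3
      have h4 := (mem_centralizer_iff.1 hz.2) u hu
      have : x = u * x * u⁻¹ := by
        have h5 : u * x * u⁻¹ * u = u * x := by group
        rw [h5] at h4
        exact (mul_left_cancel h4).symm
      rw [this]; exact hz
  have hW : ∀ u ∈ U, ∀ L ∈ W, L.map (MulAut.conj u).toMonoidHom ∈ W := by
    rintro u hu _ ⟨x, hx, rfl⟩
    exact ⟨u * x * u⁻¹, hgc u hu x hx, LL_conj (le_normalizer hu)⟩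
  letI : MulAction U W := conjActSet U W hW
  have hsm : ∀ (u : U) (L : W), (u • L : W) = L ↔ L.1.map (MulAut.conj u.1).toMonoidHom = L.1 := by
    intro u L
    exact Subtype.ext_iff
  have hfixc : ∀ (u : X) (L : Subgroup X), (∀ l ∈ L, u * l = l * u) →
      L.map (MulAut.conj u).toMonoidHom = L := by
    intro u L h
    have hh : ∀ l ∈ L, u * l * u⁻¹ = l := fun l hl => by rw [h l hl]; group
    ext y
    constructor
    · rintro ⟨l, hl, rfl⟩
      simp only [MulEquiv.coe_toMonoidHom, MulAut.conj_apply]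
      rw [hh l hl]; exact hl
    · intro hy
      exact ⟨y, hy, hh y hy⟩
  have : Nonempty W := ⟨⟨_, x0, hg0, rfl⟩⟩
  have hall := burnside_unique (U := U) (Ω := W) (Z.subgroupOf U) (by
      rintro ⟨z, hzU⟩ hz ⟨_, x, hx, rfl⟩
      rw [hsm]
      apply hfixc
      intro l hl
      exact (hcen z hz l (LL_le hl)).symm) (by
      rintro ⟨u, huU⟩ hu
      have hu' : u ∉ Z := hu
      have hex : ∃ x, good x ∧ x ∈ zpowers u := by
        by_contra hcon
        push Not at hcon
        apply hu'
        apply mem_of_primepow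
        intro y hy hyp
        by_contra hyZ
        exact hcon y ⟨zpowers_le.2 huU hy, hyp, hyZ⟩ hy
      obtain ⟨x, hx, hxu⟩ := hex
      have hcux : u * x = x * u := by
        obtain ⟨k, rfl⟩ := hxu
        exact (Commute.self_zpow u k)
      refine ⟨⟨_, x, hx, rfl⟩, ?_, ?_⟩
      · change _ = _
        rw [hsm]
        apply hfixc
        intro l hl
        exact (hcx x hx l hl u huU hcux).symm
      · rintro ⟨_, y, hy, rfl⟩ hfix
        change _ = _ at hfix
        rw [hsm] at hfix
        have h1 := claimB y hy u huU hfix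
        apply Subtype.ext
        apply claimA y x hy hx
        intro l hl
        obtain ⟨k, rfl⟩ := hxu
        have : Commute l u := (h1 l hl).symm
        exact this.zpow_right k) (by
      rintro ⟨_, x, hx, rfl⟩
      refine ⟨⟨x, hx.1⟩, hx.2.2, ?_⟩
      rw [hsm]
      apply hfixc
      intro l hl
      exact (LL_comm hl).symm)
  have hcU : ∀ u ∈ U, ∀ l ∈ LL S U x0, u * l = l * u := by
    intro u hu
    apply claimB x0 hg0 u hu
    exact (hsm ⟨u, hu⟩ ⟨_, x0, hg0, rfl⟩).1 (hall _ _)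
  let ρ : L0 →* MulAut U := U.normalizerMonoidHom.comp (Subgroup.inclusion (O_le _))
  have hρ : ∀ (l : L0) (u : U), ((ρ l u : U) : X) = l * u * (l : X)⁻¹ := by
    intro l u; rfl
  have hin : ρ.range ≤ (MulAut.conj : U →* MulAut U).range := by
    rintro _ ⟨l, rfl⟩
    obtain ⟨γ, hγ, t, ht, hlt⟩ := le_LL_mul hh hg0.1 hg0.2.1 l l.2
    refine ⟨⟨t, ht⟩, ?_⟩
    ext u
    rw [hρ, hlt]
    have := hcU _ (mul_mem (mul_mem ht u.2) (inv_mem ht)) γ hγ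
    have e : γ * t * (u:X) * (γ * t)⁻¹ = γ * (t * u * t⁻¹) * γ⁻¹ := by group
    rw [e, ← this]
    simp
  have hnI : ¬ Inv S ρ.range := by
    intro h
    have h2 := h.of_le hin
    exact hU (h2.of_surjective _ (MonoidHom.rangeRestrict_surjective _))
  intro l hl u hu
  have := PP.hom (pp_O _) ρ hnI ⟨l, hl⟩
  have h2 := hρ ⟨l, hl⟩ ⟨u, hu⟩
  rw [this] at h2
  simp only [MulAut.one_apply] at h2
  rw [eq_mul_inv_iff_mul_eq] at h2
  exact h2.symm

end
end Reg



namespace Reg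
open Subgroup Module

section
variable {k V G : Type} [Field k] [IsAlgClosed k] [AddCommGroup V] [Module k V]
  [FiniteDimensional k V] [Group G]

theorem isSemisimple_of_pow (f : End k V) (m : ℕ) (hm : (m : k) ≠ 0) (h : f ^ m = 1) :
    f.IsSemisimple := by
  have hsep : (Polynomial.X ^ m - Polynomial.C (1:k)).Separable :=
    Polynomial.separable_X_pow_sub_C (1:k) hm one_ne_zero
  apply Module.End.isSemisimple_of_squarefree_aeval_eq_zero hsep.squarefree
  simp [h]

theorem mem_maxGen (f : End k V) (m : ℕ) (hm : (m : k) ≠ 0) (h : f ^ m = 1) (μ : k) (v : V) :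
    v ∈ f.maxGenEigenspace μ ↔ f v = μ • v := by
  rw [(isSemisimple_of_pow f m hm h).isFinitelySemisimple.maxGenEigenspace_eq_eigenspace]
  exact Module.End.mem_eigenspace_iff

theorem lemmaW (ρ : G →* End k V) (hρ : Function.Injective ρ) (B : Subgroup G) [B.Normal]
    (hB : ∀ a ∈ B, ∀ b ∈ B, a * b = b * a)
    (hm : ∀ b ∈ B, ∃ m : ℕ, (m : k) ≠ 0 ∧ b ^ m = 1)
    (hY : ∀ (Y : Type) [Finite Y], Nat.card Y ≤ finrank k V → ∀ θ : G →* Equiv.Perm Y, θ = 1) :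
    ∀ b ∈ B, ∀ g : G, g * b = b * g := by
  classical
  let E : (B → k) → Submodule k V := fun χ => ⨅ b : B, (ρ b).maxGenEigenspace (χ b)
  have hE : ∀ χ v, v ∈ E χ ↔ ∀ b : B, ρ b v = χ b • v := by
    intro χ v
    simp only [E, Submodule.mem_iInf]
    refine forall_congr' fun b => ?_
    obtain ⟨m, h1, h2⟩ := hm b b.2
    exact mem_maxGen _ m h1 (by rw [← map_pow, h2, map_one]) _ _
  have hcomm : ∀ i j : B, Commute (ρ i) (ρ j) := by
    intro i j
    change _ * _ = _ * _
    rw [← map_mul, ← map_mul, hB i i.2 j j.2]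
  have hind : iSupIndep E := Module.End.independent_iInf_maxGenEigenspace_of_forall_mapsTo _
    (fun i j => Module.End.mapsTo_maxGenEigenspace_of_comm (hcomm j i))
  have htop : ⨆ χ, E χ = ⊤ :=
    Module.End.iSup_iInf_maxGenEigenspace_eq_top_of_iSup_maxGenEigenspace_eq_top_of_commute _
      (fun i j _ => hcomm i j) (fun i => Module.End.iSup_maxGenEigenspace_eq_top _)
  let Y := {χ // E χ ≠ ⊥}
  letI : Fintype Y := hind.fintypeNeBotOfFiniteDimensional
  have hYc : Nat.card Y ≤ finrank k V := by
    rw [Nat.card_eq_fintype_card]; exact hind.subtype_ne_bot_le_finrank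
  have hconj : ∀ (g : G) (b : B), g⁻¹ * b * g ∈ B := by
    intro g b
    have := (inferInstance : B.Normal).conj_mem b b.2 g⁻¹
    simpa using this
  let act : MulAction G Y :=
    { smul := fun g χ => ⟨fun b => χ.1 ⟨g⁻¹ * b * g, hconj g b⟩, by
        obtain ⟨v, hv, hv0⟩ := Submodule.exists_mem_ne_zero_of_ne_bot χ.2
        rw [Submodule.ne_bot_iff]
        refine ⟨ρ g v, ?_, ?_⟩
        · rw [hE] at hv ⊢
          intro b
          have h1 := hv ⟨g⁻¹ * b * g, hconj g b⟩
          have h2 : ρ b (ρ g v) = ρ g (ρ (g⁻¹ * b * g) v) := by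
            rw [← Module.End.mul_apply, ← Module.End.mul_apply, ← map_mul, ← map_mul]
            congr 2; group
          rw [h2]
          rw [show ρ (g⁻¹ * b * g) v = _ from h1, map_smul]
        · intro h0
          apply hv0
          have : ρ g⁻¹ (ρ g v) = v := by
            rw [← Module.End.mul_apply, ← map_mul]; simp
          rw [← this, h0, map_zero]⟩
      one_smul := by
        intro χ
        apply Subtype.ext
        funext b
        change χ.1 _ = χ.1 _
        refine congrArg χ.1 (Subtype.ext ?_); simp
      mul_smul := by
        intro g h χ
        apply Subtype.ext
        funext b
        change χ.1 _ = χ.1 _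
        refine congrArg χ.1 (Subtype.ext ?_); simp [mul_assoc] }
  have htriv := hY Y hYc (MulAction.toPermHom G Y)
  have hχ : ∀ (g : G) (χ : Y) (b : B), χ.1 ⟨g⁻¹ * b * g, hconj g b⟩ = χ.1 b := by
    intro g χ b
    have h1 : MulAction.toPermHom G Y g χ = χ := by rw [htriv]; rfl
    have h2 : (g • χ : Y) = χ := h1
    exact congrFun (congrArg Subtype.val h2) b
  intro b hb g
  have key : ρ (g⁻¹ * b * g) = ρ b := by
    have : (⊤ : Submodule k V) ≤ LinearMap.eqLocus (ρ (g⁻¹ * b * g)) (ρ b) := by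
      rw [← htop]
      apply iSup_le
      intro χ v hv
      by_cases h : E χ = ⊥
      · rw [h] at hv
        have : v = 0 := by simpa using hv
        rw [this]; exact Submodule.zero_mem _
      · rw [LinearMap.mem_eqLocus]
        rw [hE] at hv
        have h1 := hv ⟨g⁻¹ * b * g, hconj g ⟨b, hb⟩⟩
        have h2 := hv ⟨b, hb⟩
        rw [show ρ (g⁻¹ * b * g) v = _ from h1, show ρ b v = _ from h2]
        congr 1
        exact hχ g ⟨χ, h⟩ ⟨b, hb⟩
    ext v
    exact this (Submodule.mem_top (x := v))
  have h3 := hρ key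
  have : g * (g⁻¹ * b * g) = b * g := by group
  rw [← this, h3]

theorem eigen_count (ρ : G →* End k V) (hρ : Function.Injective ρ) (p : ℕ) [Fact p.Prime]
    (hp : (p : k) ≠ 0) (x s : G) (hx : x ^ p = 1) (hx1 : x ≠ 1) (g : (ZMod p)ˣ)
    (hg : ∀ u : (ZMod p)ˣ, ∃ i : ℕ, g ^ i = u) (hs : s * x * s⁻¹ = x ^ (g : ZMod p).val) :
    ∃ (ζ : (ZMod p)ˣ → k) (v : (ZMod p)ˣ → V), Function.Injective ζ ∧
      ∀ u, (ρ x).HasEigenvector (ζ u) (v u) := by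
  classical
  have hpow : (ρ x) ^ p = 1 := by rw [← map_pow, hx, map_one]
  have h1 : ∃ μ : k, μ ≠ 1 ∧ (ρ x).eigenspace μ ≠ ⊥ := by
    by_contra hcon
    push Not at hcon
    apply hx1
    apply hρ
    rw [map_one]
    have htop := Module.End.iSup_maxGenEigenspace_eq_top (ρ x)
    have : (⊤ : Submodule k V) ≤ LinearMap.eqLocus (ρ x) 1 := by
      rw [← htop]
      apply iSup_le
      intro μ v hv
      rw [mem_maxGen _ p hp hpow] at hv
      rw [LinearMap.mem_eqLocus]
      by_cases hμ : μ = 1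
      · rw [hv, hμ]; simp
      · have h2 := hcon μ hμ
        have h3 : v ∈ (ρ x).eigenspace μ := Module.End.mem_eigenspace_iff.2 hv
        rw [h2] at h3
        have : v = 0 := by simpa using h3
        rw [this]; simp
    ext v
    exact this (Submodule.mem_top (x := v))
  obtain ⟨μ, hμ1, hμ⟩ := h1
  obtain ⟨v, hv, hv0⟩ := Submodule.exists_mem_ne_zero_of_ne_bot hμ
  rw [Module.End.mem_eigenspace_iff] at hv
  have hvpow : ∀ j : ℕ, (ρ (x ^ j)) v = μ ^ j • v := by
    intro j
    induction j with
    | zero => simp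
    | succ j ih =>
      rw [pow_succ', map_mul, Module.End.mul_apply, ih, map_smul, hv, smul_smul, pow_succ]
  have hμp : μ ^ p = 1 := by
    have := hvpow p
    rw [hx, map_one] at this
    have h2 : (μ ^ p - 1) • v = 0 := by
      rw [sub_smul, ← this]; simp
    rcases smul_eq_zero.1 h2 with h | h
    · exact sub_eq_zero.1 h
    · exact absurd h hv0
  have hord : orderOf μ = p := orderOf_eq_prime hμp hμ1
  have hxval : ∀ a b : ℕ, (a : ZMod p) = b → x ^ a = x ^ b := by
    intro a b hab
    rw [ZMod.natCast_eq_natCast_iff] at hab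
    rw [pow_eq_pow_iff_modEq]
    exact hab.of_dvd (orderOf_dvd_of_pow_eq_one hx)
  have hconj : ∀ i : ℕ, s ^ i * x * (s ^ i)⁻¹ = x ^ ((g ^ i : (ZMod p)ˣ) : ZMod p).val := by
    intro i
    induction i with
    | zero =>
      simp only [pow_zero, one_mul, inv_one, mul_one, Units.val_one]
      conv_lhs => rw [← pow_one x]
      apply hxval
      simp
    | succ i ih =>
      have e : s ^ (i + 1) * x * (s ^ (i+1))⁻¹ = s * (s ^ i * x * (s ^ i)⁻¹) * s⁻¹ := by
        rw [pow_succ']; group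
      rw [e, ih, ← conj_pow, hs, ← pow_mul]
      apply hxval
      push_cast
      simp [pow_succ, mul_comm]
  have hex : ∀ u : (ZMod p)ˣ, ∃ w : V, (ρ x).HasEigenvector (μ ^ (u : ZMod p).val) w := by
    intro u
    obtain ⟨i, hi⟩ := hg u
    refine ⟨ρ (s ^ i)⁻¹ v, ?_⟩
    rw [Module.End.hasEigenvector_iff, Module.End.mem_eigenspace_iff]
    constructor
    · rw [← hi]
      have e : ρ x (ρ (s ^ i)⁻¹ v) = ρ (s ^ i)⁻¹ (ρ (s ^ i * x * (s ^ i)⁻¹) v) := by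
        rw [← Module.End.mul_apply, ← Module.End.mul_apply, ← map_mul, ← map_mul]
        congr 2; group
      rw [e, hconj i, hvpow, map_smul]
    · intro h0
      apply hv0
      have : ρ (s ^ i) (ρ (s ^ i)⁻¹ v) = v := by
        rw [← Module.End.mul_apply, ← map_mul]; simp
      rw [← this, h0, map_zero]
  choose w hw using hex
  refine ⟨fun u => μ ^ (u : ZMod p).val, w, ?_, hw⟩
  intro a b hab
  simp only at hab
  have hpr := IsPrimitiveRoot.orderOf μ
  rw [hord] at hpr
  have := hpr.pow_inj (ZMod.val_lt _) (ZMod.val_lt _) hab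
  exact Units.ext (ZMod.val_injective p this)

theorem eigen_le (f : End k V) (p : ℕ) [Fact p.Prime] (ζ : (ZMod p)ˣ → k) (v : (ZMod p)ˣ → V)
    (hζ : Function.Injective ζ) (h : ∀ u, f.HasEigenvector (ζ u) (v u)) : p - 1 ≤ finrank k V := by
  have hli := Module.End.eigenvectors_linearIndependent' f ζ hζ v h
  have := hli.fintype_card_le_finrank
  rwa [ZMod.card_units] at this

theorem eigen_comm (ρ : G →* End k V) (hρ : Function.Injective ρ) (x : G)
    (p : ℕ) [Fact p.Prime] (ζ : (ZMod p)ˣ → k) (v : (ZMod p)ˣ → V)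
    (hζ : Function.Injective ζ) (h : ∀ u, (ρ x).HasEigenvector (ζ u) (v u))
    (hd : finrank k V = p - 1) (a b : G) (ha : a * x = x * a) (hb : b * x = x * b) :
    a * b = b * a := by
  classical
  have hli := Module.End.eigenvectors_linearIndependent' (ρ x) ζ hζ v h
  have hspan : Submodule.span k (Set.range v) = ⊤ := by
    apply hli.span_eq_top_of_card_eq_finrank'
    rw [ZMod.card_units, hd]
  have hind := Module.End.eigenspaces_iSupIndep (ρ x)
  have one : ∀ (u : (ZMod p)ˣ) (w : V), ρ x w = ζ u • w → ∃ c : k, w = c • v u := by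
    intro u w hw
    have hwm : w ∈ Submodule.span k (Set.range v) := by rw [hspan]; trivial
    obtain ⟨c, hc⟩ := (Submodule.mem_span_range_iff_exists_fun k).1 hwm
    refine ⟨c u, ?_⟩
    rw [← sub_eq_zero]
    have h1 : w - c u • v u ∈ (ρ x).eigenspace (ζ u) := by
      apply Submodule.sub_mem
      · exact Module.End.mem_eigenspace_iff.2 hw
      · exact Submodule.smul_mem _ _ (h u).1
    have h2 : w - c u • v u ∈ ⨆ μ, ⨆ (_ : μ ≠ ζ u), (ρ x).eigenspace μ := by
      rw [← hc, ← Finset.add_sum_erase _ _ (Finset.mem_univ u), add_sub_cancel_left]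
      apply Submodule.sum_mem
      intro t ht
      apply Submodule.smul_mem
      have : ζ t ≠ ζ u := fun h => (Finset.ne_of_mem_erase ht) (hζ h)
      exact Submodule.mem_iSup_of_mem (ζ t) (Submodule.mem_iSup_of_mem this (h t).1)
    have := Submodule.disjoint_def.1 (hind (ζ u)) _ h1 h2
    exact this
  have ev : ∀ (y : G), y * x = x * y → ∀ u, ∃ c : k, ρ y (v u) = c • v u := by
    intro y hy u
    apply one
    rw [← Module.End.mul_apply, ← map_mul, ← hy, map_mul, Module.End.mul_apply]
    rw [Module.End.mem_eigenspace_iff.1 (h u).1, map_smul]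
  apply hρ
  have : (⊤ : Submodule k V) ≤ LinearMap.eqLocus (ρ (a * b)) (ρ (b * a)) := by
    rw [← hspan, Submodule.span_le]
    rintro _ ⟨u, rfl⟩
    obtain ⟨α, hα⟩ := ev a ha u
    obtain ⟨β, hβ⟩ := ev b hb u
    simp only [SetLike.mem_coe, LinearMap.mem_eqLocus]
    rw [map_mul, map_mul, Module.End.mul_apply, Module.End.mul_apply, hα, hβ, map_smul, map_smul,
      hα, hβ, smul_comm]
  ext w
  exact this (Submodule.mem_top (x := w))

end
end Reg



namespace Reg
open Subgroup Module

theorem pgroup_comm {R : Type} [Group R] [Finite R] {p : ℕ} [Fact p.Prime] (hR : IsPGroup p R)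
    (h : ∀ B : Subgroup R, B.Normal → (∀ a ∈ B, ∀ b ∈ B, a * b = b * a) → B ≤ center R) :
    ∀ a b : R, a * b = b * a := by
  by_cases htop : center R = ⊤
  · intro a b
    have : b ∈ center R := by rw [htop]; trivial
    exact (mem_center_iff.1 this a)
  exfalso
  have hnt : Nontrivial (R ⧸ center R) := by
    rw [← not_subsingleton_iff_nontrivial]
    intro hs
    exact htop (QuotientGroup.subsingleton_iff.1 hs)
  have := (hR.to_quotient (center R)).center_nontrivial
  obtain ⟨⟨q, hq⟩, hq1⟩ := exists_ne (1 : center (R ⧸ center R))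
  obtain ⟨x, rfl⟩ := QuotientGroup.mk'_surjective _ q
  have hx : x ∉ center R := by
    intro hx
    apply hq1
    apply Subtype.ext
    exact (QuotientGroup.eq_one_iff x).2 hx
  apply hx
  let B : Subgroup R := (zpowers (QuotientGroup.mk' (center R) x)).comap (QuotientGroup.mk' (center R))
  have hBn : B.Normal := by
    have : (zpowers (QuotientGroup.mk' (center R) x)).Normal := by
      constructor
      intro y hy g
      have hyc : y ∈ center (R ⧸ center R) := (zpowers_le.2 hq) hy
      have : g * y * g⁻¹ = y := by rw [mem_center_iff.1 hyc g]; group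
      rw [this]; exact hy
    exact this.comap _
  have hBe : ∀ a ∈ B, ∃ (i : ℤ) (z : R), z ∈ center R ∧ a = x ^ i * z := by
    intro a ha
    obtain ⟨i, hi⟩ := ha
    refine ⟨i, (x ^ i)⁻¹ * a, ?_, by group⟩
    simp only [← map_zpow, QuotientGroup.mk'_apply] at hi
    exact QuotientGroup.eq.1 hi
  refine h B hBn ?_ (mem_zpowers _)
  intro a ha b hb
  obtain ⟨i, z, hz, rfl⟩ := hBe a ha
  obtain ⟨j, w, hw, rfl⟩ := hBe b hb
  have h1 : Commute (x ^ i) (x ^ j) := Commute.zpow_zpow_self x i j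
  have hz' : ∀ t, Commute z t := fun t => (mem_center_iff.1 hz t).symm
  have hw' : ∀ t, Commute t w := fun t => (mem_center_iff.1 hw t)
  exact ((h1.mul_right (hw' _)).mul_left ((hz' _)))

theorem bcore_min {k V G S : Type} [Field k] [IsAlgClosed k] [AddCommGroup V] [Module k V]
    [FiniteDimensional k V] [Group G] [Finite G] [Group S] [IsSimpleGroup S] [Finite S]
    (ρ : G →* End k V) (hρ : Function.Injective ρ) (φ : G →* S) (hφ : Function.Surjective φ)
    (hmin : ∀ K : Subgroup G, K.map φ = ⊤ → K = ⊤)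
    (p : ℕ) [Fact p.Prime] (hp : (p : k) ≠ 0) (hdp : finrank k V < p)
    (hfac : (finrank k V).factorial < Nat.card S)
    (c s0 : S) (hc : orderOf c = p) (g : (ZMod p)ˣ) (hg1 : g ≠ 1)
    (hg : ∀ u : (ZMod p)ˣ, ∃ i : ℕ, g ^ i = u) (hs0 : s0 * c * s0⁻¹ = c ^ (g : ZMod p).val) :
    p - 1 ≤ finrank k V ∧ (finrank k V = p - 1 → Group.IsSolvable (centralizer {c})) := by
  set K := φ.ker with hK
  obtain ⟨P⟩ : Nonempty (Sylow p K) := inferInstance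
  set R : Subgroup G := P.toSubgroup.map K.subtype with hR
  have hRK : R ≤ K := map_subtype_le _
  have hRp : IsPGroup p R := P.2.map _
  have hKN : ∀ γ : G, γ ∈ normalizer (K : Set G) := fun γ => by
    rw [normalizer_eq_top]; trivial
  have hRN : normalizer (R : Set G) = ⊤ := by
    apply hmin
    rw [eq_top_iff]
    intro s _
    obtain ⟨γ, rfl⟩ := hφ s
    obtain ⟨u, hu, huR⟩ := frattini_elt P (hKN γ)
    refine ⟨u * γ, huR, ?_⟩
    have : φ u = 1 := hu
    rw [map_mul, this, one_mul]
  have hRn : R.Normal := normalizer_eq_top_iff.1 hRN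
  have hmemR : ∀ y ∈ K, (∃ j, orderOf y = p ^ j) → y ∈ R := by
    rintro y hy ⟨j, hj⟩
    have hpg : IsPGroup p (zpowers (⟨y, hy⟩ : K)) := by
      apply IsPGroup.of_card (n := j)
      rw [Nat.card_zpowers, Subgroup.orderOf_mk, hj]
    obtain ⟨P', hP'⟩ := hpg.exists_le_sylow
    obtain ⟨u, hu⟩ := MulAction.exists_smul_eq K P P'
    have h1 : (⟨y, hy⟩ : K) ∈ u • P := by rw [hu]; exact hP' (mem_zpowers _)
    obtain ⟨z, hz, hzy⟩ := h1
    have h2 : (u : G) * z * (u : G)⁻¹ ∈ R := hRn.conj_mem _ ⟨z, hz, rfl⟩ _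
    have h3 : (u : G) * z * (u : G)⁻¹ = y := congrArg Subtype.val hzy
    rwa [← h3]
  have homtriv : ∀ (Y : Type) [Finite Y], Nat.card Y ≤ finrank k V →
      ∀ θ : G →* Equiv.Perm Y, θ = 1 := by
    intro Y _ hYd θ
    have hn : (θ.ker.map φ).Normal := Subgroup.Normal.map inferInstance φ hφ
    rcases hn.eq_bot_or_eq_top with h0 | h1
    · exfalso
      have hle : θ.ker ≤ φ.ker := by
        intro x hx
        have : φ x ∈ θ.ker.map φ := ⟨x, hx, rfl⟩
        rw [h0] at this
        exact this
      have h2 := index_dvd_of_le hle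
      rw [index_ker, index_ker, MonoidHom.range_eq_top_of_surjective φ hφ, card_top] at h2
      have h3 := h2.trans (card_subgroup_dvd_card θ.range)
      rw [Nat.card_perm] at h3
      have h4 := Nat.le_of_dvd (Nat.factorial_pos _) h3
      have h5 := Nat.factorial_le hYd
      omega
    · have := hmin _ h1
      ext x : 1
      have hx : x ∈ θ.ker := by rw [this]; trivial
      exact hx
  have hpk : ∀ j : ℕ, ((p ^ j : ℕ) : k) ≠ 0 := by
    intro j; push_cast; exact pow_ne_zero _ hp
  have hRm : ∀ b ∈ R, ∃ m : ℕ, (m : k) ≠ 0 ∧ b ^ m = 1 := by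
    intro b hb
    obtain ⟨j, hj⟩ := hRp ⟨b, hb⟩
    exact ⟨p ^ j, hpk j, congrArg Subtype.val hj⟩
  have hRc : ∀ a b : R, a * b = b * a := by
    apply pgroup_comm hRp
    intro B hBn hBc b hb
    rw [mem_center_iff]
    refine fun g => lemmaW (ρ.comp R.subtype) (hρ.comp R.subtype_injective) B hBc ?_ ?_ b hb g
    · intro b hb
      obtain ⟨m, h1, h2⟩ := hRm b b.2
      exact ⟨m, h1, Subtype.ext h2⟩
    · intro Y _ hYd θ
      have h1 : IsPGroup p θ.range := hRp.of_surjective θ.rangeRestrict θ.rangeRestrict_surjective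
      obtain ⟨j, hj⟩ := IsPGroup.iff_card.1 h1
      have h2 := card_subgroup_dvd_card θ.range
      rw [Nat.card_perm, hj] at h2
      have hj0 : j = 0 := by
        by_contra hne
        have h3 := (dvd_pow_self p hne).trans h2
        have := (Nat.Prime.dvd_factorial Fact.out).1 h3
        omega
      rw [hj0, pow_zero] at hj
      have := Subgroup.eq_bot_of_card_eq _ hj
      exact MonoidHom.range_eq_bot_iff.1 this
  have hRz : ∀ b ∈ R, ∀ h : G, h * b = b * h :=
    lemmaW ρ hρ R (fun a ha b hb => congrArg Subtype.val (hRc ⟨a, ha⟩ ⟨b, hb⟩)) hRm homtriv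
  have hp1 : 1 < p := (Fact.out : p.Prime).one_lt
  have hct : ∃ ct : G, φ ct = c ∧ ∃ j, orderOf ct = p ^ j := by
    obtain ⟨x1, hx1⟩ := hφ c
    set N := orderOf x1
    have hN : N ≠ 0 := (orderOf_pos x1).ne'
    set m := ordCompl[p] N
    have hmp : Nat.Coprime m p := (Nat.coprime_ordCompl Fact.out hN).symm
    obtain ⟨m', -, hm'⟩ := Nat.exists_mul_mod_eq_one_of_coprime hmp hp1
    refine ⟨(x1 ^ m) ^ m', ?_, ?_⟩
    · rw [← pow_mul, map_pow, hx1]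
      conv_rhs => rw [← pow_one c]
      rw [pow_eq_pow_iff_modEq, hc]
      change _ % _ = _ % _
      rw [hm', Nat.mod_eq_of_lt hp1]
    · have : orderOf ((x1 ^ m) ^ m') ∣ p ^ (N.factorization p) := by
        apply orderOf_dvd_of_pow_eq_one
        have e1 : p ^ N.factorization p * m = N := Nat.ordProj_mul_ordCompl_eq_self N p
        have e2 : m * (m' * p ^ N.factorization p) = N * m' := by
          calc m * (m' * p ^ N.factorization p) = (p ^ N.factorization p * m) * m' := by ring
            _ = _ := by rw [e1]
        rw [← pow_mul, ← pow_mul, e2, pow_mul, pow_orderOf_eq_one, one_pow]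
      obtain ⟨j, _, hj⟩ := (Nat.dvd_prime_pow Fact.out).1 this
      exact ⟨j, hj⟩
  obtain ⟨ct, hct, jc, hjc⟩ := hct
  set Q : Subgroup G := (zpowers c).comap φ with hQ
  have hctQ : ct ∈ Q := by
    change φ ct ∈ zpowers c
    rw [hct]; exact mem_zpowers c
  have hpg : IsPGroup p (zpowers (⟨ct, hctQ⟩ : Q)) := by
    apply IsPGroup.of_card (n := jc)
    rw [Nat.card_zpowers, Subgroup.orderOf_mk, hjc]
  obtain ⟨Pt, hPt⟩ := hpg.exists_le_sylow
  set Rt : Subgroup G := Pt.toSubgroup.map Q.subtype with hRt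
  have hctR : ct ∈ Rt := ⟨⟨ct, hctQ⟩, hPt (mem_zpowers _), rfl⟩
  have hRtp : IsPGroup p Rt := Pt.2.map _
  have hRtK : ∀ y ∈ Rt, φ y = 1 → ∀ h : G, h * y = y * h := by
    intro y hy hy1
    apply hRz
    apply hmemR y hy1
    obtain ⟨j, hj⟩ := IsPGroup.iff_orderOf.1 hRtp ⟨y, hy⟩
    exact ⟨j, by rwa [Subgroup.orderOf_mk] at hj⟩
  have F : ∀ u : S, u * c * u⁻¹ ∈ zpowers c → ∃ h ∈ normalizer (Rt : Set G), ∃ j : ℤ,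
      φ h = c ^ j * u := by
    intro u hu
    obtain ⟨γ, rfl⟩ := hφ u
    have hγ : γ ∈ normalizer (Q : Set G) := by
      apply mem_normalizer_of_conj
      rintro y ⟨i, hi⟩
      change φ (γ * y * γ⁻¹) ∈ zpowers c
      simp only at hi
      rw [map_mul, map_mul, map_inv, ← hi, ← conj_zpow]
      exact zpow_mem hu i
    obtain ⟨q, hq, hqR⟩ := frattini_elt Pt hγ
    obtain ⟨j, hj⟩ : φ q ∈ zpowers c := hq
    exact ⟨q * γ, hqR, j, by rw [map_mul, ← hj]⟩
  set gv := (g : ZMod p).val with hgv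
  obtain ⟨s, hsN, js, hjs⟩ := F s0 (by rw [hs0]; exact npow_mem_zpowers c gv)
  have hsc : φ s * c * (φ s)⁻¹ = c ^ gv := by
    rw [hjs]
    have : c ^ js * s0 * c * (c ^ js * s0)⁻¹ = c ^ js * (s0 * c * s0⁻¹) * (c ^ js)⁻¹ := by group
    rw [this, hs0]
    have h2 : Commute (c ^ js) (c ^ gv) := (Commute.self_pow c gv).zpow_left js
    rw [h2.eq]; group
  set a := s * ct * s⁻¹ with ha
  have haR : a ∈ Rt := conj_mem_of_mem_normalizer hsN hctR
  set y := (ct ^ gv)⁻¹ * a with hy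
  have hyR : y ∈ Rt := mul_mem (inv_mem (pow_mem hctR gv)) haR
  have hφa : φ a = c ^ gv := by rw [ha, map_mul, map_mul, map_inv, hct, hsc]
  have hy1 : φ y = 1 := by rw [hy, map_mul, map_inv, map_pow, hct, hφa]; simp
  have hyz := hRtK y hyR hy1
  have hay : a = ct ^ gv * y := by rw [hy]; group
  have hac : Commute a ct := by
    rw [hay]
    exact ((Commute.self_pow ct gv).symm).mul_left (hyz ct).symm
  set x := a * ct⁻¹ with hx
  have hxR : x ∈ Rt := mul_mem haR (inv_mem hctR)
  have hφx : φ x = c ^ gv * c⁻¹ := by rw [hx, map_mul, map_inv, hct, hφa]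
  have hxp : x ^ p = 1 := by
    have h1 : φ (ct ^ p) = 1 := by rw [map_pow, hct, ← hc, pow_orderOf_eq_one]
    have h2 := hRtK _ (pow_mem hctR p) h1 s
    have h3 : a ^ p = ct ^ p := by
      rw [ha, conj_pow, h2]; group
    rw [hx, hac.inv_right.mul_pow, h3, inv_pow]; group
  have hx1 : x ≠ 1 := by
    intro h0
    rw [h0, map_one] at hφx
    have h1 : c ^ gv = c ^ 1 := by rw [pow_one]; exact (mul_inv_eq_one.1 hφx.symm)
    rw [pow_eq_pow_iff_modEq, hc] at h1
    apply hg1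
    apply Units.ext
    have := (ZMod.natCast_eq_natCast_iff _ _ _).2 h1
    simpa [hgv] using this
  have hsx : s * x * s⁻¹ = x ^ gv := by
    have e1 : s * x * s⁻¹ = (s * a * s⁻¹) * a⁻¹ := by rw [hx, ha]; group
    have e2 : s * a * s⁻¹ = a ^ gv * y := by
      conv_lhs => rw [hay]
      have : s * (ct ^ gv * y) * s⁻¹ = (s * ct ^ gv * s⁻¹) * (s * y * s⁻¹) := by group
      rw [this, ← conj_pow, ← ha, hyz s]; group
    have e3 : a⁻¹ = y⁻¹ * (ct ^ gv)⁻¹ := by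
      conv_lhs => rw [hay]
      rw [mul_inv_rev]
    rw [e1, e2, e3, hx, hac.inv_right.mul_pow, inv_pow]; group
  obtain ⟨ζ, v, hζ, hev⟩ := eigen_count ρ hρ p hp x s hxp hx1 g hg hsx
  refine ⟨eigen_le (ρ x) p ζ v hζ hev, ?_⟩
  intro hd
  have hcomm := eigen_comm ρ hρ x p ζ v hζ hev hd
  let Q2 : Subgroup G := (centralizer {QuotientGroup.mk' R x}).comap (QuotientGroup.mk' R)
  have hQ2 : ∀ h : G, h ∈ Q2 ↔ h * x * h⁻¹ * x⁻¹ ∈ R := by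
    intro h
    rw [mem_comap, mem_centralizer_singleton_iff, ← map_mul, ← map_mul]
    simp only [QuotientGroup.mk'_apply]
    rw [eq_comm, QuotientGroup.eq]
    have e : (x * h)⁻¹ * (h * x) = (x * h)⁻¹ * (h * x * h⁻¹ * x⁻¹) * (x * h) := by group
    constructor
    · intro h1
      have := hRn.conj_mem _ h1 (x * h)
      rw [e] at this
      convert this using 1; group
    · intro h1
      rw [e]
      have := hRn.conj_mem _ h1 (x * h)⁻¹
      convert this using 1; group
  have hsol : Group.IsSolvable Q2 := by
    let f : Q2 →* R := MonoidHom.mk' (fun h => ⟨h * x * (h:G)⁻¹ * x⁻¹, (hQ2 h).1 h.2⟩) (by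
      intro h1 h2
      apply Subtype.ext
      simp only [Subgroup.coe_mul]
      have e1 : ((h1:G) * h2) * x * ((h1:G) * h2)⁻¹ * x⁻¹ =
        h1 * ((h2:G) * x * (h2:G)⁻¹ * x⁻¹) * (x * (h1:G)⁻¹ * x⁻¹) := by group
      have e2 := hRz _ ((hQ2 h2).1 h2.2) (h1 : G)
      have e3 := hRz _ ((hQ2 h2).1 h2.2) (h1 * x * (h1:G)⁻¹ * x⁻¹)
      rw [e1, e2, e3]; group)
    have : Group.IsSolvable R := Group.isSolvable_of_comm hRc
    have : Group.IsSolvable f.ker := by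
      apply Group.isSolvable_of_comm
      intro h1 h2
      have key : ∀ h : f.ker, (h : G) * x = x * h := by
        intro h
        have h3 : f h = 1 := h.2
        have h4 : (h:G) * x * (h:G)⁻¹ * x⁻¹ = 1 := congrArg Subtype.val h3
        rwa [mul_inv_eq_one, mul_inv_eq_iff_eq_mul] at h4
      apply Subtype.ext
      apply Subtype.ext
      exact hcomm _ _ (key h1) (key h2)
    exact Group.isSolvable_of_ker_le_range f.ker.subtype f (by rw [range_subtype])
  have hle : centralizer {c} ≤ Q2.map φ := by
    intro u hu
    have huc : u * c = c * u := mem_centralizer_singleton_iff.1 hu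
    obtain ⟨h, hh, j, hj⟩ := F u (by rw [huc]; simpa using mem_zpowers c)
    have hhQ : h ∈ Q2 := by
      rw [hQ2]
      apply hmemR
      · change φ _ = 1
        simp only [map_mul, map_inv, hφx, hj]
        have h1 : Commute (c ^ j * u) (c ^ gv * c⁻¹) := by
          have hu' : Commute u c := huc
          have h3 : Commute (c ^ j * u) c :=
            ((Commute.refl c).zpow_left j).mul_left hu'
          exact (h3.pow_right gv).mul_right h3.inv_right
        rw [h1.eq]; group
      · have : h * x * h⁻¹ * x⁻¹ ∈ Rt :=
          mul_mem (conj_mem_of_mem_normalizer hh hxR) (inv_mem hxR)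
        obtain ⟨i, hi⟩ := IsPGroup.iff_orderOf.1 hRtp ⟨_, this⟩
        exact ⟨i, by rwa [Subgroup.orderOf_mk] at hi⟩
    have hcQ : ct ∈ Q2 := by
      rw [hQ2]
      have h1 : Commute ct x := (hac.symm).mul_right (Commute.refl ct).inv_right
      rw [h1.eq]; simp
    refine ⟨ct ^ (-j) * h, mul_mem (zpow_mem hcQ _) hhQ, ?_⟩
    rw [map_mul, map_zpow, hct, hj]; group
  have : Group.IsSolvable (Q2.map φ) :=
    Group.isSolvable_of_surjective (φ.subgroupMap_surjective Q2)
  exact Group.isSolvable_of_isSolvable_injective (Subgroup.inclusion_injective hle)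

theorem bcore {k V G S : Type} [Field k] [IsAlgClosed k] [AddCommGroup V] [Module k V]
    [FiniteDimensional k V] [Group G] [Finite G] [Group S] [IsSimpleGroup S] [Finite S]
    (ρ : G →* End k V) (hρ : Function.Injective ρ) (φ : G →* S) (hφ : Function.Surjective φ)
    (p : ℕ) [Fact p.Prime] (hp : (p : k) ≠ 0) (hdp : finrank k V < p)
    (hfac : (finrank k V).factorial < Nat.card S)
    (c s0 : S) (hc : orderOf c = p) (g : (ZMod p)ˣ) (hg1 : g ≠ 1)
    (hg : ∀ u : (ZMod p)ˣ, ∃ i : ℕ, g ^ i = u) (hs0 : s0 * c * s0⁻¹ = c ^ (g : ZMod p).val) :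
    p - 1 ≤ finrank k V ∧ (finrank k V = p - 1 → Group.IsSolvable (centralizer {c})) := by
  classical
  have hex : ∃ m, ∃ H : Subgroup G, Nat.card H = m ∧ H.map φ = ⊤ :=
    ⟨_, ⊤, rfl, by rw [← MonoidHom.range_eq_map]; exact MonoidHom.range_eq_top_of_surjective φ hφ⟩
  obtain ⟨H, hH, hHφ⟩ := Nat.find_spec hex
  refine bcore_min (ρ.comp H.subtype) (hρ.comp H.subtype_injective) (φ.comp H.subtype) ?_ ?_
    p hp hdp hfac c s0 hc g hg1 hg hs0
  · intro s
    have : s ∈ H.map φ := by rw [hHφ]; trivial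
    obtain ⟨h, hh, rfl⟩ := this
    exact ⟨⟨h, hh⟩, rfl⟩
  · intro K hK
    have h1 : (K.map H.subtype).map φ = ⊤ := by rw [Subgroup.map_map]; exact hK
    have h2 := Nat.find_min' hex ⟨K.map H.subtype, rfl, h1⟩
    rw [← hH, Nat.card_congr (K.equivMapOfInjective _ H.subtype_injective).symm.toEquiv] at h2
    exact Subgroup.eq_top_of_card_eq _ (le_antisymm (card_le_card_group K) h2)

end Reg

namespace Reg
open Subgroup Module

abbrev Al (n : ℕ) : Type := alternatingGroup (Fin n)

theorem al_simple {n : ℕ} (hn : 5 ≤ n) : IsSimpleGroup (Al n) :=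
  alternatingGroup.isSimpleGroup (by simpa using hn)

theorem al_noncomm {n : ℕ} (hn : 5 ≤ n) : ¬ ∀ a b : Al n, a * b = b * a := by
  intro h
  have h1 : center (alternatingGroup (Fin n)) = ⊥ :=
    alternatingGroup.center_eq_bot (by simp; omega)
  have h2 : center (alternatingGroup (Fin n)) = ⊤ := by
    rw [eq_top_iff]
    intro x _
    rw [mem_center_iff]
    exact fun g => h g x
  have := (al_simple hn).toNontrivial
  exact bot_ne_top (h1.symm.trans h2)

theorem al_not_solvable {n : ℕ} (hn : 5 ≤ n) : ¬ Group.IsSolvable (Al n) := by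
  intro h
  have := al_simple hn
  exact al_noncomm hn (IsSimpleGroup.comm_iff_isSolvable.2 h)

theorem al_card {n : ℕ} (hn : 5 ≤ n) : 2 * Nat.card (Al n) = n.factorial := by
  have : Nontrivial (Fin n) := Fin.nontrivial_iff_two_le.2 (by omega)
  have := two_mul_nat_card_alternatingGroup (α := Fin n)
  rw [this, Nat.card_perm, Nat.card_fin]

theorem exists_pcycle {n p : ℕ} (hp : p.Prime) (hp3 : 3 ≤ p) (hpn : p ≤ n) :
    ∃ c : Al n, (c : Equiv.Perm (Fin n)).IsCycle ∧ orderOf c = p ∧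
      ∀ i : Fin n, p ≤ i → (c : Equiv.Perm (Fin n)) i = i := by
  have : NeZero n := ⟨by omega⟩
  have hpn' : p - 1 < n := by omega
  have h0 : (⟨p - 1, hpn'⟩ : Fin n) ≠ 0 := by
    intro h
    have := congrArg Fin.val h
    simp at this
    omega
  have hc := Fin.isCycle_cycleRange h0
  have hord : orderOf (Fin.cycleRange ⟨p - 1, hpn'⟩) = p := by
    rw [← Equiv.Perm.lcm_cycleType, Fin.cycleType_cycleRange h0]
    simp; omega
  refine ⟨⟨Fin.cycleRange ⟨p - 1, hpn'⟩, ?_⟩, hc, ?_, ?_⟩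
  · rw [Equiv.Perm.mem_alternatingGroup, Fin.sign_cycleRange]
    have : Odd p := hp.odd_of_ne_two (by omega)
    apply Even.neg_one_pow
    simp
    obtain ⟨k, hk⟩ := this
    exact ⟨k, by omega⟩
  · rw [Subgroup.orderOf_mk, hord]
  · intro i hi
    apply Fin.cycleRange_of_gt
    rw [Fin.lt_def]
    simp; omega

theorem centralizer_not_solvable {n p : ℕ} (hpn : p + 5 ≤ n) (c : Al n)
    (hc : ∀ i : Fin n, p ≤ i → (c : Equiv.Perm (Fin n)) i = i) :
    ¬ Group.IsSolvable (centralizer {c} : Subgroup (Al n)) := by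
  intro h
  let ι : Fin 5 ↪ Fin n := ⟨fun i => ⟨p + i, by omega⟩, fun i j hij => by
    simp [Fin.ext_iff] at hij; exact Fin.ext hij⟩
  let f1 : Al 5 →* Al n := ((Equiv.Perm.viaEmbeddingHom ι).comp
    (alternatingGroup (Fin 5)).subtype).codRestrict (alternatingGroup (Fin n)) (by
      intro x
      change Equiv.Perm.viaEmbeddingHom ι x.1 ∈ _
      rw [Equiv.Perm.mem_alternatingGroup, Equiv.Perm.viaEmbeddingHom_apply,
        Equiv.Perm.viaEmbedding]
      have := Equiv.Perm.mem_alternatingGroup.1 x.2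
      rw [Equiv.Perm.sign_extendDomain]
      exact this)
  have hf1 : Function.Injective f1 := by
    intro x y hxy
    have := congrArg Subtype.val hxy
    exact Subtype.ext (Equiv.Perm.viaEmbeddingHom_injective ι this)
  have hcen : ∀ x, f1 x ∈ (centralizer {c} : Subgroup (Al n)) := by
    intro x
    rw [mem_centralizer_singleton_iff]
    apply Subtype.ext
    have hd : Equiv.Perm.Disjoint (f1 x).1 c.1 := by
      intro i
      by_cases hi : p ≤ i
      · right; exact hc i hi
      · left
        apply Equiv.Perm.viaEmbedding_apply_of_notMem
        rintro ⟨j, rfl⟩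
        exact hi (Nat.le_add_right _ _)
    exact hd.commute.eq
  exact al_not_solvable le_rfl (Group.isSolvable_of_isSolvable_injective
    (f := f1.codRestrict _ hcen) (fun x y hxy => hf1 (congrArg Subtype.val hxy)))

theorem exists_gen {p : ℕ} [Fact p.Prime] (hp3 : 3 ≤ p) : ∃ g : (ZMod p)ˣ, g ≠ 1 ∧
    ∀ u : (ZMod p)ˣ, ∃ i : ℕ, g ^ i = u := by
  obtain ⟨g, hg⟩ := IsCyclic.exists_monoid_generator (α := (ZMod p)ˣ)
  refine ⟨g, ?_, fun u => hg u⟩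
  rintro rfl
  have h1 : Nat.card (ZMod p)ˣ = 1 := by
    rw [Nat.card_eq_one_iff_unique]
    refine ⟨⟨fun a b => ?_⟩, ⟨1⟩⟩
    obtain ⟨i, hi⟩ := hg a
    obtain ⟨j, hj⟩ := hg b
    simp at hi hj
    rw [← hi, ← hj]
  rw [Nat.card_eq_fintype_card, ZMod.card_units] at h1
  omega

theorem exists_conj_pow {n p : ℕ} [Fact p.Prime] (hpn : p + 2 ≤ n) (c : Al n)
    (hc : (c : Equiv.Perm (Fin n)).IsCycle) (ho : orderOf c = p) (g : (ZMod p)ˣ) :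
    ∃ s0 : Al n, s0 * c * s0⁻¹ = c ^ (g : ZMod p).val := by
  have ho' : orderOf (c : Equiv.Perm (Fin n)) = p := by rw [Subgroup.orderOf_coe, ho]
  have hcop : (g : ZMod p).val.Coprime (orderOf (c : Equiv.Perm (Fin n))) := by
    rw [ho']; exact ZMod.val_coe_unit_coprime g
  have h1 : IsConj (c : Equiv.Perm (Fin n)) ((c ^ (g : ZMod p).val : Al n) : Equiv.Perm (Fin n)) := by
    apply hc.isConj
    · exact hc.pow_iff.2 hcop
    · rw [SubmonoidClass.coe_pow, Equiv.Perm.support_pow_coprime hcop]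
  have h2 := alternatingGroup.isConj_of h1 (by
    rw [← hc.orderOf, ho']; simpa using hpn)
  exact isConj_iff.1 h2

theorem lemmab {n p : ℕ} (hn : 5 ≤ n) (hp : p.Prime) (hp3 : 3 ≤ p) (hpn : p + 2 ≤ n)
    {F V : Type} [Field F] [AddCommGroup V] [Module F V] [Finite V] (hF : (p : F) ≠ 0)
    (hd : finrank F V + 2 ≤ p ∨ (finrank F V + 1 ≤ p ∧ p + 5 ≤ n)) :
    ¬ Inv (Al n) (End F V)ˣ := by
  rintro ⟨H, φ, hφ⟩
  have := al_simple hn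
  have : Fact p.Prime := ⟨hp⟩
  have : FiniteDimensional F V := Module.Finite.of_finite
  have : Finite (End F V) := Finite.of_injective (fun f : End F V => (f : V → V))
    DFunLike.coe_injective
  have : Finite (End F V)ˣ := inferInstance
  let k := AlgebraicClosure F
  let ρ : H →* End k (TensorProduct F k V) :=
    ((Module.End.baseChangeHom F k V : _ →ₐ[F] _) : End F V →* End k (TensorProduct F k V)).comp
      ((Units.coeHom _).comp H.subtype)
  have hρ : Function.Injective ρ := by
    intro x y hxy
    apply Subtype.ext
    apply Units.ext
    ext v
    have := congrArg (fun f : End k (TensorProduct F k V) => f (1 ⊗ₜ[F] v)) hxy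
    simp [ρ, Module.End.baseChangeHom] at this
    exact Module.FaithfullyFlat.tensorProduct_mk_injective (A := F) (B := k) V this
  have hkp : (p : k) ≠ 0 := by
    intro h
    apply hF
    apply (algebraMap F k).injective
    simpa using h
  have hfr : finrank k (TensorProduct F k V) = finrank F V := Module.finrank_baseChange
  obtain ⟨c, hc1, hc2, hc3⟩ := exists_pcycle (n := n) hp hp3 (by omega)
  obtain ⟨g, hg1, hg⟩ := exists_gen hp3
  obtain ⟨s0, hs0⟩ := exists_conj_pow hpn c hc1 hc2 g
  have hfac : (finrank k (TensorProduct F k V)).factorial < Nat.card (Al n) := by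
    rw [hfr]
    have h1 := al_card hn
    have h2 : (finrank F V).factorial ≤ (n - 3).factorial := Nat.factorial_le (by omega)
    obtain ⟨m, rfl⟩ : ∃ m, n = m + 3 := ⟨n - 3, by omega⟩
    rw [Nat.factorial_succ, Nat.factorial_succ, Nat.factorial_succ] at h1
    simp at h2
    have := Nat.factorial_pos m
    have h4 : 5 * (4 * (3 * m.factorial)) ≤ (m + 2 + 1) * ((m + 1 + 1) * ((m + 1) * m.factorial)) := by
      gcongr <;> omega
    omega
  obtain ⟨h1, h2⟩ := bcore ρ hρ φ hφ p hkp (by rw [hfr]; omega) hfac c s0 hc2 g hg1 hg hs0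
  rw [hfr] at h1 h2
  rcases hd with hd | ⟨hd, hd2⟩
  · omega
  · exact centralizer_not_solvable hd2 c hc3 (h2 (by omega))

end Reg

namespace Reg
open Subgroup Module

def GLT (S : Type) [Group S] (r k : ℕ) : Prop :=
  ∀ (V : Type) [AddCommGroup V] [Module (ZMod r) V] [Finite V], finrank (ZMod r) V ≤ k →
    ¬ Inv S (End (ZMod r) V)ˣ

theorem GLT.mono {S : Type} [Group S] {r k l : ℕ} (h : GLT S r k) (hl : l ≤ k) : GLT S r l :=
  fun V _ _ _ hV => h V (hV.trans hl)

theorem elem_aut_aux {S : Type} [Group S] {r k m : ℕ} [Fact r.Prime] (h : GLT S r k) (hm : m ≤ k)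
    (V : Type) [AddCommGroup V] [Finite V] [Module (ZMod r) V]
    (hV : Nat.card V = r ^ m) : ¬ Inv S (MulAut (Multiplicative V)) := by
  intro hI
  have hfr : finrank (ZMod r) V ≤ k := by
    have : Module.Finite (ZMod r) V := Module.Finite.of_finite
    have h1 := Module.natCard_eq_pow_finrank (K := ZMod r) (V := V)
    rw [Nat.card_zmod, hV] at h1
    have := Nat.pow_right_injective (Fact.out : r.Prime).two_le h1
    omega
  apply h V hfr
  let f : MulAut (Multiplicative V) →* End (ZMod r) V :=
    { toFun := fun α => AddMonoidHom.toZModLinearMap r (AddMonoidHom.toMultiplicative.symm α.toMonoidHom)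
      map_one' := by ext x; rfl
      map_mul' := fun a b => by ext x; rfl }
  refine hI.of_injective f.toHomUnits ?_
  intro α β hab
  have h1 := congrArg (fun u : (End (ZMod r) V)ˣ => u.val) hab
  ext v
  exact congrArg (fun u : End (ZMod r) V => Multiplicative.ofAdd (u v.toAdd)) h1

theorem elem_aut {S : Type} [Group S] {r k m : ℕ} [Fact r.Prime] (h : GLT S r k) (hm : m ≤ k)
    (V : Type) [i : Group V] [Finite V] (hc : ∀ a b : V, a * b = b * a) (hr : ∀ a : V, a ^ r = 1)
    (hV : Nat.card V = r ^ m) : ¬ Inv S (MulAut V) := by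
  let j : CommGroup V := { i with mul_comm := hc }
  have : Finite (Additive V) := inferInstanceAs (Finite V)
  letI : Module (ZMod r) (Additive V) :=
    AddCommGroup.zmodModule (fun x => congrArg Additive.ofMul (hr x.toMul))
  have h1 := elem_aut_aux h hm (Additive V) hV
  exact h1

theorem bprime {S : Type} [Group S] [IsSimpleGroup S] (hS : ¬ ∀ a b : S, a * b = b * a)
    {r k : ℕ} [Fact r.Prime] (h : GLT S r k) : ∀ m ≤ k,
    ∀ (B : Type) [Group B] [Finite B], Nat.card B = r ^ m → ¬ Inv S (MulAut B) := by
  intro m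
  induction m using Nat.strong_induction_on with
  | _ m ih =>
  intro hm B _ _ hB hI
  rcases Nat.eq_zero_or_pos m with h0 | hpos
  · rw [h0, pow_zero] at hB
    have : Subsingleton B := (Nat.card_eq_one_iff_unique.1 hB).1
    refine not_inv_of_comm hS (fun a b => ?_) hI
    ext x
    exact Subsingleton.elim _ _
  have hpg : IsPGroup r B := IsPGroup.of_card hB
  have hnt : Nontrivial B := by
    rw [← Finite.one_lt_card_iff_nontrivial, hB]
    exact Nat.one_lt_pow hpos.ne' (Fact.out : r.Prime).one_lt
  let V : Subgroup B := 
    { carrier := {z | z ∈ center B ∧ z ^ r = 1}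
      one_mem' := ⟨one_mem _, one_pow _⟩
      mul_mem' := by
        rintro a b ⟨ha, ha'⟩ ⟨hb, hb'⟩
        refine ⟨mul_mem ha hb, ?_⟩
        have : Commute a b := (mem_center_iff.1 hb a)
        rw [this.mul_pow, ha', hb', one_mul]
      inv_mem' := by
        rintro a ⟨ha, ha'⟩
        exact ⟨inv_mem ha, by rw [inv_pow, ha', inv_one]⟩ }
  have hVz : ∀ v ∈ V, ∀ b : B, b * v = v * b := fun v hv b => mem_center_iff.1 hv.1 b
  have hVch : V.Characteristic := by
    rw [characteristic_iff_le_comap]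
    rintro φ v ⟨hv, hv'⟩
    refine ⟨?_, ?_⟩
    · rw [mem_center_iff]
      intro g
      obtain ⟨g, rfl⟩ := φ.surjective g
      change φ g * φ v = φ v * φ g
      rw [← map_mul, ← map_mul, mem_center_iff.1 hv g]
    · change φ v ^ r = 1
      rw [← map_pow, hv', map_one]
  have hVn : V.Normal := inferInstance
  have hV1 : 1 < Nat.card V := by
    have := hpg.center_nontrivial
    have h1 : r ∣ Nat.card (center B) := by
      obtain ⟨j, hj⟩ := IsPGroup.iff_card.1 (hpg.to_subgroup (center B))
      rw [hj]
      apply dvd_pow_self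
      rintro rfl
      rw [pow_zero] at hj
      have := (Nat.card_eq_one_iff_unique.1 hj).1
      exact not_subsingleton _ this
    obtain ⟨x, hx⟩ := exists_prime_orderOf_dvd_card' r h1
    rw [Finite.one_lt_card_iff_nontrivial, Subgroup.nontrivial_iff_exists_ne_one]
    refine ⟨x, ⟨x.2, ?_⟩, ?_⟩
    · have := pow_orderOf_eq_one x
      rw [hx] at this
      exact congrArg Subtype.val this
    · intro h
      have : x = 1 := Subtype.ext h
      rw [this, orderOf_one] at hx
      exact (Fact.out : r.Prime).one_lt.ne hx
  obtain ⟨d, hd⟩ := IsPGroup.iff_card.1 (hpg.to_subgroup V)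
  have hd0 : d ≠ 0 := by rintro rfl; rw [pow_zero] at hd; omega
  have hq := V.card_eq_card_quotient_mul_card_subgroup
  have hqp : IsPGroup r (B ⧸ V) := hpg.to_quotient V
  obtain ⟨e, he⟩ := IsPGroup.iff_card.1 hqp
  rw [hB, he, hd, ← pow_add] at hq
  have hq := Nat.pow_right_injective (Fact.out : r.Prime).two_le hq
  let f : MulAut B →* MulAut (B ⧸ V) :=
    { toFun := fun α => QuotientGroup.congr V V α (characteristic_iff_map_eq.1 hVch α)
      map_one' := by
        ext x
        obtain ⟨x, rfl⟩ := QuotientGroup.mk_surjective x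
        rfl
      map_mul' := by
        intro α β
        ext x
        obtain ⟨x, rfl⟩ := QuotientGroup.mk_surjective x
        rfl }
  rcases hI.ext f with hI | hI
  swap
  · exact ih e (by omega) (by omega) (B ⧸ V) he hI
  let g : f.ker →* MulAut V := (MulAut.characteristic V).comp f.ker.subtype
  rcases hI.ext g with hI | hI
  swap
  · refine elem_aut h (by omega : d ≤ k) V ?_ ?_ hd hI
    · intro a b
      exact Subtype.ext (hVz b b.2 a)
    · intro a
      exact Subtype.ext a.2.2
  refine not_inv_of_comm hS (fun α β => ?_) hI
  have key : ∀ α : g.ker, ∀ b : B, ∃ v ∈ V, α.1.1 b = b * v := by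
    intro α b
    have h1 : f α.1.1 = 1 := α.1.2
    have h2 := congrArg (fun a : MulAut (B ⧸ V) => a (b : B ⧸ V)) h1
    have h3 : ((α.1.1 b : B) : B ⧸ V) = (b : B ⧸ V) := h2
    exact ⟨b⁻¹ * α.1.1 b, QuotientGroup.eq.1 h3.symm, by group⟩
  have key2 : ∀ α : g.ker, ∀ v ∈ V, α.1.1 v = v := by
    intro α v hv
    have h1 : g α.1 = 1 := α.2
    exact congrArg (fun a : MulAut V => (a ⟨v, hv⟩ : B)) h1
  apply Subtype.ext
  apply Subtype.ext
  ext b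
  change α.1.1 (β.1.1 b) = β.1.1 (α.1.1 b)
  obtain ⟨v, hv, hav⟩ := key α b
  obtain ⟨w, hw, hbw⟩ := key β b
  rw [hav, hbw, map_mul, map_mul, hav, hbw, key2 α w hw, key2 β v hv, mul_assoc, mul_assoc,
    hVz w hw v]

end Reg

namespace Reg
open Subgroup Module

theorem lemmab' {n p r k : ℕ} (hn : 5 ≤ n) (hp : p.Prime) (hp3 : 3 ≤ p) (hpn : p + 2 ≤ n)
    (hr : r.Prime) (hrp : r ≠ p) (hd : k + 2 ≤ p ∨ (k + 1 ≤ p ∧ p + 5 ≤ n)) :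
    GLT (Al n) r k := by
  have : Fact r.Prime := ⟨hr⟩
  intro V _ _ _ hV
  refine lemmab hn hp hp3 hpn ?_ (by omega)
  intro h
  rw [ZMod.natCast_eq_zero_iff] at h
  exact hrp ((Nat.prime_dvd_prime_iff_eq hr hp).1 h)

theorem val_le {r m : ℕ} (hr : r.Prime) (hm : m ≠ 0) :
    (r - 1) * padicValNat r m.factorial + 1 ≤ m := by
  have : Fact r.Prime := ⟨hr⟩
  exact sub_one_mul_padicValNat_factorial_lt_of_ne_zero r hm

theorem val_two {p : ℕ} (hp : p.Prime) (hp3 : 3 ≤ p) :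
    padicValNat 2 (2 * p).factorial + 2 ≤ 2 * p := by
  have := padicValNat_factorial_mul (p := 2) p
  rw [this]
  obtain ⟨m, rfl⟩ : ∃ m, p = m + 1 := ⟨p - 1, by omega⟩
  rw [Nat.factorial_succ, padicValNat.mul (by omega) (Nat.factorial_ne_zero m)]
  have h1 : padicValNat 2 (m + 1) = 0 := by
    apply padicValNat.eq_zero_of_not_dvd
    intro h
    have := (Nat.prime_dvd_prime_iff_eq Nat.prime_two hp).1 h
    omega
  have h2 := val_le Nat.prime_two (m := m) (by omega)
  omega

theorem nums_big {n : ℕ} (hn : 11 ≤ n) : ∃ p e, p.Prime ∧ 5 ≤ p ∧ p + 2 ≤ n ∧ n ≤ 2 * p ∧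
    (e + 2 ≤ p ∨ (e + 1 ≤ p ∧ p + 5 ≤ n)) ∧ 3 ≤ e ∧ padicValNat 2 n.factorial ≤ 2 * e ∧
    n ≤ 2 * e + 2 := by
  have hv := val_le Nat.prime_two (m := n) (by omega)
  obtain ⟨p, hp, h1, h2, h3⟩ : ∃ p, p.Prime ∧ p + 2 ≤ n ∧ n ≤ 2 * p ∧
      (Odd n ∨ p + 3 ≤ n) := by
    rcases Nat.even_or_odd' n with ⟨m, rfl | rfl⟩
    · obtain ⟨p, hp, h1, h2⟩ := Nat.exists_prime_lt_and_le_two_mul (m - 1) (by omega)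
      have : p ≠ 2 * (m - 1) := by
        rintro rfl
        have := hp.eq_one_or_self_of_dvd 2 ⟨_, rfl⟩
        omega
      exact ⟨p, hp, by omega, by omega, by right; omega⟩
    · obtain ⟨p, hp, h1, h2⟩ := Nat.exists_prime_lt_and_le_two_mul m (by omega)
      have : p ≠ 2 * m := by
        rintro rfl
        have := hp.eq_one_or_self_of_dvd 2 ⟨_, rfl⟩
        omega
      exact ⟨p, hp, by omega, by omega, by left; exact ⟨m, rfl⟩⟩
  by_cases h5 : p + 5 ≤ n
  · refine ⟨p, p - 1, hp, by omega, h1, h2, by omega, by omega, ?_, by omega⟩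
    by_cases h6 : n = 2 * p
    · have := val_two hp (by omega)
      rw [← h6] at this
      omega
    · rcases h3 with ⟨m, h3⟩ | h3
      · omega
      · by_cases h7 : n + 1 = 2 * p <;> omega
  · exact ⟨p, p - 2, hp, by omega, h1, h2, by omega, by omega, by omega, by omega⟩

theorem fac_small : padicValNat 2 (Nat.factorial 7) = 4 ∧ padicValNat 2 (Nat.factorial 8) = 7 ∧
    padicValNat 2 (Nat.factorial 9) = 7 ∧ padicValNat 2 (Nat.factorial 10) = 8 ∧
    padicValNat 2 (Nat.factorial 5) = 3 := by
  have key : ∀ a b, padicValNat 2 (2 ^ a * (2 * b + 1)) = a := by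
    intro a b
    have : Fact (Nat.Prime 2) := ⟨Nat.prime_two⟩
    rw [padicValNat.mul (by positivity) (by omega), padicValNat.prime_pow,
      padicValNat.eq_zero_of_not_dvd (by omega), add_zero]
  refine ⟨?_, ?_, ?_, ?_, ?_⟩
  · exact key 4 157
  · exact key 7 157
  · exact key 7 1417
  · exact key 8 7087
  · exact key 3 7

theorem nums {n : ℕ} (hn : 7 ≤ n) : ∃ p e, p.Prime ∧ 5 ≤ p ∧ p + 2 ≤ n ∧ n ≤ 2 * p ∧
    (e + 2 ≤ p ∨ (e + 1 ≤ p ∧ p + 5 ≤ n)) ∧ 3 ≤ e ∧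
    (padicValNat 2 n.factorial ≤ 2 * e ∨ n = 8 ∧ e = 3 ∧ padicValNat 2 n.factorial ≤ 2 * e + 1) ∧
    n ≤ 2 * e + 2 ∧ (n ≤ 9 ∨ 6 ≤ p) := by
  obtain ⟨h7, h8, h9, h10, -⟩ := fac_small
  by_cases h : 11 ≤ n
  · obtain ⟨p, e, h1, h2, h3, h4, h5, h6, h7, h8⟩ := nums_big h
    exact ⟨p, e, h1, h2, h3, h4, h5, h6, Or.inl h7, h8, by omega⟩
  · have : n = 7 ∨ n = 8 ∨ n = 9 ∨ n = 10 := by omega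
    rcases this with rfl | rfl | rfl | rfl
    · exact ⟨5, 3, by norm_num, by omega, by omega, by omega, by omega, by omega, by omega, by omega, by omega⟩
    · exact ⟨5, 3, by norm_num, by omega, by omega, by omega, by omega, by omega, by omega, by omega, by omega⟩
    · exact ⟨7, 5, by norm_num, by omega, by omega, by omega, by omega, by omega, by omega, by omega, by omega⟩
    · exact ⟨7, 5, by norm_num, by omega, by omega, by omega, by omega, by omega, by omega, by omega, by omega⟩

theorem data7 {n : ℕ} (hn : 7 ≤ n) : ∃ e, 3 ≤ e ∧
    (∀ (F V : Type) [Field F] [AddCommGroup V] [Module F V] [Finite V], (2 : F) = 0 →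
      finrank F V ≤ e → ¬ Inv (Al n) (End F V)ˣ) ∧
    (padicValNat 2 n.factorial ≤ 2 * e ∨ n = 8 ∧ e = 3 ∧ padicValNat 2 n.factorial ≤ 2 * e + 1) ∧
    ∀ r, r.Prime → r ≠ 2 → GLT (Al n) r (padicValNat r n.factorial) := by
  obtain ⟨p, e, hp, hp5, hpn, hnp, he, he3, hv, hne, hn9⟩ := nums hn
  refine ⟨e, he3, ?_, hv, ?_⟩
  · intro F V _ _ _ _ h2 hV
    refine lemmab (by omega) hp (by omega) hpn ?_ (by omega)
    have hodd : Odd p := hp.odd_of_ne_two (by omega)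
    obtain ⟨m, rfl⟩ := hodd
    push_cast
    rw [h2]
    simp
  · intro r hr hr2
    have hr3 : 3 ≤ r := by
      have := hr.two_le
      omega
    have hvr := val_le hr (m := n) (by omega)
    have hmul : 2 * padicValNat r n.factorial ≤ (r - 1) * padicValNat r n.factorial :=
      Nat.mul_le_mul_right _ (by omega)
    by_cases hrp : r = p
    · subst hrp
      by_cases h5 : r = 5
      · subst h5
        exact lemmab' (p := 3) (by omega) (by norm_num) (by omega) (by omega) hr (by omega)
            (by omega)
      · have h3 : padicValNat r n.factorial ≤ 3 := by
          by_contra hcon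
          push Not at hcon
          have : (r - 1) * 4 ≤ (r - 1) * padicValNat r n.factorial := Nat.mul_le_mul_left _ hcon
          omega
        exact lemmab' (p := 5) (by omega) (by norm_num) (by omega) (by omega) hr h5
          (by omega)
    · exact lemmab' (by omega) hp (by omega) hpn hr hrp (by omega)

theorem data5 (r : ℕ) (hr : r.Prime) : GLT (Al 5) r (padicValNat r (Nat.factorial 5)) := by
  have hv := val_le hr (m := 5) (by omega)
  have hr2 := hr.two_le
  have : Fact r.Prime := ⟨hr⟩
  have hcard : ∀ (V : Type) [AddCommGroup V] [Module (ZMod r) V] [Finite V],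
      Nat.card (End (ZMod r) V)ˣ = ∏ i : Fin (finrank (ZMod r) V),
        (r ^ finrank (ZMod r) V - r ^ (i : ℕ)) := by
    intro V _ _ _
    have : Module.Finite (ZMod r) V := Module.Finite.of_finite
    have h1 := Matrix.card_GL_field (𝔽 := ZMod r) (finrank (ZMod r) V)
    rw [ZMod.card] at h1
    rw [← h1]
    exact Nat.card_congr (Units.mapEquiv
      (LinearMap.toMatrixAlgEquiv (Module.finBasis (ZMod r) V)).toMulEquiv).toEquiv
  have h60 : Nat.card (Al 5) = 60 := by
    have := al_card (n := 5) le_rfl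
    have h2 : Nat.factorial 5 = 120 := rfl
    omega
  by_cases h5 : 5 ≤ r
  · refine lemmab' (p := 3) (by omega) (by norm_num) (by omega) (by omega) hr (by omega) ?_
    left
    have : 4 * padicValNat r (Nat.factorial 5) ≤ (r - 1) * padicValNat r (Nat.factorial 5) :=
      Nat.mul_le_mul_right _ (by omega)
    omega
  · intro V _ _ _ hV hI
    have hd := hI.card_dvd
    rw [hcard, h60] at hd
    have h4 : r ≠ 4 := by rintro rfl; norm_num at hr
    have : r = 2 ∨ r = 3 := by omega
    rcases this with rfl | rfl
    · rw [fac_small.2.2.2.2] at hV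
      generalize finrank (ZMod 2) V = d at hV hd
      interval_cases d <;> simp [Fin.prod_univ_succ] at hd
      all_goals revert hd; decide
    · have h1 : padicValNat 3 (Nat.factorial 5) ≤ 1 := by
        by_contra hcon
        push Not at hcon
        have := (padicValNat_dvd_iff_le (p := 3) (Nat.factorial_ne_zero 5)).2 hcon
        revert this; decide
      generalize finrank (ZMod 3) V = d at hV hd
      have : d ≤ 1 := by omega
      interval_cases d <;> simp [Fin.prod_univ_succ] at hd
      all_goals revert hd; decide

end Reg

namespace Reg
open Subgroup Module

abbrev M2 : Type := Multiplicative (ZMod 2)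

theorem M2.ne_one {a b : M2} (ha : a ≠ 1) (hb : b ≠ 1) : a = b := by
  revert a b; decide

theorem M2.sq (a : M2) : a * a = 1 := by revert a; decide

theorem M2.odd {a : M2} (ha : a ≠ 1) {k : ℕ} (hk : Odd k) : a ^ k ≠ 1 := by
  obtain ⟨j, rfl⟩ := hk
  rw [pow_add, pow_mul, pow_two, M2.sq, one_pow, one_mul, pow_one]
  exact ha

section
variable {G : Type} [Group G] [Finite G] (C : Subgroup G)

theorem tr_mem (s : G ⧸ C → G) (hs : ∀ q, (s q : G ⧸ C) = q) (g : G) (q : G ⧸ C) :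
    (s (g • q))⁻¹ * g * s q ∈ C := by
  have h1 : ((s (g • q) : G) : G ⧸ C) = ((g * s q : G) : G ⧸ C) := by
    rw [hs]
    conv_lhs => rw [← hs q]
    rfl
  rw [mul_assoc]
  exact QuotientGroup.eq.1 h1

noncomputable def tr [Fintype (G ⧸ C)] (ψ : C →* M2) (s : G ⧸ C → G)
    (hs : ∀ q, (s q : G ⧸ C) = q) : G →* M2 :=
  MonoidHom.mk' (fun g => ∏ q : G ⧸ C, ψ ⟨_, tr_mem C s hs g q⟩) (by
    intro g h
    have e1 : ∏ q : G ⧸ C, ψ ⟨_, tr_mem C s hs g q⟩ =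
        ∏ q : G ⧸ C, ψ ⟨_, tr_mem C s hs g (h • q)⟩ :=
      (Fintype.prod_equiv (MulAction.toPerm h) _ _ (fun q => rfl)).symm
    rw [e1, ← Finset.prod_mul_distrib]
    apply Finset.prod_congr rfl
    intro q _
    rw [← map_mul]
    congr 1
    apply Subtype.ext
    simp only [coe_mul, mul_smul]
    group)

theorem tr_apply [Fintype (G ⧸ C)] (ψ : C →* M2) (s : G ⧸ C → G)
    (hs : ∀ q, (s q : G ⧸ C) = q) (g : G) :
    tr C ψ s hs g = ∏ q : G ⧸ C, ψ ⟨_, tr_mem C s hs g q⟩ := rfl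

end

theorem psi_conj {C : Type} [Group C] {R : Subgroup C} (ψ : R →* M2) {r y : C} (hr : r ∈ R)
    (hy : y ∈ R) (h : r⁻¹ * y * r ∈ R) : ψ ⟨r⁻¹ * y * r, h⟩ = ψ ⟨y, hy⟩ := by
  have : (⟨r⁻¹ * y * r, h⟩ : R) = (⟨r, hr⟩ : R)⁻¹ * ⟨y, hy⟩ * ⟨r, hr⟩ := rfl
  rw [this, map_mul, map_mul, map_inv, mul_comm, ← mul_assoc, mul_inv_cancel, one_mul]

theorem TR {C : Type} [Group C] [Finite C] (R : Subgroup C) (hR : IsPGroup 2 R)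
    (hidx : Odd (Nat.card (C ⧸ R))) (z : C) (hz : ∀ g : C, g * z = z * g) (hzR : z ∈ R)
    (v : C) (hv : v ∈ R) (hv2 : v * v = 1 ∨ v * v = z)
    (hvR : ∀ y ∈ R, y⁻¹ * v * y = v ∨ y⁻¹ * v * y = v * z) (ψ : R →* M2)
    (hψz : ψ ⟨z, hzR⟩ = 1) (hψv : ψ ⟨v, hv⟩ ≠ 1)
    (hN : ∀ x ∈ normalizer (R : Set C), ∀ h : x⁻¹ * v * x ∈ R, ψ ⟨x⁻¹ * v * x, h⟩ ≠ 1) :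
    ∃ Ψ : C →* M2, Ψ v ≠ 1 := by
  classical
  have := Fintype.ofFinite (C ⧸ R)
  have hs : ∀ q : C ⧸ R, ((Quotient.out q : C) : C ⧸ R) = q := fun q => QuotientGroup.out_eq' q
  refine ⟨tr R ψ Quotient.out hs, ?_⟩
  rw [tr_apply]
  set s : C ⧸ R → C := Quotient.out with hsdef
  set c : C ⧸ R → M2 := fun q => ψ ⟨_, tr_mem R s hs v q⟩ with hc
  have hzq : ∀ q : C ⧸ R, z • q = q := by
    intro q
    obtain ⟨x, rfl⟩ := QuotientGroup.mk_surjective q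
    change ((z * x : C) : C ⧸ R) = x
    rw [← hz, QuotientGroup.mk_mul_of_mem _ hzR]
  have hvv : ∀ q : C ⧸ R, v • v • q = q := by
    intro q
    rw [← mul_smul]
    rcases hv2 with h | h <;> rw [h]
    · rw [one_smul]
    · exact hzq q
  have hfix : ∀ x : C, v • (x : C ⧸ R) = x → ∃ h : x⁻¹ * v * x ∈ R,
      c (x : C ⧸ R) = ψ ⟨x⁻¹ * v * x, h⟩ := by
    intro x hx
    have h1 : x⁻¹ * v * x ∈ R := by
      rw [mul_assoc]
      exact QuotientGroup.eq.1 hx.symm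
    refine ⟨h1, ?_⟩
    have h2 : (s (x : C ⧸ R))⁻¹ * x ∈ R := QuotientGroup.eq.1 (hs x)
    have h3 := psi_conj ψ (r := x⁻¹ * s (x : C ⧸ R)) (y := x⁻¹ * v * x)
      (by have := inv_mem h2; simpa using this) h1
      (by
        have h4 := tr_mem R s hs v x
        rw [hx] at h4
        convert h4 using 1
        group)
    rw [← h3]
    simp only [hc]
    congr 1
    apply Subtype.ext
    simp only
    rw [hx]
    group
  have hprod1 : ∏ q : C ⧸ R, c q = ∏ q ∈ Finset.univ.filter (fun q : C ⧸ R => v • q = q), c q := by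
    rw [← Finset.prod_filter_mul_prod_filter_not Finset.univ (fun q : C ⧸ R => v • q = q)]
    have : ∏ q ∈ Finset.univ.filter (fun q : C ⧸ R => ¬ v • q = q), c q = 1 := by
      refine Finset.prod_involution (fun q _ => v • q) ?_ ?_ ?_ ?_
      · intro q _
        simp only [hc]
        rw [mul_comm]
        have e : ((⟨_, tr_mem R s hs v (v • q)⟩ : R) * ⟨_, tr_mem R s hs v q⟩ : R).1 =
            (s q)⁻¹ * (v * v) * s q := by
          simp only [coe_mul]
          rw [hvv]
          group
        rcases hv2 with h | h
        · have e2 : ((⟨_, tr_mem R s hs v (v • q)⟩ : R) * ⟨_, tr_mem R s hs v q⟩ : R) = 1 := by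
            apply Subtype.ext
            rw [e, h]; simp
          rw [← map_mul, e2, map_one]
        · have e2 : ((⟨_, tr_mem R s hs v (v • q)⟩ : R) * ⟨_, tr_mem R s hs v q⟩ : R) = ⟨z, hzR⟩ := by
            apply Subtype.ext
            rw [e, h]
            simp only
            rw [hz, mul_assoc, inv_mul_cancel, mul_one]
          rw [← map_mul, e2, hψz]
      · intro q hq _
        simpa using hq
      · intro q hq
        simp at hq ⊢
        exact hq
      · intro q _
        exact hvv q
    rw [this, mul_one]
  have hprod2 : ∏ q : C ⧸ R, c q = (ψ ⟨v, hv⟩) ^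
      (Finset.univ.filter (fun q : C ⧸ R => v • q = q ∧ c q ≠ 1)).card := by
    rw [hprod1, ← Finset.prod_filter_ne_one, Finset.filter_filter]
    apply Finset.prod_eq_pow_card
    intro q hq
    simp at hq
    exact M2.ne_one hq.2 hψv
  rw [hprod2]
  apply M2.odd hψv
  let Ω : SubMulAction R (C ⧸ R) :=
    { carrier := {q | v • q = q ∧ c q ≠ 1}
      smul_mem' := by
        rintro ⟨y, hy⟩ q ⟨h1, h2⟩
        obtain ⟨x, rfl⟩ := QuotientGroup.mk_surjective q
        have hyx : (⟨y, hy⟩ : R) • (x : C ⧸ R) = ((y * x : C) : C ⧸ R) := rfl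
        have h3 : v • ((y * x : C) : C ⧸ R) = ((y * x : C) : C ⧸ R) := by
          have e1 : v • ((y * x : C) : C ⧸ R) = y • (y⁻¹ * v * y) • (x : C ⧸ R) := by
            rw [← mul_smul]
            change ((v * (y * x) : C) : C ⧸ R) = ((y * (y⁻¹ * v * y) * x : C) : C ⧸ R)
            congr 1
            group
          rw [e1]
          have e2 : (y⁻¹ * v * y) • (x : C ⧸ R) = x := by
            rcases hvR y hy with h | h <;> rw [h]
            · exact h1
            · rw [mul_smul, hzq, h1]
          rw [e2]
          rfl
        rw [hyx]
        refine ⟨h3, ?_⟩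
        obtain ⟨m1, e1⟩ := hfix _ h3
        obtain ⟨m2, e2⟩ := hfix _ h1
        rw [e1]
        rw [e2] at h2
        rcases hvR y hy with h | h
        · have e3 : (y * x)⁻¹ * v * (y * x) = x⁻¹ * v * x := by
            calc (y * x)⁻¹ * v * (y * x) = x⁻¹ * (y⁻¹ * v * y) * x := by group
              _ = _ := by rw [h]
          simpa only [e3] using h2
        · have e3 : (y * x)⁻¹ * v * (y * x) = x⁻¹ * v * x * z := by
            calc (y * x)⁻¹ * v * (y * x) = x⁻¹ * (y⁻¹ * v * y) * x := by group
              _ = x⁻¹ * v * (z * x) := by rw [h]; group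
              _ = _ := by rw [← hz]; group
          have e4 : (⟨(y * x)⁻¹ * v * (y * x), m1⟩ : R) = ⟨x⁻¹ * v * x, m2⟩ * ⟨z, hzR⟩ :=
            Subtype.ext e3
          rw [e4, map_mul, hψz, mul_one]
          exact h2 }
  have hΩ : (Finset.univ.filter (fun q : C ⧸ R => v • q = q ∧ c q ≠ 1)).card = Nat.card Ω := by
    have : Nat.card Ω = Nat.card {q : C ⧸ R // v • q = q ∧ c q ≠ 1} := rfl
    rw [this, Nat.card_eq_fintype_card, Fintype.card_subtype]
  rw [hΩ]
  have : Fact (Nat.Prime 2) := ⟨Nat.prime_two⟩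
  have m1 := hR.card_modEq_card_fixedPoints (C ⧸ R)
  have m2 := hR.card_modEq_card_fixedPoints Ω
  have hbij : Nat.card (MulAction.fixedPoints R Ω) = Nat.card (MulAction.fixedPoints R (C ⧸ R)) := by
    apply Nat.card_congr
    refine Equiv.ofBijective (fun q => ⟨q.1.1, fun r => congrArg Subtype.val (q.2 r)⟩) ⟨?_, ?_⟩
    · intro a b hab
      have := congrArg Subtype.val hab
      exact Subtype.ext (Subtype.ext this)
    · rintro ⟨q, hq⟩
      obtain ⟨x, rfl⟩ := QuotientGroup.mk_surjective q
      have hx : x ∈ normalizer (R : Set C) := by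
        have h1 : x⁻¹ ∈ normalizer (R : Set C) := by
          apply mem_normalizer_of_conj
          intro y hy
          rw [inv_inv, mul_assoc]
          have := hq ⟨y, hy⟩
          exact QuotientGroup.eq.1 this.symm
        have := inv_mem h1
        rwa [inv_inv] at this
      have hvx : v • (x : C ⧸ R) = x := hq ⟨v, hv⟩
      obtain ⟨m3, e3⟩ := hfix x hvx
      refine ⟨⟨⟨(x : C ⧸ R), hvx, ?_⟩, ?_⟩, rfl⟩
      · rw [e3]; exact hN x hx m3
      · intro r
        exact Subtype.ext (hq r)
  rw [hbij] at m2
  have m3 := m2.trans m1.symm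
  rw [Nat.odd_iff] at hidx ⊢
  exact Eq.trans m3 hidx

end Reg

namespace Reg
open Subgroup Module

theorem isolift {G : Type} [Group G] [Finite G] (z : G) (hz2 : z * z = 1)
    (hiso : ∀ x : G, (x * z * x⁻¹) * z = z * (x * z * x⁻¹) → x * z * x⁻¹ = z)
    (C : Subgroup G) (hC : C = centralizer {z}) (Ψ : C →* M2) (v : G) (hv : v ∈ C)
    (hΨ : Ψ ⟨v, hv⟩ ≠ 1) : ∃ Φ : G →* M2, Φ v ≠ 1 := by
  classical
  have := Fintype.ofFinite (G ⧸ C)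
  obtain ⟨f, hf⟩ := Countable.exists_injective_nat (G ⧸ C)
  have hout : ∀ q : G ⧸ C, ((Quotient.out q : G) : G ⧸ C) = q := fun q => QuotientGroup.out_eq' q
  let s : G ⧸ C → G := fun q => if f q ≤ f (z • q) then Quotient.out q else z * Quotient.out (z • q)
  have hzz : ∀ q : G ⧸ C, z • z • q = q := by
    intro q; rw [← mul_smul, hz2, one_smul]
  have hs : ∀ q, (s q : G ⧸ C) = q := by
    intro q
    simp only [s]
    split_ifs with h
    · exact hout q
    · have : ((z * Quotient.out (z • q) : G) : G ⧸ C) = z • ((Quotient.out (z • q) : G) : G ⧸ C) := rfl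
      rw [this, hout, hzz]
  have heq : ∀ q : G ⧸ C, z • q ≠ q → s (z • q) = z * s q := by
    intro q hq
    have hne : f (z • q) ≠ f q := fun h => hq (hf h)
    simp only [s, hzz]
    by_cases h : f q ≤ f (z • q)
    · rw [if_pos h, if_neg (by omega)]
    · rw [if_neg h, if_pos (by omega), ← mul_assoc, hz2, one_mul]
  have hzC : z ∈ C := by rw [hC, mem_centralizer_singleton_iff]
  have hfix : ∀ q : G ⧸ C, z • q = q → q = ((1 : G) : G ⧸ C) := by
    intro q hq
    obtain ⟨x, rfl⟩ := QuotientGroup.mk_surjective q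
    have h1 : x⁻¹ * (z * x) ∈ C := QuotientGroup.eq.1 hq.symm
    rw [hC, mem_centralizer_singleton_iff] at h1
    have h2 := hiso x⁻¹ (by rw [inv_inv, mul_assoc x⁻¹]; exact h1)
    apply QuotientGroup.eq.2
    rw [mul_one]
    rw [hC]
    apply (mem_centralizer_singleton_iff).2
    rw [inv_inv] at h2
    calc x⁻¹ * z = (x⁻¹ * z * x) * x⁻¹ := by group
      _ = _ := by rw [h2]
  have hone : ∀ g ∈ C, g • ((1 : G) : G ⧸ C) = ((1 : G) : G ⧸ C) := by
    intro g hg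
    have : g • ((1 : G) : G ⧸ C) = ((g * 1 : G) : G ⧸ C) := rfl
    rw [this]
    apply QuotientGroup.eq.2
    simpa using hg
  have hvz : v * z = z * v := mem_centralizer_singleton_iff.1 (hC ▸ hv)
  refine ⟨tr C Ψ s hs, ?_⟩
  rw [tr_apply, ← Finset.mul_prod_erase Finset.univ _ (Finset.mem_univ ((1 : G) : G ⧸ C))]
  have hrest : ∏ q ∈ Finset.univ.erase ((1 : G) : G ⧸ C), Ψ ⟨_, tr_mem C s hs v q⟩ = 1 := by
    refine Finset.prod_involution (fun q _ => z • q) ?_ ?_ ?_ ?_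
    · intro q hq
      have hq1 : q ≠ ((1 : G) : G ⧸ C) := (Finset.mem_erase.1 hq).1
      have h1 : z • q ≠ q := fun h => hq1 (hfix q h)
      have h2 : z • v • q ≠ v • q := by
        intro h
        apply hq1
        have h3 := hfix _ h
        have h4 := hone v⁻¹ (inv_mem hv)
        rw [← h3, inv_smul_smul] at h4
        exact h4.trans h3
      have e : (⟨_, tr_mem C s hs v (z • q)⟩ : C) = ⟨_, tr_mem C s hs v q⟩ := by
        apply Subtype.ext
        simp only
        rw [← mul_smul, hvz, mul_smul, heq _ h1, heq _ h2]
        calc (z * s (v • q))⁻¹ * v * (z * s q) = (s (v • q))⁻¹ * z⁻¹ * (v * z) * s q := by group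
          _ = _ := by rw [hvz]; group
      rw [e, M2.sq]
    · intro q hq _ h
      exact (Finset.mem_erase.1 hq).1 (hfix q h)
    · intro q hq
      refine Finset.mem_erase.2 ⟨fun h => (Finset.mem_erase.1 hq).1 ?_, Finset.mem_univ _⟩
      have := hone z hzC
      rw [← h, hzz] at this
      exact this.trans h
    · intro q _
      exact hzz q
  rw [hrest, mul_one]
  have hs1 : s ((1 : G) : G ⧸ C) ∈ C := by
    have := QuotientGroup.eq.1 (hs ((1 : G) : G ⧸ C))
    simpa using this
  have e := psi_conj Ψ hs1 hv (mul_mem (mul_mem (inv_mem hs1) hv) hs1)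
  rw [← e] at hΨ
  convert hΨ using 5
  rw [hone v hv]

theorem syl_conj {T : Type} [Group T] [Finite T] (P : Sylow 2 T) {H Q : Subgroup T}
    (hPH : (P : Subgroup T) ≤ H) (hQ : Q ≤ H) (hQ2 : IsPGroup 2 Q) :
    ∃ a ∈ H, ∀ q ∈ Q, a⁻¹ * q * a ∈ P := by
  have : Fact (Nat.Prime 2) := ⟨Nat.prime_two⟩
  have h1 : IsPGroup 2 (Q.subgroupOf H) := hQ2.comap_of_injective _ H.subtype_injective
  obtain ⟨P2, hP2⟩ := h1.exists_le_sylow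
  obtain ⟨a, ha⟩ := MulAction.exists_smul_eq H (P.subtype hPH) P2
  refine ⟨a, a.2, fun q hq => ?_⟩
  have h2 : (⟨q, hQ hq⟩ : H) ∈ P2 := hP2 hq
  rw [← ha] at h2
  obtain ⟨y, hy, e⟩ := h2
  have e2 : (a : T) * (y : T) * (a : T)⁻¹ = q := congrArg Subtype.val e
  have hy2 : (y : T) ∈ P := hy
  rw [← e2]
  simpa [mul_assoc] using hy2

theorem syl_abs {T : Type} [Group T] [Finite T] {K : Subgroup T} (Q : Sylow 2 K) {E : Subgroup T}
    (hE : E ≤ K) (hE2 : IsPGroup 2 E)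
    (hn : ∀ q ∈ (Q : Subgroup K), ∀ e ∈ E, (q : T) * e * (q : T)⁻¹ ∈ E) :
    ∀ e ∈ E, ∃ h : e ∈ K, (⟨e, h⟩ : K) ∈ Q := by
  have h1 : IsPGroup 2 (E.subgroupOf K) := hE2.comap_of_injective _ K.subtype_injective
  have h2 : (Q : Subgroup K) ≤ normalizer ((E.subgroupOf K : Subgroup K) : Set K) := by
    intro q hq
    apply mem_normalizer_of_conj
    intro y hy
    exact hn q hq y hy
  have h3 := Q.2.to_sup_of_normal_right' h1 h2
  have h4 := Q.3 h3 le_sup_left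
  intro e he
  refine ⟨hE he, ?_⟩
  have : (⟨e, hE he⟩ : K) ∈ (Q : Subgroup K) ⊔ E.subgroupOf K := mem_sup_right he
  rw [h4] at this
  exact this

theorem card_le_two {T : Type} [Group T] [Finite T] {E H : Subgroup T}
    (h : ∀ a ∈ E, ∀ b ∈ E, a ∉ H → b ∉ H → a * b⁻¹ ∈ H) : Nat.card E ≤ 2 * Nat.card H := by
  classical
  by_cases hc : ∃ b ∈ E, b ∉ H
  · obtain ⟨b, hb, hb'⟩ := hc
    let f : E → H × Bool := fun e => if he : (e : T) ∈ H then (⟨e, he⟩, true)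
      else (⟨e * b⁻¹, h e e.2 b hb he hb'⟩, false)
    have hf : Function.Injective f := by
      intro x y hxy
      simp only [f] at hxy
      apply Subtype.ext
      split_ifs at hxy with h1 h2 h2 <;> simp at hxy <;> first | exact hxy | exact congrArg _ hxy
    have := Nat.card_le_card_of_injective f hf
    rw [Nat.card_prod, Nat.card_eq_fintype_card (α := Bool), Fintype.card_bool] at this
    omega
  · push Not at hc
    have := Subgroup.card_le_of_le (show E ≤ H from hc)
    omega

end Reg

namespace Reg
open Subgroup Module

def cj {T : Type} [Group T] (g : T) (H : Subgroup T) : Subgroup T :=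
  H.comap (MulAut.conj g⁻¹).toMonoidHom

theorem mem_cj {T : Type} [Group T] {g : T} {H : Subgroup T} {e : T} :
    e ∈ cj g H ↔ g⁻¹ * e * g ∈ H := by
  simp [cj, Subgroup.mem_comap]

theorem card_cj {T : Type} [Group T] (g : T) (H : Subgroup T) :
    Nat.card (cj g H) = Nat.card H := by
  refine Nat.card_congr ⟨fun e => ⟨g⁻¹ * e * g, mem_cj.1 e.2⟩,
    fun h => ⟨g * h * g⁻¹, mem_cj.2 (by simp [mul_assoc])⟩, fun e => ?_, fun h => ?_⟩ <;>
  · apply Subtype.ext; simp [mul_assoc]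

theorem isolated {T : Type} [Group T] [Finite T] (P : Sylow 2 T) (R0 A : Subgroup T) (z : T)
    (hR0 : R0 ≤ P) (hz : z ∈ R0) (hzz : z * z = 1) (hzP : ∀ y ∈ P, y * z = z * y)
    (hcomm : ∀ x ∈ R0, ∀ y ∈ P, y⁻¹ * x * y = x ∨ y⁻¹ * x * y = x * z)
    (hcen : ∀ x ∈ R0, (∀ y ∈ R0, x * y = y * x) → x ∈ A)
    (hcard : 4 * Nat.card A * Nat.card P < Nat.card R0 ^ 2) (x : T)
    (hx : (x * z * x⁻¹) * z = z * (x * z * x⁻¹)) : x * z * x⁻¹ = z := by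
  by_contra hne
  obtain ⟨w, hw⟩ : ∃ w, w = x * z * x⁻¹ := ⟨_, rfl⟩
  rw [← hw] at hx hne
  have hww : w * w = 1 := by
    rw [hw]
    calc x * z * x⁻¹ * (x * z * x⁻¹) = x * (z * z) * x⁻¹ := by group
      _ = 1 := by rw [hzz]; group
  let Cz : Subgroup T := centralizer {z}
  let Cw : Subgroup T := centralizer {w}
  have mz : ∀ t, t ∈ Cz ↔ t * z = z * t := fun t => mem_centralizer_singleton_iff
  have mw : ∀ t, t ∈ Cw ↔ t * w = w * t := fun t => mem_centralizer_singleton_iff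
  obtain ⟨Q⟩ : Nonempty (Sylow 2 (Cz ⊓ Cw : Subgroup T)) := inferInstance
  let Q0 : Subgroup T := (Q : Subgroup _).map (Cz ⊓ Cw).subtype
  have hQ02 : IsPGroup 2 Q0 := Q.2.map _
  have hQ0 : Q0 ≤ Cz ⊓ Cw := by
    rintro _ ⟨y, -, rfl⟩; exact y.2
  obtain ⟨a, ha, haQ⟩ := syl_conj P (H := Cz) (fun y hy => (mz y).2 (hzP y hy))
    (fun q hq => (hQ0 hq).1) hQ02
  obtain ⟨b, hb, hbQ⟩ := syl_conj P (H := Cz) (fun y hy => (mz y).2 (hzP y hy))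
    (Q := Q0.map (MulAut.conj x⁻¹).toMonoidHom) (by
      rintro _ ⟨q, hq, rfl⟩
      have h1 := (mw q).1 (hQ0 hq).2
      rw [mz]
      have e : ((MulAut.conj x⁻¹).toMonoidHom q) = x⁻¹ * q * x := by simp
      rw [e]
      have : z = x⁻¹ * w * x := by rw [hw]; group
      rw [this]
      calc x⁻¹ * q * x * (x⁻¹ * w * x) = x⁻¹ * (q * w) * x := by group
        _ = _ := by rw [h1]; group) (hQ02.map _)
  obtain ⟨g, hg⟩ : ∃ g, g = x * b := ⟨_, rfl⟩
  have hgz : g * z * g⁻¹ = w := by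
    rw [hg, hw]
    have := (mz b).1 hb
    calc x * b * z * (x * b)⁻¹ = x * (b * z) * b⁻¹ * x⁻¹ := by group
      _ = _ := by rw [this]; group
  have haz : a * z * a⁻¹ = z := by rw [(mz a).1 ha]; group
  have hgQ : ∀ q ∈ Q0, g⁻¹ * q * g ∈ P := by
    intro q hq
    have := hbQ (x⁻¹ * q * x) ⟨q, hq, by simp⟩
    rw [hg]; simpa [mul_assoc] using this
  have gen : ∀ (h u : T), h * z * h⁻¹ = u → (∀ q ∈ Q0, h⁻¹ * q * h ∈ P) →
      ∀ e ∈ cj h R0, ∀ q ∈ Q0, q⁻¹ * e * q = e ∨ q⁻¹ * e * q = e * u := by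
    intro h u hu hq e he q hqq
    have := hcomm _ (mem_cj.1 he) _ (hq q hqq)
    rcases this with k | k
    · left
      calc q⁻¹ * e * q = h * ((h⁻¹ * q * h)⁻¹ * (h⁻¹ * e * h) * (h⁻¹ * q * h)) * h⁻¹ := by group
        _ = _ := by rw [k]; group
    · right
      calc q⁻¹ * e * q = h * ((h⁻¹ * q * h)⁻¹ * (h⁻¹ * e * h) * (h⁻¹ * q * h)) * h⁻¹ := by group
        _ = _ := by rw [k, ← hu]; group
  have gen2 : ∀ (h u : T), h * z * h⁻¹ = u → u ∈ cj h R0 ∧ ∀ e ∈ cj h R0, e * u = u * e := by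
    intro h u hu
    constructor
    · rw [mem_cj, ← hu]
      have : h⁻¹ * (h * z * h⁻¹) * h = z := by group
      rw [this]; exact hz
    · intro e he
      have := hzP _ (hR0 (mem_cj.1 he))
      rw [← hu]
      calc e * (h * z * h⁻¹) = h * ((h⁻¹ * e * h) * z) * h⁻¹ := by group
        _ = _ := by rw [this]; group
  have genp : ∀ h : T, IsPGroup 2 (cj h R0) := by
    intro h
    exact (P.2.to_le hR0).comap_of_injective _ (MulAut.conj h⁻¹).injective
  have hEa := gen a z haz haQ
  have hEg := gen g w hgz hgQ
  obtain ⟨zEa, cEa⟩ := gen2 a z haz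
  obtain ⟨wEg, cEg⟩ := gen2 g w hgz
  generalize hEadef : cj a R0 = Ea at *
  generalize hEgdef : cj g R0 = Eg at *
  have hQmem : ∀ e, (∃ h : e ∈ Cz ⊓ Cw, (⟨e, h⟩ : (Cz ⊓ Cw : Subgroup T)) ∈ Q) → e ∈ Q0 := by
    rintro e ⟨h, hq⟩
    exact ⟨_, hq, rfl⟩
  have hpa : IsPGroup 2 Ea := hEadef ▸ genp a
  have hpg : IsPGroup 2 Eg := hEgdef ▸ genp g
  have hE1 : ∀ e ∈ Ea ⊓ Cw, e ∈ Q0 := by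
    intro e he
    apply hQmem
    refine syl_abs Q (E := Ea ⊓ Cw) (fun e he => mem_inf.2 ⟨(mz e).2 (cEa e he.1), he.2⟩)
      (hpa.to_le inf_le_left) ?_ e he
    intro q hq e he
    have hq0 : (q : T) ∈ Q0 := ⟨q, hq, rfl⟩
    refine mem_inf.2 ⟨?_, mul_mem (mul_mem q.2.2 he.2) (inv_mem q.2.2)⟩
    have := hEa e he.1 (q : T)⁻¹ (inv_mem hq0)
    rw [inv_inv] at this
    rcases this with k | k
    · rw [k]; exact he.1
    · rw [k]; exact mul_mem he.1 zEa
  have hE2 : ∀ e ∈ Eg ⊓ Cz, e ∈ Q0 := by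
    intro e he
    apply hQmem
    refine syl_abs Q (E := Eg ⊓ Cz) (fun e he => mem_inf.2 ⟨he.2, (mw e).2 (cEg e he.1)⟩)
      (hpg.to_le inf_le_left) ?_ e he
    intro q hq e he
    have hq0 : (q : T) ∈ Q0 := ⟨q, hq, rfl⟩
    refine mem_inf.2 ⟨?_, mul_mem (mul_mem q.2.1 he.2) (inv_mem q.2.1)⟩
    have := hEg e he.1 (q : T)⁻¹ (inv_mem hq0)
    rw [inv_inv] at this
    rcases this with k | k
    · rw [k]; exact he.1
    · rw [k]; exact mul_mem he.1 wEg
  have zQ : z ∈ Q0 := hE1 z (mem_inf.2 ⟨zEa, (mw z).2 hx.symm⟩)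
  have wQ : w ∈ Q0 := hE2 w (mem_inf.2 ⟨wEg, (mz w).2 hx⟩)
  have cc : ∀ s t : T, t⁻¹ * s * t = s → s * t = t * s := by
    intro s t h
    calc s * t = t * (t⁻¹ * s * t) := by group
      _ = _ := by rw [h]
  have two : ∀ (E : Subgroup T) (u t : T), (∀ e ∈ E, t⁻¹ * e * t = e ∨ t⁻¹ * e * t = e * u) →
      ∀ p ∈ E, ∀ q ∈ E, p ∉ E ⊓ centralizer {t} → q ∉ E ⊓ centralizer {t} →
      p * q⁻¹ ∈ E ⊓ centralizer {t} := by
    intro E u t h p hp q hq hp' hq'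
    refine mem_inf.2 ⟨mul_mem hp (inv_mem hq), mem_centralizer_singleton_iff.2 (cc _ _ ?_)⟩
    have k1 := (h p hp).resolve_left
      (fun k => hp' (mem_inf.2 ⟨hp, mem_centralizer_singleton_iff.2 (cc _ _ k)⟩))
    have k2 := (h q hq).resolve_left
      (fun k => hq' (mem_inf.2 ⟨hq, mem_centralizer_singleton_iff.2 (cc _ _ k)⟩))
    calc t⁻¹ * (p * q⁻¹) * t = (t⁻¹ * p * t) * (t⁻¹ * q * t)⁻¹ := by group
      _ = _ := by rw [k1, k2]; group
  have twoa := two Ea z w (fun e he => hEa e he w wQ)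
  have twog := two Eg w z (fun e he => hEg e he z zQ)
  have c2 := card_le_two twog
  have c12 : ∀ e ∈ Ea ⊓ Cw, ∀ f ∈ Eg ⊓ Cz, e * f = f * e := by
    intro e he f hf
    rcases hEa e he.1 f (hE2 f hf) with k | k
    · exact cc _ _ k
    rcases hEg f hf.1 e (hE1 e he) with k2 | k2
    · exact (cc _ _ k2).symm
    exfalso
    apply hne
    have k3 : e⁻¹ * f⁻¹ * e * f = z := by
      calc e⁻¹ * f⁻¹ * e * f = e⁻¹ * (f⁻¹ * e * f) := by group
        _ = z := by rw [k]; group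
    have k4 : f⁻¹ * e⁻¹ * f * e = w := by
      calc f⁻¹ * e⁻¹ * f * e = f⁻¹ * (e⁻¹ * f * e) := by group
        _ = w := by rw [k2]; group
    have : z * w = 1 := by rw [← k3, ← k4]; group
    calc w = (z * z) * w := by rw [hzz, one_mul]
      _ = z * (z * w) := by group
      _ = z := by rw [this, mul_one]
  have c3 : Nat.card (Ea ⊓ (Eg ⊓ Cz) : Subgroup T) ≤
      2 * Nat.card ((Ea ⊓ (Eg ⊓ Cz)) ⊓ centralizer (Ea : Set T) : Subgroup T) := by
    apply card_le_two
    have key : ∀ j ∈ Ea ⊓ (Eg ⊓ Cz), j ∉ (Ea ⊓ (Eg ⊓ Cz)) ⊓ centralizer (Ea : Set T) →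
        ∀ e ∈ Ea, e ∉ Ea ⊓ Cw → j⁻¹ * e * j = e * z := by
      intro j hj hj' e he he'
      refine (hEa e he j (hE2 j hj.2)).resolve_left fun k => hj' (mem_inf.2 ⟨hj, ?_⟩)
      rw [mem_centralizer_iff]
      intro f hf
      have hf : f ∈ Ea := hf
      by_cases hf' : f ∈ Ea ⊓ Cw
      · exact c12 f hf' j hj.2
      · have k1 := c12 _ (twoa f hf e he hf' he') j hj.2
        have k2 := cc _ _ k
        calc f * j = (f * e⁻¹) * (e * j) := by group
          _ = (f * e⁻¹ * j) * e := by rw [k2]; group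
          _ = j * f := by rw [k1]; group
    intro j hj i hi hj' hi'
    refine mem_inf.2 ⟨mul_mem hj (inv_mem hi), ?_⟩
    rw [mem_centralizer_iff]
    intro e he
    have he : e ∈ Ea := he
    by_cases he' : e ∈ Ea ⊓ Cw
    · exact c12 e he' _ (mul_mem hj.2 (inv_mem hi.2))
    · apply cc
      have k1 := key j hj hj' e he he'
      have k2 := key i hi hi' e he he'
      calc (j * i⁻¹)⁻¹ * e * (j * i⁻¹) = i * (j⁻¹ * e * j) * i⁻¹ := by group
        _ = e := by rw [k1, ← k2]; group
  have c4 : Nat.card ((Ea ⊓ (Eg ⊓ Cz)) ⊓ centralizer (Ea : Set T) : Subgroup T) ≤ Nat.card A := by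
    rw [← card_cj a A]
    apply Subgroup.card_le_of_le
    intro j hj
    rw [mem_cj]
    have hj1 : j ∈ Ea := hj.1.1
    have hj2 := mem_centralizer_iff.1 hj.2
    have hj3 : j ∈ cj a R0 := by rw [hEadef]; exact hj1
    apply hcen _ (mem_cj.1 hj3)
    intro y hy
    have : a * y * a⁻¹ ∈ (Ea : Set T) := by
      rw [← hEadef]
      refine mem_cj.2 ?_
      have e : a⁻¹ * (a * y * a⁻¹) * a = y := by group
      rw [e]; exact hy
    have := hj2 _ this
    calc a⁻¹ * j * a * y = a⁻¹ * (j * (a * y * a⁻¹)) * a := by group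
      _ = _ := by rw [← this]; group
  have c5 : Nat.card Ea * Nat.card (Eg ⊓ Cz : Subgroup T) ≤
      Nat.card P * Nat.card (Ea ⊓ (Eg ⊓ Cz) : Subgroup T) := by
    have hle1 : Ea ≤ cj a P := by
      rw [← hEadef]; intro e he; exact mem_cj.2 (hR0 (mem_cj.1 he))
    have hle2 : Eg ⊓ Cz ≤ cj a P := fun e he => mem_cj.2 (haQ e (hE2 e he))
    have hcm : ∀ H K : Subgroup T, H ≤ K → Nat.card H * H.relIndex K = Nat.card K := by
      intro H K h
      have := Subgroup.relIndex_mul_relIndex ⊥ H K bot_le h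
      rwa [relIndex_bot_left, relIndex_bot_left] at this
    have r2 := hcm _ _ hle1
    have r0 : Ea.relIndex (cj a P) ≠ 0 := by
      intro h0
      rw [h0, mul_zero] at r2
      exact Nat.card_pos.ne r2
    have r1 := Subgroup.relIndex_le_of_le_right hle2 r0
    have r3 := hcm (Ea ⊓ (Eg ⊓ Cz)) (Eg ⊓ Cz) inf_le_right
    rw [inf_relIndex_right] at r3
    rw [card_cj] at r2
    have r4 : Nat.card (P : Subgroup T) = Nat.card P := rfl
    rw [← r3, ← r4, ← r2]
    calc Nat.card Ea * (Nat.card (Ea ⊓ (Eg ⊓ Cz) : Subgroup T) * Ea.relIndex (Eg ⊓ Cz))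
        ≤ Nat.card Ea * (Nat.card (Ea ⊓ (Eg ⊓ Cz) : Subgroup T) * Ea.relIndex (cj a P)) := by gcongr
      _ = _ := by ring
  have c6 : Nat.card Ea = Nat.card R0 := by rw [← hEadef, card_cj]
  have c7 : Nat.card Eg = Nat.card R0 := by rw [← hEgdef, card_cj]
  nlinarith [Nat.zero_le (Nat.card P)]

theorem odd_idx {C : Type} [Group C] [Finite C] (P : Sylow 2 C) :
    Odd (Nat.card (C ⧸ (P : Subgroup C))) := by
  have : Fact (Nat.Prime 2) := ⟨Nat.prime_two⟩
  have := P.not_dvd_index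
  rw [Nat.two_dvd_ne_zero, ← Nat.odd_iff] at this
  exact this

theorem stage2 {T : Type} [Group T] [Finite T] (P : Sylow 2 T) (R0 A : Subgroup T) (z v : T)
    (hR0 : R0 ≤ P) (hAR : A ≤ R0) (hz : z ∈ A) (hzz : z * z = 1) (hzP : ∀ y ∈ P, y * z = z * y)
    (hcomm : ∀ x ∈ R0, ∀ y ∈ P, y⁻¹ * x * y = x ∨ y⁻¹ * x * y = x * z)
    (hsq : ∀ x ∈ R0, x * x = 1 ∨ x * x = z)
    (hcen : z ≠ 1 → ∀ x ∈ R0, (∀ y ∈ R0, x * y = y * x) → x ∈ A)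
    (hcard : z ≠ 1 → 4 * Nat.card A * Nat.card P < Nat.card R0 ^ 2)
    (hv : v ∈ R0) (ψ : (P : Subgroup T) →* M2) (hψA : ∀ x (h : x ∈ A), ψ ⟨x, hR0 (hAR h)⟩ = 1)
    (hψv : ψ ⟨v, hR0 hv⟩ ≠ 1)
    (hN : ∀ x ∈ normalizer ((P : Subgroup T) : Set T), v⁻¹ * (x⁻¹ * v * x) ∈ A) :
    ∃ Φ : T →* M2, ∃ t, Φ t ≠ 1 := by
  have hN' : ∀ x ∈ normalizer ((P : Subgroup T) : Set T), ∀ h : x⁻¹ * v * x ∈ (P : Subgroup T),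
      ψ ⟨x⁻¹ * v * x, h⟩ ≠ 1 := by
    intro x hx h
    have e : (⟨x⁻¹ * v * x, h⟩ : (P : Subgroup T)) =
        ⟨v, hR0 hv⟩ * ⟨v⁻¹ * (x⁻¹ * v * x), hR0 (hAR (hN x hx))⟩ := by
      apply Subtype.ext; simp [mul_assoc]
    rw [e, map_mul, hψA _ (hN x hx), mul_one]
    exact hψv
  by_cases hz1 : z = 1
  · obtain ⟨Φ, h⟩ := TR (P : Subgroup T) P.2 (odd_idx P) 1 (by simp) (one_mem _) v (hR0 hv)
      (by simpa [hz1] using hsq v hv) (by intro y hy; simpa [hz1] using hcomm v hv y hy) ψ (map_one ψ) hψv hN'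
    exact ⟨Φ, v, h⟩
  · obtain ⟨C, hC⟩ : ∃ C : Subgroup T, C = centralizer {z} := ⟨_, rfl⟩
    have hPC : (P : Subgroup T) ≤ C := by
      intro y hy; rw [hC]; exact mem_centralizer_singleton_iff.2 (hzP y hy)
    let ι : (P.subtype hPC : Subgroup C) →* (P : Subgroup T) :=
      (C.subtype.comp (P.subtype hPC : Subgroup C).subtype).codRestrict _ (fun y => y.2)
    have hzC : z ∈ C := hPC (hR0 (hAR hz))
    have hvC : v ∈ C := hPC (hR0 hv)
    obtain ⟨Φ, h⟩ := TR (P.subtype hPC : Subgroup C) (P.subtype hPC).2 (odd_idx _) ⟨z, hzC⟩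
      (by
        intro g
        apply Subtype.ext
        have : ∀ t ∈ C, t * z = z * t := by
          intro t ht; rw [hC] at ht; exact mem_centralizer_singleton_iff.1 ht
        exact this _ g.2) (hR0 (hAR hz)) ⟨v, hvC⟩ (hR0 hv)
      (by rcases hsq v hv with k | k
          · left; exact Subtype.ext k
          · right; exact Subtype.ext k)
      (by intro y hy
          rcases hcomm v hv y hy with k | k
          · left; exact Subtype.ext k
          · right; exact Subtype.ext k) (ψ.comp ι) (hψA z hz) hψv (by
        intro x hx h
        refine hN' x ?_ h
        apply mem_normalizer_of_conj
        intro y hy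
        have h3 := conj_mem_of_mem_normalizer hx (show (⟨y, hPC hy⟩ : C) ∈ (P.subtype hPC : Subgroup C) from hy)
        exact h3)
    obtain ⟨Ψ, h⟩ := isolift z hzz (isolated P R0 A z hR0 (hAR hz) hzz hzP hcomm (hcen hz1)
      (hcard hz1)) C hC Φ v hvC h
    exact ⟨Ψ, v, h⟩

end Reg

namespace Reg
open Subgroup Module

theorem qact {X : Type} [Group X] [Finite X] (Γ U B : Subgroup X) (hBU : B ≤ U)
    (hU : ∀ γ ∈ Γ, ∀ u ∈ U, γ * u * γ⁻¹ ∈ U) (hB : ∀ γ ∈ Γ, ∀ b ∈ B, γ * b * γ⁻¹ ∈ B)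
    (hn : ∀ u ∈ U, ∀ b ∈ B, u * b * u⁻¹ ∈ B) :
    ∃ (Q : Type) (_ : Group Q) (_ : Finite Q) (p : X → Q) (ρ : Γ →* MulAut Q),
      (∀ x ∈ U, ∀ y ∈ U, p (x * y) = p x * p y) ∧ (∀ x ∈ U, p x = 1 ↔ x ∈ B) ∧
      (∀ q, ∃ x ∈ U, p x = q) ∧ (∀ γ : Γ, ∀ x ∈ U, ρ γ (p x) = p (γ * x * (γ : X)⁻¹)) ∧
      Nat.card U = Nat.card Q * Nat.card B := by
  classical
  have hnorm : (B.subgroupOf U).Normal := ⟨fun b hb u => hn u u.2 b hb⟩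
  let α : Γ →* MulAut U := (normalizerMonoidHom U).comp
    (Subgroup.inclusion (fun γ hγ => mem_normalizer_of_conj (hU γ hγ)))
  have hα : ∀ γ u, ((α γ u : U) : X) = γ * u * (γ : X)⁻¹ := fun γ u => rfl
  have hα' : ∀ γ, (B.subgroupOf U).map (α γ).toMonoidHom = B.subgroupOf U := by
    intro γ
    apply le_antisymm
    · rintro _ ⟨u, hu, rfl⟩
      exact hB γ γ.2 u hu
    · intro u hu
      refine ⟨α γ⁻¹ u, ?_, ?_⟩
      · have := hB (γ : X)⁻¹ (inv_mem γ.2) u hu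
        exact this
      · show (α γ * α γ⁻¹) u = u
        rw [← map_mul, mul_inv_cancel, map_one]; rfl
  let p : X → U ⧸ B.subgroupOf U := fun x => if h : x ∈ U then ((⟨x, h⟩ : U) : U ⧸ B.subgroupOf U) else 1
  have hp : ∀ x (h : x ∈ U), p x = ((⟨x, h⟩ : U) : U ⧸ B.subgroupOf U) := fun x h => dif_pos h
  let ρ : Γ →* MulAut (U ⧸ B.subgroupOf U) :=
    { toFun := fun γ => QuotientGroup.congr _ _ (α γ) (hα' γ)
      map_one' := by
        ext q
        obtain ⟨u, rfl⟩ := QuotientGroup.mk_surjective q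
        show ((α 1 u : U) : U ⧸ B.subgroupOf U) = _
        rw [map_one]; rfl
      map_mul' := by
        intro γ δ
        ext q
        obtain ⟨u, rfl⟩ := QuotientGroup.mk_surjective q
        show ((α (γ * δ) u : U) : U ⧸ B.subgroupOf U) = _
        rw [map_mul]; rfl }
  refine ⟨U ⧸ B.subgroupOf U, inferInstance, inferInstance, p, ρ, ?_, ?_, ?_, ?_, ?_⟩
  · intro x hx y hy
    rw [hp x hx, hp y hy, hp _ (mul_mem hx hy)]
    rfl
  · intro x hx
    rw [hp x hx, QuotientGroup.eq_one_iff, mem_subgroupOf]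
  · intro q
    obtain ⟨u, rfl⟩ := QuotientGroup.mk_surjective q
    exact ⟨u, u.2, hp _ _⟩
  · intro γ x hx
    rw [hp x hx, hp _ (hU γ γ.2 x hx)]
    rfl
  · rw [Subgroup.card_eq_card_quotient_mul_card_subgroup (B.subgroupOf U)]
    congr 1
    exact Nat.card_congr (subgroupOfEquivOfLe hBU).toEquiv

theorem vpack {X : Type} [Group X] [Finite X] (Γ U B : Subgroup X) (hBU : B ≤ U)
    (hU : ∀ γ ∈ Γ, ∀ u ∈ U, γ * u * γ⁻¹ ∈ U) (hB : ∀ γ ∈ Γ, ∀ b ∈ B, γ * b * γ⁻¹ ∈ B)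
    (hn : ∀ u ∈ U, ∀ b ∈ B, u * b * u⁻¹ ∈ B) (hsq : ∀ u ∈ U, u * u ∈ B) :
    ∃ (V : Type) (_ : AddCommGroup V) (_ : Module (ZMod 2) V) (_ : Finite V) (p : X → V)
      (ρ : Γ →* (End (ZMod 2) V)ˣ),
      (∀ x ∈ U, ∀ y ∈ U, p (x * y) = p x + p y) ∧ (∀ x ∈ U, p x = 0 ↔ x ∈ B) ∧
      (∀ q, ∃ x ∈ U, p x = q) ∧
      (∀ γ : Γ, ∀ x ∈ U, (ρ γ : End (ZMod 2) V) (p x) = p (γ * x * (γ : X)⁻¹)) ∧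
      Nat.card U = Nat.card V * Nat.card B := by
  obtain ⟨Q, i, _, p, ρ, h1, h2, h3, h4, h5⟩ := qact Γ U B hBU hU hB hn
  have hsq' : ∀ q : Q, q * q = 1 := by
    intro q
    obtain ⟨x, hx, rfl⟩ := h3 q
    rw [← h1 x hx x hx, h2 _ (mul_mem hx hx)]
    exact hsq x hx
  have hc : ∀ a b : Q, a * b = b * a := by
    intro a b
    have h := hsq' (a * b)
    have ha := eq_inv_of_mul_eq_one_left (hsq' a)
    have hb := eq_inv_of_mul_eq_one_left (hsq' b)
    have := eq_inv_of_mul_eq_one_left h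
    rw [this, mul_inv_rev, ← ha, ← hb]
  let j : CommGroup Q := { i with mul_comm := hc }
  have : Finite (Additive Q) := inferInstanceAs (Finite Q)
  let m : Module (ZMod 2) (Additive Q) :=
    AddCommGroup.zmodModule (fun x => by
      have := hsq' x.toMul
      rw [two_smul]
      exact congrArg Additive.ofMul this)
  have key : ∀ (V : Type) [AddCommGroup V] [Module (ZMod 2) V] (ρ : Γ →* MulAut (Multiplicative V)),
      ∃ ρ' : Γ →* (End (ZMod 2) V)ˣ, ∀ γ v, (ρ' γ : End (ZMod 2) V) v =
        Multiplicative.toAdd (ρ γ (Multiplicative.ofAdd v)) := by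
    intro V _ _ ρ
    let f : MulAut (Multiplicative V) →* End (ZMod 2) V :=
      { toFun := fun α => AddMonoidHom.toZModLinearMap 2
          (AddMonoidHom.toMultiplicative.symm α.toMonoidHom)
        map_one' := by ext x; rfl
        map_mul' := fun a b => by ext x; rfl }
    exact ⟨f.toHomUnits.comp ρ, fun γ v => rfl⟩
  obtain ⟨ρ', hρ'⟩ := key (Additive Q) ρ
  refine ⟨Additive Q, inferInstance, m, this, p, ρ', h1, h2, h3, ?_, h5⟩
  intro γ x hx
  exact (hρ' γ (p x)).trans (h4 γ x hx)

theorem quotact {S : Type} [Group S] [IsSimpleGroup S] (hS : ¬ ∀ a b : S, a * b = b * a)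
    {X : Type} [Group X] [Finite X] {e : ℕ} (hG : GLT S 2 e) {L U B : Subgroup X} (hL : PP S L)
    (hBU : B ≤ U)
    (hU : ∀ γ ∈ L, ∀ u ∈ U, γ * u * γ⁻¹ ∈ U) (hB : ∀ γ ∈ L, ∀ b ∈ B, γ * b * γ⁻¹ ∈ B)
    (hn : ∀ u ∈ U, ∀ b ∈ B, u * b * u⁻¹ ∈ B) {k : ℕ} (hk : k ≤ e)
    (hc : Nat.card U = 2 ^ k * Nat.card B) : ∀ l ∈ L, ∀ u ∈ U, l * u * l⁻¹ * u⁻¹ ∈ B := by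
  obtain ⟨Q, _, _, p, ρ, h1, h2, h3, h4, h5⟩ := qact L U B hBU hU hB hn
  have : Fact (Nat.Prime 2) := ⟨Nat.prime_two⟩
  have hQ : Nat.card Q = 2 ^ k := by
    rw [h5] at hc
    exact Nat.eq_of_mul_eq_mul_right Nat.card_pos hc
  have hT := hL _ ρ (bprime hS hG k hk Q hQ)
  intro l hl u hu
  have e1 := h4 ⟨l, hl⟩ u hu
  rw [hT] at e1
  have e1 : p u = p (l * u * l⁻¹) := e1
  rw [← h2 _ (mul_mem (hU l hl u hu) (inv_mem hu)), h1 _ (hU l hl u hu) _ (inv_mem hu), ← e1,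
    ← h1 _ hu _ (inv_mem hu), mul_inv_cancel, h2 _ (one_mem _)]
  exact one_mem _

end Reg

namespace Reg
open Subgroup Module

theorem endo01_aux {S : Type} [Group S] {L : Type} [Group L] (hL : PP S L) {e : ℕ}
    (hE : ∀ (F V : Type) [Field F] [AddCommGroup V] [Module F V] [Finite V], (2 : F) = 0 →
      finrank F V ≤ e → ¬ Inv S (End F V)ˣ)
    {V : Type} [AddCommGroup V] [Module (ZMod 2) V] [Finite V]
    (hd : finrank (ZMod 2) V ≤ 2 * e + 1) (ρ : L →* (End (ZMod 2) V)ˣ) (hnt : ∃ l, ρ l ≠ 1)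
    (F : Type) [Field F] [Finite F] [Algebra (ZMod 2) F] [Module F V] [IsScalarTower (ZMod 2) F V]
    (hc : ∀ l (f : F) (v : V), (ρ l : End (ZMod 2) V) (f • v) = f • (ρ l : End (ZMod 2) V) v) :
    finrank (ZMod 2) F = 1 := by
  by_contra hne
  have : Module.Finite (ZMod 2) F := Module.Finite.of_finite
  have hpos : 0 < finrank (ZMod 2) F := finrank_pos
  have h2 : 2 ≤ finrank (ZMod 2) F := by omega
  have hmul := finrank_mul_finrank (ZMod 2) F V
  have h3 : finrank F V ≤ e := by nlinarith
  have h20 : (2 : F) = 0 := by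
    have : algebraMap (ZMod 2) F 2 = 0 := by
      rw [show (2 : ZMod 2) = 0 from rfl, map_zero]
    rwa [map_ofNat] at this
  let σ : L →* End F V :=
    { toFun := fun l => { toFun := fun v => (ρ l : End (ZMod 2) V) v
                          map_add' := fun v w => map_add _ v w
                          map_smul' := fun f v => hc l f v }
      map_one' := by ext v; simp
      map_mul' := by intro a b; ext v; simp }
  obtain ⟨l, hl⟩ := hnt
  apply hl
  have := hL _ σ.toHomUnits (hE F V h20 h3) l
  ext v
  have h4 : σ l = 1 := congrArg Units.val this
  exact congrArg (fun t : End F V => t v) h4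

theorem endo01 {S : Type} [Group S] {L : Type} [Group L] (hL : PP S L) {e : ℕ}
    (hE : ∀ (F V : Type) [Field F] [AddCommGroup V] [Module F V] [Finite V], (2 : F) = 0 →
      finrank F V ≤ e → ¬ Inv S (End F V)ˣ)
    {V : Type} [AddCommGroup V] [Module (ZMod 2) V] [Finite V]
    (hd : finrank (ZMod 2) V ≤ 2 * e + 1) (ρ : L →* (End (ZMod 2) V)ˣ) (hnt : ∃ l, ρ l ≠ 1)
    (hsimp : ∀ W : Submodule (ZMod 2) V, (∀ l, ∀ w ∈ W, (ρ l : End (ZMod 2) V) w ∈ W) →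
      W = ⊥ ∨ W = ⊤)
    (φ : End (ZMod 2) V) (hφ : ∀ l, φ * ρ l = ρ l * φ) : φ = 0 ∨ φ = 1 := by
  let K : Subalgebra (ZMod 2) (End (ZMod 2) V) :=
    Subalgebra.centralizer (ZMod 2) (Set.range fun l => (ρ l : End (ZMod 2) V))
  have hK : ∀ k : End (ZMod 2) V, k ∈ K ↔ ∀ l, (ρ l : End (ZMod 2) V) * k = k * ρ l := by
    intro k
    simp only [K, Subalgebra.mem_centralizer_iff, Set.forall_mem_range]
  have hinj : ∀ k ∈ K, k ≠ 0 → ∀ v, k v = 0 → v = 0 := by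
    intro k hk h0 v hv
    rcases hsimp (LinearMap.ker k) (by
      intro l w hw
      rw [LinearMap.mem_ker] at hw ⊢
      have := congrArg (fun t : End (ZMod 2) V => t w) ((hK k).1 hk l)
      simp only [Module.End.mul_apply] at this
      rw [← this, hw, map_zero]) with h | h
    · have : v ∈ LinearMap.ker k := hv
      rw [h] at this
      exact (Submodule.mem_bot _).1 this
    · exact absurd (LinearMap.ker_eq_top.1 h) h0
  have hV : Nontrivial V := by
    obtain ⟨l, hl⟩ := hnt
    by_contra hcon
    have := not_nontrivial_iff_subsingleton.1 hcon
    apply hl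
    ext v
    exact Subsingleton.elim _ _
  have : Finite (End (ZMod 2) V) := Finite.of_injective (fun f => (f : V → V)) DFunLike.coe_injective
  have : Finite K := inferInstance
  have : IsDomain K := by
    have : NoZeroDivisors K := ⟨by
      intro a b hab
      by_contra hcon
      push Not at hcon
      obtain ⟨ha, hb⟩ := hcon
      apply hb
      apply Subtype.ext
      ext v
      apply hinj a a.2 (fun h => ha (Subtype.ext h))
      have := congrArg (fun t : K => (t : End (ZMod 2) V) v) hab
      exact this⟩
    exact NoZeroDivisors.to_isDomain K
  letI : Field K := (Finite.isDomain_to_isField K).toField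
  have h1 : finrank (ZMod 2) K = 1 := by
    refine endo01_aux hL hE hd ρ hnt K ?_
    intro l k v
    have := congrArg (fun t : End (ZMod 2) V => t v) ((hK k).1 k.2 l)
    exact this
  have hfin : Module.Finite (ZMod 2) K := Module.Finite.of_finite
  have h2 : Nat.card K = 2 := by
    have := Module.natCard_eq_pow_finrank (K := ZMod 2) (V := K)
    rw [h1, Nat.card_zmod, pow_one] at this
    exact this
  by_contra hcon
  push Not at hcon
  have h3 : Function.Injective (fun i : Fin 3 => (![0, 1, ⟨φ, (hK φ).2 fun l => (hφ l).symm⟩] i : K)) := by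
    have h01 : (0 : K) ≠ 1 := zero_ne_one
    have h02 : (0 : K) ≠ ⟨φ, (hK φ).2 fun l => (hφ l).symm⟩ := fun h =>
      hcon.1 (congrArg Subtype.val h).symm
    have h12 : (1 : K) ≠ ⟨φ, (hK φ).2 fun l => (hφ l).symm⟩ := fun h =>
      hcon.2 (congrArg Subtype.val h).symm
    intro i j hij
    fin_cases i <;> fin_cases j <;> first | rfl | (exfalso; first | exact h01 hij | exact h02 hij | exact h12 hij | exact h01 hij.symm | exact h02 hij.symm | exact h12 hij.symm)
  have := Nat.card_le_card_of_injective _ h3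
  rw [h2] at this
  simp at this

section forms
variable {L : Type} [Group L] {V : Type} [AddCommGroup V] [Module (ZMod 2) V] [Finite V]
  (ρ : L →* (End (ZMod 2) V)ˣ)

theorem form_inj (hsimp : ∀ W : Submodule (ZMod 2) V, (∀ l, ∀ w ∈ W, (ρ l : End (ZMod 2) V) w ∈ W) →
      W = ⊥ ∨ W = ⊤) (b : V →ₗ[ZMod 2] V →ₗ[ZMod 2] ZMod 2)
    (hb : ∀ l v w, b ((ρ l : End (ZMod 2) V) v) ((ρ l : End (ZMod 2) V) w) = b v w)
    (h0 : b ≠ 0) : Function.Injective b := by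
  rcases hsimp (LinearMap.ker b) (by
      intro l w hw
      rw [LinearMap.mem_ker] at hw ⊢
      ext u
      have := hb l w ((ρ l⁻¹ : End (ZMod 2) V) u)
      rw [hw, ← Module.End.mul_apply, ← Units.val_mul, ← map_mul, mul_inv_cancel, map_one] at this
      simpa using this) with h | h
  · exact LinearMap.ker_eq_bot.1 h
  · exact absurd (LinearMap.ker_eq_top.1 h) h0

theorem forms01 (hsimp : ∀ W : Submodule (ZMod 2) V,
      (∀ l, ∀ w ∈ W, (ρ l : End (ZMod 2) V) w ∈ W) → W = ⊥ ∨ W = ⊤)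
    (hE : ∀ φ : End (ZMod 2) V, (∀ l, φ * ρ l = ρ l * φ) → φ = 0 ∨ φ = 1)
    (b c : V →ₗ[ZMod 2] V →ₗ[ZMod 2] ZMod 2)
    (hb : ∀ l v w, b ((ρ l : End (ZMod 2) V) v) ((ρ l : End (ZMod 2) V) w) = b v w)
    (hc : ∀ l v w, c ((ρ l : End (ZMod 2) V) v) ((ρ l : End (ZMod 2) V) w) = c v w)
    (h0 : b ≠ 0) : c = 0 ∨ c = b := by
  have hi := form_inj ρ hsimp b hb h0
  have : Module.Finite (ZMod 2) V := Module.Finite.of_finite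
  have hfr : finrank (ZMod 2) V = finrank (ZMod 2) (V →ₗ[ZMod 2] ZMod 2) :=
    (Subspace.dual_finrank_eq).symm
  have hs : Function.Surjective b := (LinearMap.injective_iff_surjective_of_finrank_eq_finrank hfr).1 hi
  let E := LinearEquiv.ofBijective b ⟨hi, hs⟩
  let φ : End (ZMod 2) V := E.symm.toLinearMap ∘ₗ c
  have hφ : ∀ v, b (φ v) = c v := fun v => E.apply_symm_apply (c v)
  rcases hE φ (by
    intro l
    ext v
    apply hi
    ext w
    simp only [Module.End.mul_apply]
    rw [hφ]
    have e1 : w = (ρ l : End (ZMod 2) V) ((ρ l⁻¹ : End (ZMod 2) V) w) := by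
      rw [← Module.End.mul_apply, ← Units.val_mul, ← map_mul, mul_inv_cancel, map_one]; rfl
    rw [e1, hc, hb, hφ]) with h | h
  · left
    ext v w
    rw [← hφ, h]; simp
  · right
    ext v w
    rw [← hφ, h]; simp

theorem no_form4 (hsimp : ∀ W : Submodule (ZMod 2) V,
      (∀ l, ∀ w ∈ W, (ρ l : End (ZMod 2) V) w ∈ W) → W = ⊥ ∨ W = ⊤)
    (b : V →ₗ[ZMod 2] V →ₗ[ZMod 2] ZMod 2)
    (hb : ∀ l v w, b ((ρ l : End (ZMod 2) V) v) ((ρ l : End (ZMod 2) V) w) = b v w)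
    (h0 : b ≠ 0) (halt : ∀ v, b v v = 0) (hV : Nat.card V = 16) (l : L) (hl : orderOf (ρ l) = 7) : False := by
  classical
  have := Fintype.ofFinite V
  have h7 : Fact (Nat.Prime 7) := ⟨by norm_num⟩
  have hi := form_inj ρ hsimp b hb h0
  let c : End (ZMod 2) V := (ρ l : End (ZMod 2) V)
  have hc7 : (c ^ 7) = 1 := by
    have := pow_orderOf_eq_one (ρ l)
    rw [hl] at this
    exact congrArg Units.val this
  have hcne : c ≠ 1 := by
    intro h
    have : ρ l = 1 := Units.ext h
    rw [this, orderOf_one] at hl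
    omega
  have hit : ∀ v, c^[7] v = v := by
    intro v
    have := congrArg (fun t : End (ZMod 2) V => t v) hc7
    rw [Module.End.pow_apply] at this
    exact this
  have cnt : ∀ (s : Set V), (∀ v ∈ s, c v ∈ s) →
      Nat.card s ≡ Nat.card {v : V // v ∈ s ∧ c v = v} [MOD 7] := by
    intro s hs
    let f : s → s := fun v => ⟨c v, hs v v.2⟩
    have hf : f^[7 ^ 1] = id := by
      funext v
      apply Subtype.ext
      have : ∀ k, ((f^[k] v : s) : V) = c^[k] v := by
        intro k
        induction k with
        | zero => rfl
        | succ k ih => rw [Function.iterate_succ_apply', Function.iterate_succ_apply', ← ih]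
      rw [this]
      exact hit v
    have := Equiv.Perm.card_fixedPoints_modEq hf
    rw [Nat.card_eq_fintype_card]
    refine this.trans ?_
    rw [← Nat.card_eq_fintype_card]
    rw [Nat.card_congr (show Function.fixedPoints f ≃ {v : V // v ∈ s ∧ c v = v} from
      ⟨fun v => ⟨v.1.1, v.1.2, congrArg Subtype.val v.2⟩, fun v => ⟨⟨v.1, v.2.1⟩, Subtype.ext v.2.2⟩,
        fun v => rfl, fun v => rfl⟩)]
  let W : Submodule (ZMod 2) V := LinearMap.ker (c - 1)
  have hW : ∀ v, v ∈ W ↔ c v = v := by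
    intro v
    simp [W, sub_eq_zero]
  have hWc : Nat.card W = 2 := by
    have h1 := cnt Set.univ (fun _ _ => trivial)
    have h2 : Nat.card {v : V // v ∈ Set.univ ∧ c v = v} = Nat.card W :=
      Nat.card_congr (Equiv.subtypeEquivRight (fun v => by simp [hW]))
    rw [h2, Nat.card_univ, hV] at h1
    have h3 : Nat.card W ∣ 2 ^ 4 := by
      have := AddSubgroup.card_addSubgroup_dvd_card W.toAddSubgroup
      rw [hV] at this
      exact this
    obtain ⟨k, hk, hk2⟩ := (Nat.dvd_prime_pow Nat.prime_two).1 h3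
    rw [hk2] at h1 ⊢
    have h16 : k ≠ 4 := by
      rintro rfl
      apply hcne
      have : W.toAddSubgroup = ⊤ := by
        apply AddSubgroup.eq_top_of_card_eq
        rw [hV]; exact hk2
      ext v
      have : v ∈ W.toAddSubgroup := by rw [this]; trivial
      exact (hW v).1 this
    interval_cases k <;> first | rfl | (exfalso; revert h1; decide) | omega
  obtain ⟨f, hf⟩ : ∃ f : W, f ≠ 0 := by
    have : Nontrivial W := by
      rw [← Finite.one_lt_card_iff_nontrivial, hWc]; omega
    exact exists_ne 0
  have hfc : c f = f := (hW _).1 f.2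
  have hbf : b f ≠ 0 := fun h => hf (Subtype.ext (hi (by rw [h]; simp)))
  have hker : ∀ v, b f (c v) = b f v := by
    intro v
    have := hb l f v
    have e : (ρ l : End (ZMod 2) V) f = f := hfc
    rw [e] at this
    exact this
  have hrest := cnt {v | b f v ≠ 0} (by
    intro v hv
    show b f (c v) ≠ 0
    rw [hker]; exact hv)
  have hfix : Nat.card {v : V // v ∈ {v | b f v ≠ 0} ∧ c v = v} = 0 := by
    rw [Nat.card_eq_zero]
    left
    constructor
    rintro ⟨v, hv, hcv⟩
    have hvW : v ∈ W := (hW v).2 hcv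
    have hor : ∀ x : W, x = 0 ∨ x = f := by
      intro x
      by_contra hcon
      push Not at hcon
      have h3 : Function.Injective (fun i : Fin 3 => (![0, f, x] i : W)) := by
        intro i j hij
        fin_cases i <;> fin_cases j <;> first | rfl | (exfalso; first | exact hf hij | exact hf hij.symm | exact hcon.1 hij | exact hcon.1 hij.symm | exact hcon.2 hij | exact hcon.2 hij.symm)
      have := Nat.card_le_card_of_injective _ h3
      rw [hWc] at this
      simp at this
    rcases hor ⟨v, hvW⟩ with h | h
    · apply hv
      have : v = 0 := congrArg Subtype.val h
      rw [this]; simp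
    · apply hv
      have : v = f := congrArg Subtype.val h
      rw [this]; exact halt _
  have h8 : Nat.card {v | b f v ≠ 0} = 8 := by
    obtain ⟨w, hw⟩ : ∃ w, b f w ≠ 0 := by
      by_contra hcon
      push Not at hcon
      exact hbf (LinearMap.ext hcon)
    have z2 : ∀ a : ZMod 2, a ≠ 0 → a = 1 := by decide
    have e1 : Nat.card {v | b f v ≠ 0} = Nat.card {v | ¬ b f v ≠ 0} := by
      refine Nat.card_congr ⟨fun v => ⟨v.1 + w, ?_⟩, fun v => ⟨v.1 + w, ?_⟩, fun v => ?_, fun v => ?_⟩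
      · have h1 := z2 _ v.2
        have h2 := z2 _ hw
        show ¬ (b f (v.1 + w) ≠ 0)
        rw [map_add, h1, h2]; decide
      · have h1 : b f v.1 = 0 := not_not.1 v.2
        show b f (v.1 + w) ≠ 0
        rw [map_add, h1, zero_add]; exact hw
      all_goals
        apply Subtype.ext
        have : w + w = 0 := by rw [← two_smul (ZMod 2)]; rw [show (2 : ZMod 2) = 0 from rfl, zero_smul]
        simp [add_assoc, this]
    have e2 : Nat.card {v | b f v ≠ 0} + Nat.card {v | ¬ b f v ≠ 0} = 16 := by
      rw [← hV, ← Nat.card_sum]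
      exact Nat.card_congr (Equiv.sumCompl _)
    omega
  rw [hfix, h8] at hrest
  revert hrest; decide

end forms
end Reg

namespace Reg
open Subgroup Module

def Nm {X : Type} [Group X] (Γ B : Subgroup X) : Prop := ∀ g ∈ Γ, ∀ b ∈ B, g * b * g⁻¹ ∈ B

section
variable {S : Type} [Group S] [IsSimpleGroup S] (hS : ¬ ∀ a b : S, a * b = b * a)
variable {X : Type} [Group X] [Finite X]

include hS in
theorem not_inv_2grp {B : Subgroup X} (hB : IsPGroup 2 B) : ¬ Inv S B := by
  have : Fact (Nat.Prime 2) := ⟨Nat.prime_two⟩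
  have h1 : Group.IsNilpotent B := hB.isNilpotent
  have h2 : ¬ Group.IsSolvable S := fun h => hS (IsSimpleGroup.comm_iff_isSolvable.2 h)
  exact not_inv_of_solvable h2

include hS in
theorem getR0 {R G1 L : Subgroup X} (hR2 : IsPGroup 2 R) (hGR : Nm G1 R)
    (hLG : L ≤ G1) (hL : PP S L) (hGL : Nm G1 L) (hex : ∃ l ∈ L, ∃ r ∈ R, l * r ≠ r * l) :
    ∃ R0 ≤ R, Nm G1 R0 ∧ (∃ l ∈ L, ∃ u ∈ R0, l * u ≠ u * l) ∧
      (∀ B ≤ R0, Nm G1 B → B ≠ R0 → ∀ l ∈ L, ∀ b ∈ B, l * b = b * l) ∧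
      (∀ K : Subgroup X, (∀ l ∈ L, ∀ u ∈ R0, l * u * l⁻¹ * u⁻¹ ∈ K) → R0 ≤ K) := by
  classical
  have hfin : Finite (Subgroup X) := inferInstance
  obtain ⟨R0, ⟨h1, h2, h3⟩, hmin⟩ := (Set.toFinite {U : Subgroup X | U ≤ R ∧ Nm G1 U ∧
    ∃ l ∈ L, ∃ u ∈ U, l * u ≠ u * l}).exists_minimal ⟨R, le_rfl, hGR, hex⟩
  have hm : ∀ B ≤ R0, Nm G1 B → B ≠ R0 → ∀ l ∈ L, ∀ b ∈ B, l * b = b * l := by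
    intro B hB hn hne
    by_contra hcon
    push Not at hcon
    have h4 := hmin (y := B) ⟨hB.trans h1, hn, hcon⟩ hB
    exact hne (le_antisymm hB h4)
  refine ⟨R0, h1, h2, h3, hm, ?_⟩
  intro K hK
  let M : Subgroup X := closure {x | ∃ l ∈ L, ∃ u ∈ R0, x = l * u * l⁻¹ * u⁻¹}
  have hMR : M ≤ R0 := by
    rw [closure_le]
    rintro _ ⟨l, hl, u, hu, rfl⟩
    exact mul_mem (h2 l (hLG hl) u hu) (inv_mem hu)
  have hMK : M ≤ K := by
    rw [closure_le]
    rintro _ ⟨l, hl, u, hu, rfl⟩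
    exact hK l hl u hu
  have hMn : Nm G1 M := by
    intro g hg x hx
    have : M ≤ M.comap (MulAut.conj g).toMonoidHom := by
      rw [closure_le]
      rintro _ ⟨l, hl, u, hu, rfl⟩
      apply Subgroup.subset_closure
      refine ⟨g * l * g⁻¹, hGL g hg l hl, g * u * g⁻¹, h2 g hg u hu, ?_⟩
      simp [mul_assoc]
    exact this hx
  by_cases hne : M = R0
  · rw [← hne]; exact hMK
  · exfalso
    have h4 := hm M hMR hMn hne
    obtain ⟨l, hl, u, hu, hlu⟩ := h3
    apply hlu
    refine (hL.comm_trick M (not_inv_2grp hS (hR2.to_le (hMR.trans h1))) h4 u ?_ l hl).symm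
    intro l hl
    have : u * l * u⁻¹ * l⁻¹ = (l * u * l⁻¹ * u⁻¹)⁻¹ := by group
    rw [this]
    exact inv_mem (Subgroup.subset_closure ⟨l, hl, u, hu, rfl⟩)

end

section
variable {X : Type} [Group X] [Finite X] {R G1 L R0 : Subgroup X}

def Ac (R0 L : Subgroup X) : Subgroup X := R0 ⊓ centralizer (L : Set X)

theorem mem_Ac {x : X} : x ∈ Ac R0 L ↔ x ∈ R0 ∧ ∀ l ∈ L, l * x = x * l := by
  rw [Ac, mem_inf, mem_centralizer_iff]; rfl

theorem Ac_nm (hGL : Nm G1 L) (hn : Nm G1 R0) : Nm G1 (Ac R0 L) := by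
  intro g hg a ha
  rw [mem_Ac] at ha ⊢
  refine ⟨hn g hg a ha.1, fun l hl => ?_⟩
  have h1 := hGL g⁻¹ (inv_mem hg) l hl
  rw [inv_inv] at h1
  have := ha.2 _ h1
  calc l * (g * a * g⁻¹) = g * (g⁻¹ * l * g * a) * g⁻¹ := by group
    _ = _ := by rw [this]; group

theorem not_le_Ac (h3 : ∃ l ∈ L, ∃ u ∈ R0, l * u ≠ u * l) : ¬ R0 ≤ Ac R0 L := by
  intro h
  obtain ⟨l, hl, u, hu, hlu⟩ := h3
  exact hlu ((mem_Ac.1 (h hu)).2 l hl)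

theorem comm_ne (hR2 : IsPGroup 2 R) (hR0 : R0 ≤ R) (h : ⁅R0, R⁆ = R0) : R0 = ⊥ := by
  have : Fact (Nat.Prime 2) := ⟨Nat.prime_two⟩
  have h1 : Group.IsNilpotent R := hR2.isNilpotent
  have e : ⁅R0.subgroupOf R, (⊤ : Subgroup R)⁆ = R0.subgroupOf R := by
    apply Subgroup.map_injective R.subtype_injective
    rw [map_commutator, subgroupOf_map_subtype, inf_eq_left.2 hR0]
    have : (⊤ : Subgroup R).map R.subtype = R := by rw [← MonoidHom.range_eq_map, range_subtype]
    rw [this]; exact h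
  have h2 : ∀ k, R0.subgroupOf R ≤ (⊤ : Subgroup R).lowerCentralSeries k := by
    intro k
    induction k with
    | zero => exact le_top
    | succ k ih =>
      rw [← e]
      exact commutator_mono ih le_rfl
  have h3 := h2 (Group.nilpotencyClass R)
  rw [Subgroup.lowerCentralSeries_nilpotencyClass, le_bot_iff, subgroupOf_eq_bot] at h3
  rw [disjoint_iff] at h3
  rwa [inf_eq_left.2 hR0] at h3

variable (hR2 : IsPGroup 2 R) (hRG : R ≤ G1) (hGR : Nm G1 R) (hLG : L ≤ G1) (hGL : Nm G1 L)
  (hR0 : R0 ≤ R) (hn : Nm G1 R0) (h3 : ∃ l ∈ L, ∃ u ∈ R0, l * u ≠ u * l)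
  (hm : ∀ B ≤ R0, Nm G1 B → B ≠ R0 → ∀ l ∈ L, ∀ b ∈ B, l * b = b * l)
  (gen : ∀ K : Subgroup X, (∀ l ∈ L, ∀ u ∈ R0, l * u * l⁻¹ * u⁻¹ ∈ K) → R0 ≤ K)

include hm in
theorem le_Ac_of {B : Subgroup X} (hB : B ≤ R0) (hBn : Nm G1 B) (hne : B ≠ R0) : B ≤ Ac R0 L :=
  fun b hb => mem_Ac.2 ⟨hB hb, fun l hl => hm B hB hBn hne l hl b hb⟩

include hR2 hRG hGR hR0 hn h3 hm in
theorem RA : ∀ y ∈ R, ∀ u ∈ R0, y * u * y⁻¹ * u⁻¹ ∈ Ac R0 L := by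
  have h1 : ⁅R0, R⁆ ≤ R0 := by
    rw [commutator_le]
    intro u hu y hy
    rw [commutatorElement_def, mul_assoc, mul_assoc, ← mul_assoc y]
    exact mul_mem hu (hn y (hRG hy) _ (inv_mem hu))
  have h2 : Nm G1 ⁅R0, R⁆ := by
    intro g hg x hx
    have : ⁅R0, R⁆ ≤ (⁅R0, R⁆).comap (MulAut.conj g).toMonoidHom := by
      rw [commutator_le]
      intro u hu y hy
      rw [mem_comap, map_commutatorElement]
      exact commutator_mem_commutator (hn g hg u hu) (hGR g hg y hy)
    exact this hx
  have h4 : ⁅R0, R⁆ ≠ R0 := by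
    intro h
    have := comm_ne hR2 hR0 h
    obtain ⟨l, hl, u, hu, hlu⟩ := h3
    rw [this, mem_bot] at hu
    apply hlu; rw [hu]; simp
  intro y hy u hu
  apply le_Ac_of hm h1 h2 h4
  have := commutator_mem_commutator hu hy
  rw [← inv_mem_iff, commutatorElement_def] at this
  convert this using 1
  group

include hRG hLG hGL hn gen hR0 in
theorem Acen : ∀ a ∈ Ac R0 L, ∀ u ∈ R0, a * u = u * a := by
  intro a ha u hu
  have := gen (centralizer {a}) (by
    intro l hl u hu
    rw [mem_centralizer_singleton_iff]
    have hc := Ac_nm hGL hn (u⁻¹) (inv_mem (hRG (hR0 hu))) a ha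
    rw [inv_inv] at hc
    have hc : u⁻¹ * a * u * a⁻¹ ∈ Ac R0 L := mul_mem hc (inv_mem ha)
    obtain ⟨c, hcd⟩ : ∃ c, c = u⁻¹ * a * u * a⁻¹ := ⟨_, rfl⟩
    rw [← hcd] at hc
    have e1 : a * u = u * c * a := by rw [hcd]; group
    have e2 := (mem_Ac.1 ha).2 l hl
    have e3 := (mem_Ac.1 hc).2 l hl
    have e4 : a * (l * u * l⁻¹) = l * u * l⁻¹ * c * a := by
      calc a * (l * u * l⁻¹) = (a * l) * u * l⁻¹ := by group
        _ = l * (a * u) * l⁻¹ := by rw [← e2]; group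
        _ = l * u * c * (a * l⁻¹) := by rw [e1]; group
        _ = l * u * c * (l⁻¹ * a) := by
            congr 1
            calc a * l⁻¹ = l⁻¹ * (l * a) * l⁻¹ := by group
              _ = _ := by rw [e2]; group
        _ = l * u * (c * l⁻¹) * a := by group
        _ = l * u * (l⁻¹ * c) * a := by
            congr 2
            calc c * l⁻¹ = l⁻¹ * (l * c) * l⁻¹ := by group
              _ = _ := by rw [e3]; group
        _ = _ := by group
    have e5 : c * a * u⁻¹ = u⁻¹ * a := by rw [hcd]; group
    calc l * u * l⁻¹ * u⁻¹ * a = l * u * l⁻¹ * (c * a * u⁻¹) := by rw [e5]; group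
      _ = (l * u * l⁻¹ * c * a) * u⁻¹ := by group
      _ = _ := by rw [← e4]; group) hu
  exact (mem_centralizer_singleton_iff.1 this).symm

include hR2 hRG hGR hLG hGL hR0 hn h3 hm gen in
theorem sqA : ∀ u ∈ R0, u * u ∈ Ac R0 L := by
  have hAn := Ac_nm (R0 := R0) hGL hn
  have hcom := RA hR2 hRG hGR hR0 hn h3 hm
  obtain ⟨Q, i, _, p, ρ, p1, p2, p3, p4, p5⟩ := qact G1 R0 (Ac R0 L) (fun a ha => (mem_Ac.1 ha).1) hn hAn
    (fun u hu a ha => hAn u (hRG (hR0 hu)) a ha)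
  have pinv : ∀ x ∈ R0, p x⁻¹ = (p x)⁻¹ := by
    intro x hx
    have h := p1 x hx x⁻¹ (inv_mem hx)
    rw [mul_inv_cancel, (p2 1 (one_mem _)).2 (one_mem _)] at h
    exact eq_inv_of_mul_eq_one_right h.symm
  have hc : ∀ a b : Q, a * b = b * a := by
    intro a b
    obtain ⟨x, hx, rfl⟩ := p3 a
    obtain ⟨y, hy, rfl⟩ := p3 b
    have h := (p2 _ (mul_mem (mul_mem (mul_mem hx hy) (inv_mem hx)) (inv_mem hy))).2 (hcom x (hR0 hx) y hy)
    rw [p1 _ (mul_mem (mul_mem hx hy) (inv_mem hx)) _ (inv_mem hy), p1 _ (mul_mem hx hy) _ (inv_mem hx),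
      p1 _ hx _ hy, pinv x hx, pinv y hy] at h
    have h2 : p x * p y = (p x * p y * (p x)⁻¹ * (p y)⁻¹) * (p y * p x) := by group
    rw [h, one_mul] at h2
    exact h2
  let B : Subgroup X := 
    { carrier := {x | x ∈ R0 ∧ ∃ q : Q, p x = q * q}
      one_mem' := ⟨one_mem _, 1, by rw [(p2 1 (one_mem _)).2 (one_mem _)]; simp⟩
      mul_mem' := by
        rintro x y ⟨hx, q, hq⟩ ⟨hy, q', hq'⟩
        refine ⟨mul_mem hx hy, q * q', ?_⟩
        rw [p1 x hx y hy, hq, hq']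
        calc q * q * (q' * q') = q * (q * q') * q' := by group
          _ = q * (q' * q) * q' := by rw [hc q q']
          _ = _ := by group
      inv_mem' := by
        rintro x ⟨hx, q, hq⟩
        refine ⟨inv_mem hx, q⁻¹, ?_⟩
        rw [pinv x hx, hq]; group }
  have hBR : B ≤ R0 := fun x hx => hx.1
  have hBn : Nm G1 B := by
    rintro g hg x ⟨hx, q, hq⟩
    refine ⟨hn g hg x hx, ρ ⟨g, hg⟩ q, ?_⟩
    rw [← map_mul, ← hq, p4 ⟨g, hg⟩ x hx]
  have hBne : B ≠ R0 := by
    intro h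
    have hs : Function.Surjective (fun q : Q => q * q) := by
      intro q
      obtain ⟨x, hx, rfl⟩ := p3 q
      rw [← h] at hx
      obtain ⟨-, q', hq'⟩ := hx
      exact ⟨q', hq'.symm⟩
    have hinj := Finite.injective_iff_surjective.2 hs
    have hQ1 : ∀ q : Q, q = 1 := by
      have hpg : IsPGroup 2 Q := by
        intro q
        obtain ⟨x, hx, rfl⟩ := p3 q
        obtain ⟨k, hk⟩ := hR2 ⟨x, hR0 hx⟩
        refine ⟨k, ?_⟩
        have : ∀ j : ℕ, p (x ^ j) = p x ^ j := by
          intro j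
          induction j with
          | zero => simp [(p2 1 (one_mem _)).2 (one_mem _)]
          | succ j ih => rw [pow_succ, p1 _ (pow_mem hx j) _ hx, ih, pow_succ]
        rw [← this]
        have : x ^ 2 ^ k = 1 := congrArg Subtype.val hk
        rw [this, (p2 1 (one_mem _)).2 (one_mem _)]
      intro q
      obtain ⟨k, hk⟩ := hpg q
      induction k with
      | zero => simpa using hk
      | succ k ih =>
        apply ih
        rw [pow_succ, pow_mul, pow_two] at hk
        apply hinj
        simpa using hk
    apply not_le_Ac h3
    intro u hu
    exact (p2 u hu).1 (hQ1 _)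
  have hBA := le_Ac_of hm hBR hBn hBne
  intro u hu
  exact hBA ⟨mul_mem hu hu, p u, p1 u hu u hu⟩

end
end Reg

namespace Reg
open Subgroup Module

structure Cfg (S : Type) [Group S] {X : Type} [Group X] (e m : ℕ) (R G1 L R0 : Subgroup X) : Prop where
  hS : ¬ ∀ a b : S, a * b = b * a
  hE : ∀ (F V : Type) [Field F] [AddCommGroup V] [Module F V] [Finite V], (2 : F) = 0 →
      finrank F V ≤ e → ¬ Inv S (End F V)ˣ
  hR2 : IsPGroup 2 R
  hcR : Nat.card R = 2 ^ m
  hme : m ≤ 2 * e + 1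
  hRG : R ≤ G1
  hGR : Nm G1 R
  hLG : L ≤ G1
  hL : PP S L
  hGL : Nm G1 L
  hR0 : R0 ≤ R
  hn : Nm G1 R0
  h3 : ∃ l ∈ L, ∃ u ∈ R0, l * u ≠ u * l
  hm : ∀ B ≤ R0, Nm G1 B → B ≠ R0 → ∀ l ∈ L, ∀ b ∈ B, l * b = b * l
  gen : ∀ K : Subgroup X, (∀ l ∈ L, ∀ u ∈ R0, l * u * l⁻¹ * u⁻¹ ∈ K) → R0 ≤ K

theorem pow2_sub {X : Type} [Group X] [Finite X] {U B : Subgroup X} {m : ℕ} (h : B ≤ U) (hU : Nat.card U = 2 ^ m) :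
    ∃ k b, Nat.card B = 2 ^ b ∧ Nat.card U = 2 ^ k * Nat.card B ∧ k + b = m := by
  obtain ⟨b, hb, hb'⟩ := (Nat.dvd_prime_pow Nat.prime_two).1 (hU ▸ card_dvd_of_le h)
  refine ⟨m - b, b, hb', ?_, by omega⟩
  rw [hU, hb', ← pow_add]; congr 1; omega

namespace Cfg
variable {S : Type} [Group S] [IsSimpleGroup S] {X : Type} [Group X] [Finite X] {e m : ℕ}
  {R G1 L R0 : Subgroup X} (C : Cfg S e m R G1 L R0)
include C

theorem ra : ∀ y ∈ R, ∀ u ∈ R0, y * u * y⁻¹ * u⁻¹ ∈ Ac R0 L := RA C.hR2 C.hRG C.hGR C.hR0 C.hn C.h3 C.hm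
theorem acen : ∀ a ∈ Ac R0 L, ∀ u ∈ R0, a * u = u * a := Acen C.hRG C.hLG C.hGL C.hR0 C.hn C.gen
theorem sqa : ∀ u ∈ R0, u * u ∈ Ac R0 L := sqA C.hR2 C.hRG C.hGR C.hLG C.hGL C.hR0 C.hn C.h3 C.hm C.gen
theorem an : Nm G1 (Ac R0 L) := Ac_nm C.hGL C.hn
theorem glt : GLT S 2 e := fun V _ _ _ hV => C.hE (ZMod 2) V (by decide) hV
omit C in
theorem ale : Ac R0 L ≤ R0 := fun a ha => (mem_Ac.1 ha).1

theorem big {B : Subgroup X} (hB : B ≤ R0) (hLB : Nm L B) (hn : ∀ u ∈ R0, ∀ b ∈ B, u * b * u⁻¹ ∈ B) {k : ℕ}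
    (hk : k ≤ e) (hc : Nat.card R0 = 2 ^ k * Nat.card B) : R0 ≤ B :=
  C.gen B (quotact C.hS C.glt C.hL hB (fun l hl => C.hn l (C.hLG hl)) hLB hn hk hc)

theorem dim : ∃ d a, Nat.card R0 = 2 ^ d * Nat.card (Ac R0 L) ∧ e + 1 ≤ d ∧ Nat.card (Ac R0 L) = 2 ^ a ∧ d + a ≤ m := by
  obtain ⟨k, b, h1, h2, h3⟩ := pow2_sub C.hR0 C.hcR
  obtain ⟨d, a, h4, h5, h6⟩ := pow2_sub (ale (L := L)) h1
  refine ⟨d, a, h5, ?_, h4, by omega⟩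
  by_contra hlt
  exact not_le_Ac C.h3 (C.big ale (fun l hl => C.an l (C.hLG hl)) (fun u hu => C.an u (C.hRG (C.hR0 hu)))
    (by omega) h5)

theorem rl : ∀ l ∈ L, ∀ y ∈ R, l * y * l⁻¹ * y⁻¹ ∈ R0 := by
  obtain ⟨k, b, h1, h2, h3⟩ := pow2_sub C.hR0 C.hcR
  obtain ⟨d, a, h4, h5, h6, h7⟩ := C.dim
  have h8 : b = d + a := by
    rw [h1, h6, ← pow_add] at h4
    exact Nat.pow_right_injective le_rfl h4
  have := C.hme
  exact quotact C.hS C.glt C.hL C.hR0 (fun l hl => C.hGR l (C.hLG hl)) (fun l hl => C.hn l (C.hLG hl))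
    (fun u hu => C.hn u (C.hRG hu)) (by omega) h2

theorem simp0 {B : Subgroup X} (hAB : Ac R0 L ≤ B) (hB : B ≤ R0) (hLB : Nm L B) : B = Ac R0 L ∨ B = R0 := by
  have hnor : ∀ u ∈ R0, ∀ b ∈ B, u * b * u⁻¹ ∈ B := by
    intro u hu b hb
    have := mul_mem (hAB (C.ra u (C.hR0 hu) b (hB hb))) hb
    simpa using this
  obtain ⟨k, b, h1, h2, h3⟩ := pow2_sub C.hR0 C.hcR
  obtain ⟨i, j, h4, h5, h6⟩ := pow2_sub hB h1
  obtain ⟨i', j', h7, h8, h9⟩ := pow2_sub hAB h4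
  by_cases hi : i ≤ e
  · right; exact le_antisymm hB (C.big hB hLB hnor hi h5)
  · left
    refine le_antisymm ?_ hAB
    intro x hx
    have hme := C.hme
    have h10 := quotact C.hS C.glt C.hL hAB hLB (fun l hl => C.an l (C.hLG hl))
      (fun u hu => C.an u (C.hRG (C.hR0 (hB hu)))) (show i' ≤ e by omega) h8
    rw [mem_Ac]
    refine ⟨hB hx, fun l hl => ?_⟩
    refine (C.hL.comm_trick (Ac R0 L) (not_inv_2grp C.hS (C.hR2.to_le (ale.trans C.hR0)))
      (fun l hl a ha => (mem_Ac.1 ha).2 l hl) x ?_ l hl).symm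
    intro l hl
    have : x * l * x⁻¹ * l⁻¹ = (l * x * l⁻¹ * x⁻¹)⁻¹ := by group
    rw [this]
    exact inv_mem (h10 l hl x hx)

theorem cD : ∀ x ∈ ⁅R0, R0⁆, x ∈ Ac R0 L := by
  have : ⁅R0, R0⁆ ≤ Ac R0 L := by
    rw [commutator_le]
    intro x hx y hy
    exact C.ra x (C.hR0 hx) y hy
  exact this

theorem rD : ∀ y ∈ R, ∀ u ∈ R0, y * u * y⁻¹ * u⁻¹ ∈ ⁅R0, R0⁆ := by
  have hDc : ∀ x ∈ ⁅R0, R0⁆, ∀ u ∈ R0, x * u = u * x := fun x hx => C.acen x (C.cD x hx)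
  let K : Subgroup X :=
    { carrier := {u | u ∈ R0 ∧ ∀ y ∈ R, y * u * y⁻¹ * u⁻¹ ∈ ⁅R0, R0⁆}
      one_mem' := ⟨one_mem _, fun y hy => by simp⟩
      mul_mem' := by
        rintro u v ⟨hu, hu'⟩ ⟨hv, hv'⟩
        refine ⟨mul_mem hu hv, fun y hy => ?_⟩
        have h := mul_mem (hu' y hy) (hv' y hy)
        have e1 := hDc _ (hv' y hy) u hu
        convert h using 1
        calc y * (u * v) * y⁻¹ * (u * v)⁻¹ = (y * u * y⁻¹) * (y * v * y⁻¹ * v⁻¹ * u⁻¹) := by group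
          _ = (y * u * y⁻¹) * (u⁻¹ * (u * (y * v * y⁻¹ * v⁻¹)) * u⁻¹) := by group
          _ = _ := by rw [← e1]; group
      inv_mem' := by
        rintro u ⟨hu, hu'⟩
        refine ⟨inv_mem hu, fun y hy => ?_⟩
        have h := inv_mem (hu' y hy)
        have e1 := hDc _ h u hu
        convert h using 1
        calc y * u⁻¹ * y⁻¹ * u⁻¹⁻¹ = u⁻¹ * ((y * u * y⁻¹ * u⁻¹)⁻¹ * u) := by group
          _ = _ := by rw [e1]; group }
  have hK : R0 ≤ K := by
    apply C.gen
    intro l hl u hu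
    have hlu := C.hn l (C.hLG hl) u hu
    refine ⟨mul_mem hlu (inv_mem hu), fun y hy => ?_⟩
    have hr := C.rl l⁻¹ (inv_mem hl) y hy
    obtain ⟨r, hr'⟩ : ∃ r, r = l⁻¹ * y * l⁻¹⁻¹ * y⁻¹ := ⟨_, rfl⟩
    rw [← hr'] at hr
    have hA := C.ra y hy u hu
    obtain ⟨c, hc⟩ : ∃ c, c = y * u * y⁻¹ * u⁻¹ := ⟨_, rfl⟩
    rw [← hc] at hA
    have hru : r * u * r⁻¹ * u⁻¹ ∈ ⁅R0, R0⁆ := commutator_mem_commutator hr hu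
    obtain ⟨w, hw⟩ : ∃ w, w = r * u * r⁻¹ * u⁻¹ := ⟨_, rfl⟩
    rw [← hw] at hru
    have hwA := C.cD w hru
    have e1 : y * u * y⁻¹ = c * u := by rw [hc]; group
    have e2 : l⁻¹ * y * l = r * y := by rw [hr']; group
    have e3 : y * (l * u * l⁻¹) * y⁻¹ = c * w * (l * u * l⁻¹) := by
      calc y * (l * u * l⁻¹) * y⁻¹ = l * ((l⁻¹ * y * l) * u * (l⁻¹ * y * l)⁻¹) * l⁻¹ := by group
        _ = l * (r * (y * u * y⁻¹) * r⁻¹) * l⁻¹ := by rw [e2]; group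
        _ = l * ((r * c) * u * r⁻¹) * l⁻¹ := by rw [e1]; group
        _ = (l * c) * (r * u * r⁻¹ * u⁻¹) * u * l⁻¹ := by rw [← C.acen c hA r hr]; group
        _ = c * (l * w) * u * l⁻¹ := by rw [(mem_Ac.1 hA).2 l hl, ← hw]; group
        _ = _ := by rw [(mem_Ac.1 hwA).2 l hl]; group
    have e4 : c * w * (l * u * l⁻¹) = (l * u * l⁻¹) * c * w := by
      rw [C.acen _ (mul_mem hA hwA) _ hlu]; group
    have e5 : u * y⁻¹ * u⁻¹ = y⁻¹ * c := by rw [hc]; group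
    convert hru using 1
    calc y * (l * u * l⁻¹ * u⁻¹) * y⁻¹ * (l * u * l⁻¹ * u⁻¹)⁻¹
        = (y * (l * u * l⁻¹) * y⁻¹) * (y * u * y⁻¹)⁻¹ * u * (l * u * l⁻¹)⁻¹ := by group
      _ = (l * u * l⁻¹) * (c * w) * u⁻¹ * c⁻¹ * u * (l * u * l⁻¹)⁻¹ := by rw [e3, e4, e1]; group
      _ = (l * u * l⁻¹) * (c * w) * u⁻¹ * (c⁻¹ * u) * (l * u * l⁻¹)⁻¹ := by group
      _ = (l * u * l⁻¹) * (c * (w * c⁻¹)) * (l * u * l⁻¹)⁻¹ := by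
          rw [C.acen _ (inv_mem hA) u hu]; group
      _ = ((l * u * l⁻¹) * w) * (l * u * l⁻¹)⁻¹ := by
          rw [C.acen w hwA c⁻¹ (inv_mem (ale hA))]; group
      _ = w := by rw [← C.acen w hwA _ hlu]; group
  intro y hy u hu
  exact (hK hu).2 y hy

theorem sqD : ∀ u ∈ R0, u * u ∈ ⁅R0, R0⁆ := by
  have hDc : ∀ x ∈ ⁅R0, R0⁆, ∀ u ∈ R0, x * u = u * x := fun x hx => C.acen x (C.cD x hx)
  have key : ∀ x ∈ R0, ∀ y ∈ R0, ∃ d ∈ ⁅R0, R0⁆, x * y * (x * y) = d * (x * x) * (y * y) := by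
    intro x hx y hy
    have h := commutator_mem_commutator (inv_mem hx) hy
    refine ⟨_, h, ?_⟩
    have h2 := C.acen _ (C.cD _ h) (x*x) (mul_mem hx hx)
    rw [commutatorElement_def] at *
    rw [h2]; group
  let K : Subgroup X :=
    { carrier := {u | u ∈ R0 ∧ u * u ∈ ⁅R0, R0⁆}
      one_mem' := ⟨one_mem _, by simp⟩
      mul_mem' := by
        rintro u v ⟨hu, hu'⟩ ⟨hv, hv'⟩
        refine ⟨mul_mem hu hv, ?_⟩
        obtain ⟨d, hd, h⟩ := key u hu v hv
        change u * v * (u * v) ∈ _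
        rw [h]
        exact mul_mem (mul_mem hd hu') hv'
      inv_mem' := by
        rintro u ⟨hu, hu'⟩
        refine ⟨inv_mem hu, ?_⟩
        have := inv_mem hu'
        rwa [mul_inv_rev] at this }
  have hK : R0 ≤ K := by
    apply C.gen
    intro l hl u hu
    have hlu := C.hn l (C.hLG hl) u hu
    refine ⟨mul_mem hlu (inv_mem hu), ?_⟩
    obtain ⟨d, hd, h⟩ := key _ hlu _ (inv_mem hu)
    rw [h]
    have e := (mem_Ac.1 (C.sqa u hu)).2 l hl
    have : d * (l * u * l⁻¹ * (l * u * l⁻¹)) * (u⁻¹ * u⁻¹) = d := by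
      calc _ = d * (l * (u * u) * l⁻¹) * (u⁻¹ * u⁻¹) := by group
        _ = d := by rw [e]; group
    rw [this]
    exact hd
  exact fun u hu => (hK hu).2

theorem cDR : ∀ x ∈ ⁅R0, R0⁆, ∀ y ∈ R, x * y = y * x := by
  have : ⁅R0, R0⁆ ≤ centralizer (R : Set X) := by
    rw [commutator_le]
    intro u hu v hv
    rw [mem_centralizer_iff]
    intro y hy
    have h1 := C.ra y hy u hu
    have h2 := C.ra y hy v hv
    obtain ⟨c, hc⟩ : ∃ c, c = y * u * y⁻¹ * u⁻¹ := ⟨_, rfl⟩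
    obtain ⟨c', hc'⟩ : ∃ c, c = y * v * y⁻¹ * v⁻¹ := ⟨_, rfl⟩
    rw [← hc] at h1
    rw [← hc'] at h2
    have e1 : y * u * y⁻¹ = c * u := by rw [hc]; group
    have e2 : y * v * y⁻¹ = c' * v := by rw [hc']; group
    have e3 : y * (u * v * u⁻¹ * v⁻¹) * y⁻¹ = u * v * u⁻¹ * v⁻¹ := by
      calc y * (u * v * u⁻¹ * v⁻¹) * y⁻¹ = (y * u * y⁻¹) * (y * v * y⁻¹) * (y * u * y⁻¹)⁻¹ * (y * v * y⁻¹)⁻¹ := by group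
        _ = c * u * (c' * v) * (u⁻¹ * c⁻¹) * (v⁻¹ * c'⁻¹) := by rw [e1, e2]; group
        _ = c * u * (c' * v) * (c⁻¹ * u⁻¹) * (c'⁻¹ * v⁻¹) := by
            rw [C.acen _ (inv_mem h1) _ (inv_mem hu), C.acen _ (inv_mem h2) _ (inv_mem hv)]
        _ = c * ((u * c') * (v * c⁻¹)) * (u⁻¹ * c'⁻¹) * v⁻¹ := by group
        _ = c * ((c' * u) * (c⁻¹ * v)) * (c'⁻¹ * u⁻¹) * v⁻¹ := by
            rw [C.acen _ h2 _ hu, C.acen _ (inv_mem h1) _ hv, C.acen _ (inv_mem h2) _ (inv_mem hu)]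
        _ = c * c' * (u * c⁻¹) * (v * c'⁻¹) * u⁻¹ * v⁻¹ := by group
        _ = c * c' * (c⁻¹ * u) * (c'⁻¹ * v) * u⁻¹ * v⁻¹ := by
            rw [C.acen _ (inv_mem h1) _ hu, C.acen _ (inv_mem h2) _ hv]
        _ = c * (c' * c⁻¹) * (u * c'⁻¹) * v * u⁻¹ * v⁻¹ := by group
        _ = c * (c⁻¹ * c') * (c'⁻¹ * u) * v * u⁻¹ * v⁻¹ := by
            rw [C.acen _ h2 _ (inv_mem (ale h1)), C.acen _ (inv_mem h2) _ hu]
        _ = _ := by group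
    rw [commutatorElement_def]
    calc _ = (y * (u * v * u⁻¹ * v⁻¹) * y⁻¹) * y := by group
      _ = _ := by rw [e3]
  intro x hx y hy
  exact (mem_centralizer_iff.1 (this hx) y hy).symm

theorem D2 : ∀ x ∈ ⁅R0, R0⁆, x * x = 1 := by
  have hDc : ∀ x ∈ ⁅R0, R0⁆, ∀ u ∈ R0, x * u = u * x := fun x hx => C.acen x (C.cD x hx)
  have hDR : ⁅R0, R0⁆ ≤ R0 := fun x hx => ale (C.cD x hx)
  let K : Subgroup X :=
    { carrier := {x | x ∈ ⁅R0, R0⁆ ∧ x * x = 1}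
      one_mem' := ⟨one_mem _, by simp⟩
      mul_mem' := by
        rintro u v ⟨hu, hu'⟩ ⟨hv, hv'⟩
        refine ⟨mul_mem hu hv, ?_⟩
        change u * v * (u * v) = 1
        calc u * v * (u * v) = u * (v * u) * v := by group
          _ = (u * u) * (v * v) := by rw [← hDc u hu v (hDR hv)]; group
          _ = 1 := by rw [hu', hv', one_mul]
      inv_mem' := by
        rintro u ⟨hu, hu'⟩
        refine ⟨inv_mem hu, ?_⟩
        rw [← mul_inv_rev, hu', inv_one] }
  have hK : ⁅R0, R0⁆ ≤ K := by
    rw [commutator_le]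
    intro u hu v hv
    have hc := commutator_mem_commutator hu hv
    refine ⟨hc, ?_⟩
    have h1 := C.acen _ (C.sqa u hu) v hv
    have h2 := hDc _ hc u hu
    have e : (u * u) * v * (u * u)⁻¹ * v⁻¹ = 1 := by rw [h1]; group
    rw [commutatorElement_def] at *
    obtain ⟨w, hw⟩ : ∃ w, w = u * v * u⁻¹ * v⁻¹ := ⟨_, rfl⟩
    have e2 : (u * u) * v * (u * u)⁻¹ * v⁻¹ = u * w * u⁻¹ * w := by
      rw [hw]; group
    rw [← hw] at h2 ⊢
    rw [e2, ← h2] at e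
    calc w * w = w * u * u⁻¹ * w := by group
      _ = 1 := e
  exact fun x hx => (hK hx).2

end Cfg
end Reg

namespace Reg
open Subgroup Module

theorem mkbil {X : Type} [Group X] {U : Subgroup X} {V : Type} [AddCommGroup V] [Module (ZMod 2) V]
    {p : X → V} (p1 : ∀ x ∈ U, ∀ y ∈ U, p (x * y) = p x + p y) (p3 : ∀ q, ∃ x ∈ U, p x = q)
    (g : X → X → ZMod 2) (g1 : ∀ x ∈ U, ∀ y ∈ U, ∀ w ∈ U, g (x * y) w = g x w + g y w)
    (g2 : ∀ x ∈ U, ∀ y ∈ U, ∀ w ∈ U, g w (x * y) = g w x + g w y)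
    (g3 : ∀ x ∈ U, p x = 0 → ∀ w ∈ U, g x w = 0) (g4 : ∀ x ∈ U, p x = 0 → ∀ w ∈ U, g w x = 0) :
    ∃ b : V →ₗ[ZMod 2] V →ₗ[ZMod 2] ZMod 2, ∀ x ∈ U, ∀ y ∈ U, b (p x) (p y) = g x y := by
  choose s s1 s2 using p3
  have key : ∀ x ∈ U, ∀ y ∈ U, p x = p y → ∃ a ∈ U, p a = 0 ∧ x = y * a := by
    intro x hx y hy h
    refine ⟨y⁻¹ * x, mul_mem (inv_mem hy) hx, ?_, by group⟩
    have := p1 y hy (y⁻¹ * x) (mul_mem (inv_mem hy) hx)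
    rw [mul_inv_cancel_left, h] at this
    simpa using this
  have k1 : ∀ x ∈ U, ∀ y ∈ U, p x = p y → ∀ w ∈ U, g x w = g y w := by
    intro x hx y hy h w hw
    obtain ⟨a, ha, ha', rfl⟩ := key x hx y hy h
    rw [g1 y hy a ha w hw, g3 a ha ha' w hw, add_zero]
  have k2 : ∀ x ∈ U, ∀ y ∈ U, p x = p y → ∀ w ∈ U, g w x = g w y := by
    intro x hx y hy h w hw
    obtain ⟨a, ha, ha', rfl⟩ := key x hx y hy h
    rw [g2 y hy a ha w hw, g4 a ha ha' w hw, add_zero]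
  have sadd : ∀ v w, p (s (v + w)) = p (s v * s w) := by
    intro v w
    rw [p1 _ (s1 v) _ (s1 w), s2, s2, s2]
  let b1 : V → V →ₗ[ZMod 2] ZMod 2 := fun v => AddMonoidHom.toZModLinearMap 2
    (AddMonoidHom.mk' (fun w => g (s v) (s w)) (by
      intro w w'
      rw [k2 _ (s1 _) _ (mul_mem (s1 w) (s1 w')) (sadd w w') _ (s1 v), g2 _ (s1 _) _ (s1 _) _ (s1 _)]))
  refine ⟨AddMonoidHom.toZModLinearMap 2 (AddMonoidHom.mk' b1 (by
    intro v v'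
    ext w
    change g (s (v + v')) (s w) = g (s v) (s w) + g (s v') (s w)
    rw [k1 _ (s1 _) _ (mul_mem (s1 v) (s1 v')) (sadd v v') _ (s1 w), g1 _ (s1 _) _ (s1 _) _ (s1 _)])), ?_⟩
  intro x hx y hy
  change g (s (p x)) (s (p y)) = _
  rw [k1 _ (s1 _) _ hx (s2 _) _ (s1 _), k2 _ (s1 _) _ hy (s2 _) _ hx]

namespace Cfg
variable {S : Type} [Group S] [IsSimpleGroup S] {X : Type} [Group X] [Finite X] {e m : ℕ}
  {R G1 L R0 : Subgroup X} (C : Cfg S e m R G1 L R0)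

theorem pack : ∃ (V : Type) (_ : AddCommGroup V) (_ : Module (ZMod 2) V) (_ : Finite V) (p : X → V)
      (ρ : G1 →* (End (ZMod 2) V)ˣ) (ρL : L →* (End (ZMod 2) V)ˣ),
      (∀ x ∈ R0, ∀ y ∈ R0, p (x * y) = p x + p y) ∧ (∀ x ∈ R0, p x = 0 ↔ x ∈ Ac R0 L) ∧
      (∀ q, ∃ x ∈ R0, p x = q) ∧
      (∀ γ : G1, ∀ x ∈ R0, (ρ γ : End (ZMod 2) V) (p x) = p (γ * x * (γ : X)⁻¹)) ∧
      Nat.card R0 = Nat.card V * Nat.card (Ac R0 L) ∧ (∀ l : L, ρL l = ρ ⟨l, C.hLG l.2⟩) ∧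
      (∀ W : Submodule (ZMod 2) V, (∀ l, ∀ w ∈ W, (ρL l : End (ZMod 2) V) w ∈ W) → W = ⊥ ∨ W = ⊤) ∧
      (∃ l, ρL l ≠ 1) ∧ (∀ φ : End (ZMod 2) V, (∀ l, φ * ρL l = ρL l * φ) → φ = 0 ∨ φ = 1) := by
  obtain ⟨V, i1, i2, i3, p, ρ, p1, p2, p3, p4, p5⟩ := vpack G1 R0 (Ac R0 L) ale C.hn C.an
    (fun u hu => C.an u (C.hRG (C.hR0 hu))) C.sqa
  refine ⟨V, i1, i2, i3, p, ρ, ρ.comp (inclusion C.hLG), p1, p2, p3, p4, p5, fun l => rfl, ?_⟩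
  have hsimp : ∀ W : Submodule (ZMod 2) V, (∀ l, ∀ w ∈ W,
      (ρ.comp (inclusion C.hLG) l : End (ZMod 2) V) w ∈ W) → W = ⊥ ∨ W = ⊤ := by
    intro W hW
    let B : Subgroup X :=
      { carrier := {x | x ∈ R0 ∧ p x ∈ W}
        one_mem' := ⟨one_mem _, by rw [(p2 1 (one_mem _)).2 (one_mem _)]; exact W.zero_mem⟩
        mul_mem' := by
          rintro x y ⟨hx, hx'⟩ ⟨hy, hy'⟩
          refine ⟨mul_mem hx hy, ?_⟩
          rw [p1 x hx y hy]; exact W.add_mem hx' hy'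
        inv_mem' := by
          rintro x ⟨hx, hx'⟩
          refine ⟨inv_mem hx, ?_⟩
          have := p1 x hx x⁻¹ (inv_mem hx)
          rw [mul_inv_cancel, (p2 1 (one_mem _)).2 (one_mem _)] at this
          rw [eq_neg_of_add_eq_zero_right this.symm]
          exact W.neg_mem hx' }
    have hB := C.simp0 (B := B) (fun a ha => ⟨ale ha, by rw [(p2 a (ale ha)).2 ha]; exact W.zero_mem⟩)
      (fun x hx => hx.1) (by
        rintro l hl x ⟨hx, hx'⟩
        refine ⟨C.hn l (C.hLG hl) x hx, ?_⟩
        have := hW ⟨l, hl⟩ _ hx'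
        change (ρ ⟨l, C.hLG hl⟩ : End (ZMod 2) V) (p x) ∈ W at this
        rwa [p4 _ x hx] at this)
    rcases hB with hB | hB
    · left
      rw [eq_bot_iff]
      intro w hw
      obtain ⟨x, hx, rfl⟩ := p3 w
      have : x ∈ B := ⟨hx, hw⟩
      rw [hB] at this
      exact (p2 x hx).2 this
    · right
      rw [eq_top_iff]
      intro w _
      obtain ⟨x, hx, rfl⟩ := p3 w
      rw [← hB] at hx
      exact hx.2
  have hnt : ∃ l, ρ.comp (inclusion C.hLG) l ≠ 1 := by
    by_contra hcon
    push Not at hcon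
    apply not_le_Ac C.h3
    apply C.gen
    intro l hl u hu
    have h1 := hcon ⟨l, hl⟩
    have h2 := p4 ⟨l, C.hLG hl⟩ u hu
    change ρ ⟨l, C.hLG hl⟩ = 1 at h1
    rw [h1] at h2
    change p u = p (l * u * l⁻¹) at h2
    have hlu := C.hn l (C.hLG hl) u hu
    have hlu' : l * u * l⁻¹ * u⁻¹ ∈ R0 := mul_mem hlu (inv_mem hu)
    refine (p2 _ hlu').1 ?_
    have := p1 _ hlu' u hu
    rw [inv_mul_cancel_right, ← h2] at this
    simpa using this
  refine ⟨hsimp, hnt, ?_⟩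
  have hfr : finrank (ZMod 2) V ≤ 2 * e + 1 := by
    obtain ⟨d, a, h1, h2, h3, h4⟩ := C.dim
    have : Module.Finite (ZMod 2) V := Module.Finite.of_finite
    have h5 := Module.natCard_eq_pow_finrank (K := ZMod 2) (V := V)
    rw [Nat.card_zmod] at h5
    rw [h1] at p5
    have h6 := Nat.eq_of_mul_eq_mul_right Nat.card_pos p5
    rw [h5] at h6
    have := Nat.pow_right_injective le_rfl h6
    have := C.hme
    omega
  exact fun φ hφ => endo01 C.hL C.hE hfr _ hnt hsimp φ hφ

theorem mkform {V : Type} [AddCommGroup V] [Module (ZMod 2) V] {p : X → V} {ρ : G1 →* (End (ZMod 2) V)ˣ}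
    (p1 : ∀ x ∈ R0, ∀ y ∈ R0, p (x * y) = p x + p y) (p2 : ∀ x ∈ R0, p x = 0 ↔ x ∈ Ac R0 L)
    (p3 : ∀ q, ∃ x ∈ R0, p x = q)
    (p4 : ∀ γ : G1, ∀ x ∈ R0, (ρ γ : End (ZMod 2) V) (p x) = p (γ * x * (γ : X)⁻¹))
    (f : X → ZMod 2) (hf : ∀ x ∈ ⁅R0, R0⁆, ∀ y ∈ ⁅R0, R0⁆, f (x * y) = f x + f y) :
    ∃ b : V →ₗ[ZMod 2] V →ₗ[ZMod 2] ZMod 2, (∀ x ∈ R0, ∀ y ∈ R0, b (p x) (p y) = f (x * y * x⁻¹ * y⁻¹)) ∧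
      ∀ l : X, ∀ hl : l ∈ L, ∀ v w, b ((ρ ⟨l, C.hLG hl⟩ : End (ZMod 2) V) v)
        ((ρ ⟨l, C.hLG hl⟩ : End (ZMod 2) V) w) = b v w := by
  have hDc : ∀ x ∈ ⁅R0, R0⁆, ∀ u ∈ R0, x * u = u * x := fun x hx => C.acen x (C.cD x hx)
  have hc : ∀ x ∈ R0, ∀ y ∈ R0, x * y * x⁻¹ * y⁻¹ ∈ ⁅R0, R0⁆ := fun x hx y hy => commutator_mem_commutator hx hy
  have f1 : f 1 = 0 := by
    have := hf 1 (one_mem _) 1 (one_mem _)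
    simpa using this
  obtain ⟨b, hb⟩ := mkbil p1 p3 (fun x y => f (x * y * x⁻¹ * y⁻¹)) (by
      intro x hx y hy w hw
      change f _ = f _ + f _
      rw [← hf _ (hc x hx w hw) _ (hc y hy w hw)]
      congr 1
      have := hDc _ (hc y hy w hw) (x * w * x⁻¹ * w⁻¹) (mul_mem (mul_mem (mul_mem hx hw) (inv_mem hx)) (inv_mem hw))
      rw [← this]
      have := hDc _ (hc y hy w hw) x hx
      calc x * y * w * (x * y)⁻¹ * w⁻¹ = x * (y * w * y⁻¹ * w⁻¹) * w * x⁻¹ * w⁻¹ := by group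
        _ = _ := by rw [← this]; group)
    (by
      intro x hx y hy w hw
      change f _ = f _ + f _
      rw [← hf _ (hc w hw x hx) _ (hc w hw y hy)]
      congr 1
      have := hDc _ (hc w hw y hy) x hx
      calc w * (x * y) * w⁻¹ * (x * y)⁻¹ = w * x * w⁻¹ * x⁻¹ * (x * (w * y * w⁻¹ * y⁻¹)) * x⁻¹ := by group
        _ = _ := by rw [← this]; group)
    (by
      intro x hx h w hw
      have := C.acen x ((p2 x hx).1 h) w hw
      change f _ = 0
      rw [this]
      simpa using f1)
    (by
      intro x hx h w hw
      have := C.acen x ((p2 x hx).1 h) w hw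
      change f _ = 0
      rw [← this]
      simpa using f1)
  refine ⟨b, hb, ?_⟩
  intro l hl v w
  obtain ⟨x, hx, rfl⟩ := p3 v
  obtain ⟨y, hy, rfl⟩ := p3 w
  rw [p4 _ x hx, p4 _ y hy, hb _ (C.hn l (C.hLG hl) x hx) _ (C.hn l (C.hLG hl) y hy), hb x hx y hy]
  congr 1
  have := (mem_Ac.1 (C.cD _ (hc x hx y hy))).2 l hl
  calc _ = l * (x * y * x⁻¹ * y⁻¹) * l⁻¹ := by group
    _ = _ := by rw [this]; group

include C in
theorem getz : ∃ z ∈ ⁅R0, R0⁆, ∀ x ∈ ⁅R0, R0⁆, x = 1 ∨ x = z := by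
  have hDc : ∀ x ∈ ⁅R0, R0⁆, ∀ u ∈ R0, x * u = u * x := fun x hx => C.acen x (C.cD x hx)
  have hDR : ⁅R0, R0⁆ ≤ R0 := fun x hx => ale (C.cD x hx)
  obtain ⟨V, i1, i2, i3, p, ρ, ρL, p1, p2, p3, p4, p5, p6, p7, p8, p9⟩ := C.pack
  obtain ⟨E, j1, j2, j3, q, τ, q1, q2, q3, q4, q5⟩ := vpack ⊥ ⁅R0, R0⁆ ⊥ bot_le
    (by intro g hg u hu; rw [mem_bot] at hg; simpa [hg] using hu) (by intro g hg u hu; rw [mem_bot] at hu; simp [hu])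
    (by intro g hg u hu; rw [mem_bot] at hu; simp [hu]) (fun u hu => mem_bot.2 (C.D2 u hu))
  have hF : ∀ f : E →ₗ[ZMod 2] ZMod 2, ∃ b : V →ₗ[ZMod 2] V →ₗ[ZMod 2] ZMod 2,
      (∀ x ∈ R0, ∀ y ∈ R0, b (p x) (p y) = f (q (x * y * x⁻¹ * y⁻¹))) ∧
      ∀ l : L, ∀ v w, b ((ρL l : End (ZMod 2) V) v) ((ρL l : End (ZMod 2) V) w) = b v w := by
    intro f
    obtain ⟨b, b1, b2⟩ := C.mkform p1 p2 p3 p4 (fun x => f (q x)) (by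
      intro x hx y hy
      change f _ = f _ + f _
      rw [q1 x hx y hy, map_add])
    refine ⟨b, b1, fun l v w => ?_⟩
    rw [p6]; exact b2 l l.2 v w
  have hext : ∀ f f' : E →ₗ[ZMod 2] ZMod 2,
      (∀ x ∈ R0, ∀ y ∈ R0, f (q (x * y * x⁻¹ * y⁻¹)) = f' (q (x * y * x⁻¹ * y⁻¹))) → f = f' := by
    intro f f' h
    let K : Subgroup X :=
      { carrier := {x | x ∈ ⁅R0, R0⁆ ∧ f (q x) = f' (q x)}
        one_mem' := ⟨one_mem _, by rw [(q2 1 (one_mem _)).2 (one_mem _)]; simp⟩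
        mul_mem' := by
          rintro x y ⟨hx, hx'⟩ ⟨hy, hy'⟩
          refine ⟨mul_mem hx hy, ?_⟩
          rw [q1 x hx y hy, map_add, map_add, hx', hy']
        inv_mem' := by
          rintro x ⟨hx, hx'⟩
          refine ⟨inv_mem hx, ?_⟩
          rw [inv_eq_of_mul_eq_one_left (C.D2 x hx)]; exact hx' }
    have hK : ⁅R0, R0⁆ ≤ K := by
      rw [commutator_le]
      exact fun x hx y hy => ⟨commutator_mem_commutator hx hy, h x hx y hy⟩
    ext v
    obtain ⟨x, hx, rfl⟩ := q3 v
    exact (hK hx).2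
  have huniq : ∀ f f' : E →ₗ[ZMod 2] ZMod 2, f ≠ 0 → f' ≠ 0 → f' = f := by
    intro f f' hf hf'
    obtain ⟨b, b1, b2⟩ := hF f
    obtain ⟨c, c1, c2⟩ := hF f'
    have hb0 : b ≠ 0 := by
      rintro rfl
      exact hf (hext f 0 (fun x hx y hy => by rw [← b1 x hx y hy]; simp))
    rcases forms01 ρL p7 p9 b c b2 c2 hb0 with h | h
    · exact absurd (hext f' 0 (fun x hx y hy => by rw [← c1 x hx y hy, h]; simp)) hf'
    · exact hext f' f (fun x hx y hy => by rw [← c1 x hx y hy, ← b1 x hx y hy, h])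
  have hdual : ∀ v : E, v ≠ 0 → ∃ f : E →ₗ[ZMod 2] ZMod 2, f v ≠ 0 := by
    intro v hv
    by_contra hcon
    push Not at hcon
    exact hv ((Module.forall_dual_apply_eq_zero_iff (ZMod 2) v).1 hcon)
  by_cases hz : ∃ z ∈ ⁅R0, R0⁆, z ≠ 1
  · obtain ⟨z, hz, hz1⟩ := hz
    refine ⟨z, hz, fun x hx => ?_⟩
    by_contra hcon
    push Not at hcon
    have e1 : q z ≠ 0 := fun h => hz1 (mem_bot.1 ((q2 z hz).1 h))
    have e2 : q x ≠ 0 := fun h => hcon.1 (mem_bot.1 ((q2 x hx).1 h))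
    have e3 : q x + q z ≠ 0 := fun h => by
      rw [← q1 x hx z hz] at h
      have := mem_bot.1 ((q2 _ (mul_mem hx hz)).1 h)
      apply hcon.2
      rw [eq_inv_of_mul_eq_one_left this]
      exact inv_eq_of_mul_eq_one_left (C.D2 z hz)
    obtain ⟨f1, h1⟩ := hdual _ e1
    obtain ⟨f2, h2⟩ := hdual _ e2
    obtain ⟨f3, h3⟩ := hdual _ e3
    have n1 : f1 ≠ 0 := by rintro rfl; simp at h1
    have n2 : f2 ≠ 0 := by rintro rfl; simp at h2
    have n3 : f3 ≠ 0 := by rintro rfl; simp at h3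
    rw [huniq f1 f2 n1 n2] at h2
    rw [huniq f1 f3 n1 n3, map_add] at h3
    generalize f1 (q x) = a at *
    generalize f1 (q z) = b at *
    revert a b; decide
  · push Not at hz
    exact ⟨1, one_mem _, fun x hx => Or.inl (hz x hx)⟩

include C in
theorem no4 (h7 : 7 ∣ Nat.card S) {z : X} (hz : z ∈ ⁅R0, R0⁆) (hD : ∀ x ∈ ⁅R0, R0⁆, x = 1 ∨ x = z) (hz1 : z ≠ 1) :
    Nat.card R0 ≠ 16 * Nat.card (Ac R0 L) := by
  classical
  intro hcard
  obtain ⟨V, i1, i2, i3, p, ρ, ρL, p1, p2, p3, p4, p5, p6, p7, ⟨l0, p8⟩, p9⟩ := C.pack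
  have hV : Nat.card V = 16 := by
    rw [hcard] at p5
    exact (Nat.eq_of_mul_eq_mul_right Nat.card_pos p5).symm
  obtain ⟨b, b1, b2⟩ := C.mkform p1 p2 p3 p4 (fun x => if x = 1 then 0 else 1) (by
    intro x hx y hy
    have := C.D2 z hz
    rcases hD x hx with rfl | rfl <;> rcases hD y hy with rfl | rfl <;> simp [hz1, this]
    decide)
  have hb0 : b ≠ 0 := by
    rintro rfl
    have : ⁅R0, R0⁆ ≤ ⊥ := by
      rw [commutator_le]
      intro x hx y hy
      have := b1 x hx y hy
      rw [mem_bot, commutatorElement_def]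
      by_contra hc
      rw [if_neg hc] at this
      simp at this
    exact hz1 (mem_bot.1 (this hz))
  have h7' : Fact (Nat.Prime 7) := ⟨by norm_num⟩
  have hI : Inv S ρL.range := by
    by_contra hcon
    have := C.hL _ ρL.rangeRestrict hcon l0
    exact p8 (congrArg Subtype.val this)
  have : Finite ρL.range := Finite.of_surjective _ ρL.rangeRestrict_surjective
  obtain ⟨⟨_, l, rfl⟩, hg⟩ := exists_prime_orderOf_dvd_card' (G := ρL.range) 7 (h7.trans hI.card_dvd)
  refine no_form4 ρL p7 b (fun l v w => by rw [p6]; exact b2 l l.2 v w) hb0 ?_ hV l ?_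
  · intro v
    obtain ⟨x, hx, rfl⟩ := p3 v
    rw [b1 x hx x hx]; simp
  · rw [← hg, ← Subgroup.orderOf_coe]

end Cfg
end Reg

namespace Reg
open Subgroup Module

theorem aut_cen {S : Type} [Group S] {X : Type} [Group X] {Γ B : Subgroup X} (hΓ : PP S Γ) (hn : Nm Γ B)
    (hA : ¬ Inv S (MulAut B)) [Finite X] : ∀ l ∈ Γ, ∀ b ∈ B, l * b = b * l := by
  have hle : Γ ≤ normalizer (B : Set X) := fun g hg => mem_normalizer_of_conj (hn g hg)
  let f : Γ →* MulAut B := (normalizerMonoidHom B).comp (inclusion hle)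
  intro l hl b hb
  have h1 := hΓ _ f hA ⟨l, hl⟩
  have h2 := congrArg (fun α : MulAut B => ((α ⟨b, hb⟩ : B) : X)) h1
  change l * b * l⁻¹ = b at h2
  exact mul_inv_eq_iff_eq_mul.1 h2

theorem hh_aux {S : Type} [Group S] {X : Type} [Group X] [Finite X] {B : Subgroup X}
    (hA : ¬ Inv S (MulAut B)) : ∀ l ∈ O S (normalizer (B : Set X)), ∀ b ∈ B, l * b = b * l :=
  aut_cen (pp_O _) (fun g hg b hb => conj_mem_of_mem_normalizer (O_le _ hg) hb) hA

namespace Cfg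
variable {S : Type} [Group S] [IsSimpleGroup S] {X : Type} [Group X] [Finite X] {e m : ℕ}
  {R G1 L R0 : Subgroup X} (C : Cfg S e m R G1 L R0)

include C in
theorem Ntriv {T : Subgroup X} (hT : Nm G1 T) (hTI : ¬ Inv S T)
    (hodd : ∀ r : ℕ, r.Prime → r ≠ 2 → ∀ k, r ^ k ∣ Nat.card T → ∀ (B : Type) [Group B] [Finite B],
      Nat.card B = r ^ k → ¬ Inv S (MulAut B))
    (hmax : ∀ x ∈ T, x ∈ G1 → ∀ k, x ^ 2 ^ k = 1 → x ∈ R) :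
    ∀ x ∈ T, x ∈ G1 → ∀ u ∈ R0, x * u * x⁻¹ * u⁻¹ ∈ Ac R0 L := by
  obtain ⟨V, i1, i2, i3, p, ρ, ρL, p1, p2, p3, p4, p5, p6, p7, ⟨l0, p8⟩, p9⟩ := C.pack
  have hone : ∀ x (hx : x ∈ G1), ρ ⟨x, hx⟩ = 1 ↔ ∀ u ∈ R0, x * u * x⁻¹ * u⁻¹ ∈ Ac R0 L := by
    intro x hx
    have key : ∀ u ∈ R0, p (x * u * x⁻¹) = p u ↔ x * u * x⁻¹ * u⁻¹ ∈ Ac R0 L := by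
      intro u hu
      have hxu : x * u * x⁻¹ * u⁻¹ ∈ R0 := mul_mem (C.hn x hx u hu) (inv_mem hu)
      rw [← p2 _ hxu]
      have := p1 _ hxu u hu
      rw [inv_mul_cancel_right] at this
      rw [this]; simp
    constructor
    · intro h u hu
      rw [← key u hu, ← p4 ⟨x, hx⟩ u hu, h]; rfl
    · intro h
      ext v
      obtain ⟨u, hu, rfl⟩ := p3 v
      rw [p4 ⟨x, hx⟩ u hu, (key u hu).2 (h u hu)]; rfl
  let N : Subgroup G1 := T.subgroupOf G1
  let Y := (End (ZMod 2) V)ˣ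
  let U : Subgroup Y := N.map ρ
  have : Finite (End (ZMod 2) V) := DFunLike.finite _
  have : Finite Y := inferInstance
  have hUdvd : Nat.card U ∣ Nat.card T := by
    refine (card_map_dvd (H := N) (f := ρ)).trans ?_
    have : Nat.card N = Nat.card (T ⊓ G1 : Subgroup X) := by
      rw [← subgroupOf_map_subtype]
      exact (card_map_of_injective G1.subtype_injective).symm
    rw [this]
    exact card_dvd_of_le inf_le_left
  have hU2 : ¬ 2 ∣ Nat.card U := by
    intro h2
    have : Fact (Nat.Prime 2) := ⟨Nat.prime_two⟩
    obtain ⟨⟨_, x, hx, rfl⟩, hg⟩ := exists_prime_orderOf_dvd_card' (G := U) 2 h2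
    rw [← Subgroup.orderOf_coe] at hg
    change orderOf (ρ x) = 2 at hg
    obtain ⟨k, t, ht, hk⟩ := Nat.exists_eq_pow_mul_and_not_dvd (orderOf_pos x).ne' 2 (by norm_num)
    have h1 : ((x : X) ^ t) ^ 2 ^ k = 1 := by
      rw [← pow_mul, mul_comm, ← hk]
      have := pow_orderOf_eq_one x
      exact congrArg Subtype.val this
    have h2 := hmax _ (T.pow_mem hx t) (pow_mem x.2 t) k h1
    have h3 : ρ (x ^ t) = 1 := (hone _ (pow_mem x.2 t)).2 (C.ra _ h2)
    rw [map_pow] at h3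
    rw [← hg] at ht
    exact ht (orderOf_dvd_of_pow_eq_one h3)
  have hHH : HH S U := by
    intro r hr B hB hBr
    have : Fact r.Prime := ⟨hr⟩
    obtain ⟨k, hk⟩ := IsPGroup.iff_card.1 hBr
    have hd : r ^ k ∣ Nat.card U := hk ▸ card_dvd_of_le hB
    by_cases h2 : r = 2
    · subst h2
      have hk0 : k = 0 := by
        by_contra h0
        exact hU2 ((dvd_pow_self 2 h0).trans hd)
      subst hk0
      rw [pow_zero, card_eq_one] at hk
      intro l _ b hb
      rw [hk, mem_bot] at hb
      rw [hb]; simp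
    · exact hh_aux (hodd r hr h2 k (hd.trans hUdvd) B hk)
  have hUI : ¬ Inv S U := by
    intro h
    have h1 : Inv S N := h.of_surjective (ρ.subgroupMap N) (ρ.subgroupMap_surjective N)
    apply hTI
    refine h1.of_injective (G := N) (((G1.subtype).comp N.subtype).codRestrict T (fun x => x.2)) ?_
    intro x y hxy
    have := congrArg Subtype.val hxy
    exact Subtype.ext (Subtype.ext this)
  have hC := lemmaC C.hS (X := Y) _ U rfl hUI hHH
  have hLU : ∀ l : L, ρL l ∈ O S (normalizer (U : Set Y)) := by
    intro l
    refine le_O (L := ρL.range) ?_ (C.hL.range ρL) ⟨l, rfl⟩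
    rintro _ ⟨l, rfl⟩
    refine mem_normalizer_of_conj ?_
    rintro _ ⟨y, hy, rfl⟩
    rw [p6]
    refine ⟨⟨l, C.hLG l.2⟩ * y * ⟨l, C.hLG l.2⟩⁻¹, hT l (C.hLG l.2) _ hy, by simp⟩
  intro x hxT hx
  rw [← hone x hx]
  have h1 : ∀ l, (ρ ⟨x, hx⟩ : End (ZMod 2) V) * ρL l = ρL l * ρ ⟨x, hx⟩ := by
    intro l
    have := hC _ (hLU l) (ρ ⟨x, hx⟩) ⟨⟨x, hx⟩, hxT, rfl⟩
    exact (congrArg Units.val this).symm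
  rcases p9 _ h1 with h | h
  · exfalso
    apply p8
    have h2 : ∀ v : V, v = 0 := by
      intro v
      have : (((ρ ⟨x, hx⟩)⁻¹ : Y) : End (ZMod 2) V) * (ρ ⟨x, hx⟩ : End (ZMod 2) V) = 1 := Units.inv_mul _
      rw [h, mul_zero] at this
      exact (congrArg (fun t : End (ZMod 2) V => t v) this).symm
    ext v
    rw [h2 v]; simp
  · exact Units.ext h

include C in
theorem cen (hz1 : ∃ x ∈ ⁅R0, R0⁆, x ≠ 1) : ∀ x ∈ R0, (∀ y ∈ R0, x * y = y * x) → x ∈ Ac R0 L := by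
  let Z : Subgroup X := R0 ⊓ centralizer (R0 : Set X)
  have hZ : ∀ x, x ∈ Z ↔ x ∈ R0 ∧ ∀ y ∈ R0, y * x = x * y := by
    intro x; rw [mem_inf, mem_centralizer_iff]; rfl
  have hn : Nm G1 Z := by
    intro g hg x hx
    rw [hZ] at hx ⊢
    refine ⟨C.hn g hg x hx.1, fun y hy => ?_⟩
    have h1 := C.hn g⁻¹ (inv_mem hg) y hy
    rw [inv_inv] at h1
    have := hx.2 _ h1
    calc y * (g * x * g⁻¹) = g * (g⁻¹ * y * g * x) * g⁻¹ := by group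
      _ = _ := by rw [this]; group
  have hne : Z ≠ R0 := by
    intro h
    obtain ⟨x, hx, hx1⟩ := hz1
    have : ⁅R0, R0⁆ ≤ ⊥ := by
      rw [commutator_le]
      intro u hu v hv
      rw [← h, hZ] at hu
      rw [mem_bot, commutatorElement_def, ← hu.2 v hv]; group
    exact hx1 (mem_bot.1 (this hx))
  intro x hx h
  exact le_Ac_of C.hm (inf_le_left) hn hne ((hZ x).2 ⟨hx, fun y hy => (h y hy).symm⟩)

include C in
theorem getpsi : ∃ v ∈ R0, ∃ ψ : R →* M2, (∀ x (h : x ∈ R), x ∈ Ac R0 L → ψ ⟨x, h⟩ = 1) ∧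
    ∀ h : v ∈ R, ψ ⟨v, h⟩ ≠ 1 := by
  have hAR : Ac R0 L ≤ R := ale.trans C.hR0
  let F : Subgroup X := closure ({x | ∃ y ∈ R, x = y * y} ∪ (Ac R0 L : Set X))
  have hFR : F ≤ R := by
    rw [closure_le]
    rintro x (⟨y, hy, rfl⟩ | hx)
    · exact mul_mem hy hy
    · exact hAR hx
  have hsq : ∀ y ∈ R, y * y ∈ F := fun y hy => Subgroup.subset_closure (Or.inl ⟨y, hy, rfl⟩)
  have hAF : Ac R0 L ≤ F := fun x hx => Subgroup.subset_closure (Or.inr hx)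
  have hFn : ∀ u ∈ R, ∀ b ∈ F, u * b * u⁻¹ ∈ F := by
    intro u hu b hb
    have h1 := mul_mem (mul_mem (hsq _ (mul_mem hu (hFR hb)))
      (inv_mem hb)) (inv_mem (hsq u hu))
    have e : u * b * u⁻¹ = (u * b * (u * b)) * b⁻¹ * (u * u)⁻¹ := by group
    rw [e]; exact h1
  let K : Subgroup X :=
    { carrier := {x | x ∈ R ∧ ∀ l ∈ L, l * x * l⁻¹ * x⁻¹ ∈ Ac R0 L}
      one_mem' := ⟨one_mem _, fun l hl => by simp⟩
      mul_mem' := by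
        rintro x y ⟨hx, hx'⟩ ⟨hy, hy'⟩
        refine ⟨mul_mem hx hy, fun l hl => ?_⟩
        have h2 := C.an x (C.hRG hx) _ (hy' l hl)
        have h1 := mul_mem (hx' l hl) h2
        have e : l * (x * y) * l⁻¹ * (x * y)⁻¹ = l * x * l⁻¹ * x⁻¹ * (x * (l * y * l⁻¹ * y⁻¹) * x⁻¹) := by group
        rw [e]; exact h1
      inv_mem' := by
        rintro x ⟨hx, hx'⟩
        refine ⟨inv_mem hx, fun l hl => ?_⟩
        have h1 := C.an x⁻¹ (C.hRG (inv_mem hx)) _ (inv_mem (hx' l hl))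
        have e : l * x⁻¹ * l⁻¹ * x⁻¹⁻¹ = x⁻¹ * (l * x * l⁻¹ * x⁻¹)⁻¹ * x⁻¹⁻¹ := by group
        rw [e]; exact h1 }
  have hFK : F ≤ K := by
    rw [closure_le]
    rintro x (⟨y, hy, rfl⟩ | hx)
    · refine ⟨mul_mem hy hy, fun l hl => ?_⟩
      have h1 := C.rl l hl y hy
      obtain ⟨r, hr⟩ : ∃ r, r = l * y * l⁻¹ * y⁻¹ := ⟨_, rfl⟩
      rw [← hr] at h1
      have e : l * (y * y) * l⁻¹ * (y * y)⁻¹ = r * (y * r * y⁻¹ * r⁻¹) * r⁻¹ * (r * r) := by rw [hr]; group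
      rw [e]
      exact mul_mem (C.an r (C.hRG (C.hR0 h1)) _ (C.ra y hy r h1)) (C.sqa r h1)
    · exact ⟨hAR hx, fun l hl => by
        rw [(mem_Ac.1 hx).2 l hl]; simp⟩
  have hnot : ¬ R0 ≤ F := by
    intro h
    exact not_le_Ac C.h3 (C.gen _ (fun l hl u hu => (hFK (h hu)).2 l hl))
  rw [SetLike.not_le_iff_exists] at hnot
  obtain ⟨v, hv, hvF⟩ := hnot
  obtain ⟨E, j1, j2, j3, q, τ, q1, q2, q3, q4, q5⟩ := vpack R R F hFR
    (fun g hg u hu => mul_mem (mul_mem hg hu) (inv_mem hg)) hFn hFn hsq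
  have hqv : q v ≠ 0 := fun h => hvF ((q2 v (C.hR0 hv)).1 h)
  obtain ⟨f, hf⟩ : ∃ f : E →ₗ[ZMod 2] ZMod 2, f (q v) ≠ 0 := by
    by_contra hcon
    push Not at hcon
    exact hqv ((Module.forall_dual_apply_eq_zero_iff (ZMod 2) _).1 hcon)
  refine ⟨v, hv, MonoidHom.mk' (fun x => Multiplicative.ofAdd (f (q x))) (by
    intro x y
    change Multiplicative.ofAdd (f (q (x * y))) = _
    rw [q1 _ x.2 _ y.2, map_add, ofAdd_add]), ?_, ?_⟩
  · intro x h hx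
    change Multiplicative.ofAdd (f (q x)) = 1
    rw [(q2 x h).2 (hAF hx), map_zero, ofAdd_zero]
  · intro h hc
    exact hf (Multiplicative.ofAdd.injective hc)

end Cfg
end Reg

namespace Reg
open Subgroup Module

theorem syl_max {T : Type} [Group T] [Finite T] (P : Sylow 2 T) {x : T}
    (hx : x ∈ normalizer ((P : Subgroup T) : Set T)) {k : ℕ} (hk : x ^ 2 ^ k = 1) : x ∈ P := by
  have h1 : IsPGroup 2 (zpowers x) := by
    have : Fact (Nat.Prime 2) := ⟨Nat.prime_two⟩
    obtain ⟨j, -, hj⟩ := (Nat.dvd_prime_pow Nat.prime_two).1 (orderOf_dvd_of_pow_eq_one hk)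
    exact IsPGroup.of_card (by rw [Nat.card_zpowers, hj])
  have h2 : zpowers x ≤ normalizer ((P : Subgroup T) : Set T) := by rwa [zpowers_le]
  have h3 := h1.to_sup_of_normal_right' P.isPGroup' h2
  have h4 := P.is_maximal' h3 le_sup_right
  have : x ∈ (zpowers x ⊔ (P : Subgroup T)) := mem_sup_left (mem_zpowers x)
  rw [h4] at this
  exact this

theorem NW {S : Type} [Group S] [IsSimpleGroup S] (hS : ¬ ∀ a b : S, a * b = b * a)
    {X : Type} [Group X] [Finite X] {e m : ℕ}
    (hE : ∀ (F V : Type) [Field F] [AddCommGroup V] [Module F V] [Finite V], (2 : F) = 0 →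
      finrank F V ≤ e → ¬ Inv S (End F V)ˣ)
    {T : Subgroup X} (hT : T.Normal) (hTI : ¬ Inv S T)
    (hodd : ∀ r : ℕ, r.Prime → r ≠ 2 → ∀ k, r ^ k ∣ Nat.card T → ∀ (B : Type) [Group B] [Finite B],
      Nat.card B = r ^ k → ¬ Inv S (MulAut B))
    (hC2 : ∀ Φ : T →* M2, ∀ t, Φ t = 1) (P : Sylow 2 T) (hP : Nat.card P = 2 ^ m)
    (hme : m ≤ 2 * e ∨ e = 3 ∧ 7 ∣ Nat.card S ∧ m ≤ 2 * e + 1) (R : Subgroup X)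
    (hR : R = (P : Subgroup T).map T.subtype) :
    ∀ l ∈ O S (normalizer (R : Set X)), ∀ r ∈ R, l * r = r * l := by
  by_contra hcon
  push Not at hcon
  have hR2 : IsPGroup 2 R := by rw [hR]; exact P.isPGroup'.map _
  have hRT : R ≤ T := by rw [hR]; exact map_subtype_le _
  have hmem : ∀ x : T, (x : X) ∈ R ↔ x ∈ P := by
    intro x
    rw [hR]
    constructor
    · rintro ⟨y, hy, hyx⟩
      have : y = x := Subtype.ext hyx
      exact this ▸ hy
    · exact fun h => ⟨x, h, rfl⟩
  have hcR : Nat.card R = 2 ^ m := by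
    rw [hR, card_map_of_injective T.subtype_injective]; exact hP
  have hGR : Nm (normalizer (R : Set X)) R := fun g hg b hb => conj_mem_of_mem_normalizer hg hb
  have hGL : Nm (normalizer (R : Set X)) (O S (normalizer (R : Set X))) := fun g hg b hb =>
    conj_mem_O (fun z hz => mul_mem (mul_mem hg hz) (inv_mem hg)) hb
  obtain ⟨R0, hR0, hn, h3, hm, gen⟩ := getR0 hS hR2 hGR (O_le _) (pp_O _) hGL hcon
  obtain ⟨L, C⟩ : ∃ L, Cfg S e m R (normalizer (R : Set X)) L R0 :=
    ⟨O S (normalizer (R : Set X)), hS, hE, hR2, hcR, by omega, le_normalizer, hGR, O_le _, pp_O _, hGL, hR0, hn, h3, hm, gen⟩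
  have hnP : ∀ x : T, x ∈ normalizer ((P : Subgroup T) : Set T) ↔ (x : X) ∈ normalizer (R : Set X) := by
    intro x
    constructor
    · intro hx
      refine mem_normalizer_of_conj fun y hy => ?_
      have h1 := conj_mem_of_mem_normalizer hx ((hmem ⟨y, hRT hy⟩).1 hy)
      exact (hmem _).2 h1
    · intro hx
      refine mem_normalizer_of_conj fun y hy => ?_
      have h1 := conj_mem_of_mem_normalizer hx ((hmem y).2 hy)
      exact (hmem (x * y * x⁻¹)).1 h1
  have hNt := C.Ntriv (T := T) (fun g _ t ht => hT.conj_mem t ht g) hTI hodd (by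
    intro x hxT hx k hk
    exact (hmem ⟨x, hxT⟩).2 (syl_max P ((hnP ⟨x, hxT⟩).2 hx) (k := k) (Subtype.ext hk)))
  obtain ⟨z, hz, hD⟩ := C.getz
  obtain ⟨v, hv, ψ, hψA, hψv⟩ := C.getpsi
  have hzA := C.cD z hz
  have hzR : z ∈ R := hR0 (Cfg.ale hzA)
  have hcardR0 : Nat.card (R0.subgroupOf T) = Nat.card R0 := by
    rw [← card_map_of_injective T.subtype_injective, subgroupOf_map_subtype, inf_eq_left.2 (hR0.trans hRT)]
  have hcardA : Nat.card ((Ac R0 L).subgroupOf T) = Nat.card (Ac R0 L) := by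
    rw [← card_map_of_injective T.subtype_injective, subgroupOf_map_subtype,
      inf_eq_left.2 (Cfg.ale.trans (hR0.trans hRT))]
  have hc : z ≠ 1 → ∀ x ∈ R0, (∀ y ∈ R0, x * y = y * x) → x ∈ Ac R0 L := fun h => C.cen ⟨z, hz, h⟩
  let j : (P : Subgroup T) →* R := (T.subtype.comp (P : Subgroup T).subtype).codRestrict R (fun x => (hmem _).2 x.2)
  obtain ⟨Φ, t, ht⟩ := stage2 P (R0.subgroupOf T) ((Ac R0 L).subgroupOf T) ⟨z, hRT hzR⟩ ⟨v, hRT (hR0 hv)⟩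
    (fun x hx => (hmem x).1 (hR0 hx)) (fun x hx => mem_subgroupOf.2 (Cfg.ale (mem_subgroupOf.1 hx))) hzA
    (Subtype.ext (C.D2 z hz)) (fun y hy => Subtype.ext (C.cDR z hz y ((hmem y).2 hy)).symm)
    (by
      rintro ⟨x, hxT⟩ hx ⟨y, hyT⟩ hy
      have hy' := (hmem _).2 hy
      change x ∈ R0 at hx
      change y ∈ R at hy'
      have h1 := C.rD y⁻¹ (inv_mem hy') x hx
      rw [inv_inv] at h1
      rcases hD _ h1 with h | h
      · left; exact Subtype.ext (mul_inv_eq_one.1 h)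
      · right
        apply Subtype.ext
        change y⁻¹ * x * y = x * z
        rw [← C.cDR z hz x (hR0 hx)]
        exact mul_inv_eq_iff_eq_mul.1 h)
    (by
      rintro ⟨x, hxT⟩ hx
      rcases hD _ (C.sqD x hx) with h | h
      · left; exact Subtype.ext h
      · right; exact Subtype.ext h)
    (by
      rintro h1 ⟨x, hxT⟩ hx h
      refine hc (fun h => h1 (Subtype.ext h)) x hx fun y hy => ?_
      exact congrArg Subtype.val (h ⟨y, hRT (hR0 hy)⟩ hy))
    (by
      intro h1
      have hz1 : z ≠ 1 := fun h => h1 (Subtype.ext h)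
      rw [hcardR0, hcardA, hP]
      obtain ⟨d, a, c1, c2, c3, c4⟩ := C.dim
      have ha : 1 ≤ a := by
        by_contra h0
        have : a = 0 := by omega
        rw [this, pow_zero, card_eq_one] at c3
        rw [c3] at hzA
        exact hz1 (mem_bot.1 hzA)
      have hlt : 2 + a + m < (d + a) * 2 := by
        rcases hme with h | ⟨h, h7, h'⟩
        · omega
        · have : d ≠ 4 := by
            rintro rfl
            exact C.no4 h7 hz hD hz1 c1
          omega
      rw [c1, c3, ← pow_add, ← pow_mul, show (4 : ℕ) = 2 ^ 2 by norm_num, ← pow_add, ← pow_add]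
      exact Nat.pow_lt_pow_right (by norm_num) hlt)
    hv (ψ.comp j) (fun x h => hψA x _ h) (hψv _)
    (by
      rintro ⟨x, hxT⟩ hx
      have hx' := (hnP ⟨x, hxT⟩).1 hx
      have h1 := hNt x⁻¹ (inv_mem hxT) (inv_mem hx') v hv
      rw [inv_inv] at h1
      change v⁻¹ * (x⁻¹ * v * x) ∈ Ac R0 L
      have e := C.acen _ h1 v hv
      have : v⁻¹ * (x⁻¹ * v * x) = x⁻¹ * v * x * v⁻¹ := by
        calc v⁻¹ * (x⁻¹ * v * x) = v⁻¹ * (x⁻¹ * v * x * v⁻¹ * v) := by group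
          _ = _ := by rw [e]; group
      rw [this]; exact h1)
  exact ht (hC2 Φ t)

theorem HH2 {S : Type} [Group S] [IsSimpleGroup S] 
    {X : Type} [Group X] [Finite X] {T : Subgroup X} (hT : T.Normal) (hTI : ¬ Inv S T)
    (h : ∀ P : Sylow 2 T, ∀ l ∈ O S (normalizer (((P : Subgroup T).map T.subtype : Subgroup X) : Set X)),
      ∀ r ∈ (P : Subgroup T).map T.subtype, l * r = r * l)
    {B : Subgroup X} (hB : B ≤ T) (hB2 : IsPGroup 2 B) :
    ∀ l ∈ O S (normalizer (B : Set X)), ∀ b ∈ B, l * b = b * l := by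
  have : Fact (Nat.Prime 2) := ⟨Nat.prime_two⟩
  obtain ⟨P, hP⟩ := (hB2.comap_of_injective T.subtype T.subtype_injective).exists_le_sylow
  have hBR : B ≤ (P : Subgroup T).map T.subtype := fun b hb => ⟨⟨b, hB hb⟩, hP hb, rfl⟩
  obtain ⟨R, hR⟩ : ∃ R, R = (P : Subgroup T).map T.subtype := ⟨_, rfl⟩
  have hP' := h P
  rw [← hR] at hP' hBR
  have hfr : ∀ x : X, ∃ γ ∈ normalizer (R : Set X), ∃ t ∈ T, x = γ * t := by
    intro x
    obtain ⟨u, hu, h⟩ := frattini_elt P (γ := x⁻¹) (mem_normalizer_of_conj (fun y hy => hT.conj_mem y hy x⁻¹))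
    rw [← hR] at h
    exact ⟨_, inv_mem h, u, hu, by group⟩
  have hnT : normalizer (R : Set X) ≤ normalizer (T : Set X) :=
    fun g _ => mem_normalizer_of_conj (fun y hy => hT.conj_mem y hy g)
  have h1 := (pp_O (S := S) (normalizer (B : Set X))).le_O_mul hnT (fun l _ => hfr l)
  let f := normalizerMonoidHom B
  let NB := normalizer (B : Set X)
  let D : Subgroup (MulAut B) := (T.subgroupOf NB).map f
  have hDI : ¬ Inv S D := by
    intro hI
    have h1 : Inv S (T.subgroupOf NB) := hI.of_surjective (f.subgroupMap _) (f.subgroupMap_surjective _)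
    apply hTI
    refine h1.of_injective ((NB.subtype.comp (T.subgroupOf NB).subtype).codRestrict T (fun x => x.2)) ?_
    intro x y hxy
    have := congrArg Subtype.val hxy
    exact Subtype.ext (Subtype.ext this)
  let g : O S NB →* D := (f.comp (inclusion (O_le (S := S) NB))).codRestrict D (by
    intro l
    obtain ⟨γ, hγ, t, ht, hl⟩ := h1 l l.2
    have hγB : ∀ b ∈ B, γ * b = b * γ := fun b hb => hP' γ hγ b (hBR hb)
    have hγN : γ ∈ NB := mem_normalizer_of_conj (fun b hb => by rw [hγB b hb]; simpa using hb)
    have htN : t ∈ NB := by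
      have : t = γ⁻¹ * l := by rw [hl]; group
      rw [this]
      exact mul_mem (inv_mem hγN) (O_le _ l.2)
    refine ⟨⟨t, htN⟩, ht, ?_⟩
    ext b
    change t * b * t⁻¹ = l * b * (l : X)⁻¹
    have hb := conj_mem_of_mem_normalizer htN b.2
    rw [hl]
    calc t * b * t⁻¹ = (t * b * t⁻¹) * γ * γ⁻¹ := by group
      _ = _ := by rw [← hγB _ hb]; group)
  intro l hl b hb
  have h2 := pp_O (S := S) NB _ g hDI ⟨l, hl⟩
  have h3 := congrArg (fun α : D => ((α.1 ⟨b, hb⟩ : B) : X)) h2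
  change l * b * l⁻¹ = b at h3
  exact mul_inv_eq_iff_eq_mul.1 h3

theorem MP {n : ℕ} (hn : 5 ≤ n) (hn6 : n ≠ 6) (T : Type) [Group T] [Finite T] (hd : Nat.card T ∣ n.factorial)
    (hI : ¬ Inv (Al n) T) (hC2 : ∀ Φ : T →* M2, ∀ t, Φ t = 1) (φ : Al n →* MulAut T) : ∀ s, φ s = 1 := by
  have : IsSimpleGroup (Al n) := al_simple hn
  have hS := al_noncomm hn
  let X := T ⋊[φ] (Al n)
  have : Finite X := Finite.of_equiv _ SemidirectProduct.equivProd.symm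
  let T0 : Subgroup X := (SemidirectProduct.inl : T →* X).range
  have hT0 : T0.Normal := by
    have : T0 = (SemidirectProduct.rightHom : X →* Al n).ker := SemidirectProduct.range_inl_eq_ker_rightHom
    rw [this]; infer_instance
  let ι : T ≃* T0 := MonoidHom.ofInjective SemidirectProduct.inl_injective
  have hcT : Nat.card T0 = Nat.card T := (Nat.card_congr ι.toEquiv).symm
  have hTI : ¬ Inv (Al n) T0 := fun h => hI (h.of_injective ι.symm.toMonoidHom ι.symm.injective)
  have hC2' : ∀ Φ : T0 →* M2, ∀ t, Φ t = 1 := by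
    intro Φ t
    have := hC2 (Φ.comp ι.toMonoidHom) (ι.symm t)
    simpa using this
  have hval : ∀ r k : ℕ, r.Prime → r ^ k ∣ Nat.card T0 → k ≤ padicValNat r n.factorial := by
    intro r k hr h
    have : Fact r.Prime := ⟨hr⟩
    rw [hcT] at h
    exact (padicValNat_dvd_iff_le (Nat.factorial_pos n).ne').1 (h.trans hd)
  have hHH : HH (Al n) T0 := by
    by_cases h5 : n = 5
    · subst h5
      intro r hr B hB hBr
      have : Fact r.Prime := ⟨hr⟩
      obtain ⟨k, hk⟩ := IsPGroup.iff_card.1 hBr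
      exact hh_aux (bprime hS (data5 r hr) k (hval r k hr (hk ▸ card_dvd_of_le hB)) B hk)
    · obtain ⟨e, he, hE, h2, hodd⟩ := data7 (n := n) (by omega)
      have hodd' : ∀ r : ℕ, r.Prime → r ≠ 2 → ∀ k, r ^ k ∣ Nat.card T0 → ∀ (B : Type) [Group B] [Finite B],
          Nat.card B = r ^ k → ¬ Inv (Al n) (MulAut B) := by
        intro r hr hr2 k hk B _ _ hB
        have : Fact r.Prime := ⟨hr⟩
        exact bprime hS (hodd r hr hr2) k (hval r k hr hk) B hB
      intro r hr B hB hBr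
      by_cases hr2 : r = 2
      · subst hr2
        refine HH2 hT0 hTI ?_ hB hBr
        intro P
        have : Fact (Nat.Prime 2) := ⟨Nat.prime_two⟩
        obtain ⟨m, hm⟩ := IsPGroup.iff_card.1 P.isPGroup'
        have hm' := hval 2 m Nat.prime_two (hm ▸ card_subgroup_dvd_card (P : Subgroup T0))
        refine NW hS hE hT0 hTI hodd' hC2' P hm ?_ _ rfl
        rcases h2 with h | ⟨h8, h, h'⟩
        · left; omega
        · right
          refine ⟨h, ?_, by omega⟩
          have := al_card hn
          subst h8
          have h1 : 7 ∣ 2 * Nat.card (Al 8) := by rw [this]; decide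
          exact (Nat.Coprime.dvd_mul_left (by norm_num)).1 h1
      · have : Fact r.Prime := ⟨hr⟩
        obtain ⟨k, hk⟩ := IsPGroup.iff_card.1 hBr
        exact hh_aux (hodd' r hr hr2 k (hk ▸ card_dvd_of_le hB) B hk)
  have hC := lemmaC hS _ T0 rfl hTI hHH
  intro s
  have hs : (SemidirectProduct.inr s : X) ∈ O (Al n) (normalizer (T0 : Set X)) := by
    refine le_O (L := (SemidirectProduct.inr : Al n →* X).range) ?_ (pp_simple.range _) ⟨s, rfl⟩
    exact fun g _ => mem_normalizer_of_conj (fun y hy => hT0.conj_mem y hy g)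
  ext t
  have := hC _ hs (SemidirectProduct.inl t) ⟨t, rfl⟩
  have h2 := congrArg SemidirectProduct.left this
  rw [SemidirectProduct.mul_left, SemidirectProduct.mul_left] at h2
  simpa using h2
end Reg

namespace Reg
open Subgroup Module Equiv Equiv.Perm
open scoped Pointwise

theorem c3_card {n : ℕ} {a b k : Fin n} (h1 : a ≠ b) (h2 : k ≠ a) (h3 : k ≠ b) :
    IsThreeCycle (swap a b * swap b k) := by
  rw [swap_comm a b]; exact isThreeCycle_swap_mul_swap_same h1.symm h3.symm h2.symm

theorem gen01 {n : ℕ} (hn : 5 ≤ n) {a b : Fin n} (hab : a ≠ b) (K : Subgroup (Perm (Fin n)))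
    (h : ∀ k, k ≠ a → k ≠ b → swap a b * swap b k ∈ K) : alternatingGroup (Fin n) ≤ K := by
  have ex : ∀ y, ∃ k : Fin n, k ≠ a ∧ k ≠ b ∧ k ≠ y := by
    intro y
    have h1 : ({a, b, y} : Finset (Fin n)).card < Fintype.card (Fin n) := by
      rw [Fintype.card_fin]; exact lt_of_le_of_lt Finset.card_le_three (by omega)
    obtain ⟨k, hk⟩ := Finset.exists_mem_notMem_of_card_lt_card (s := {a, b, y}) (t := Finset.univ) h1
    simp at hk
    exact ⟨k, by tauto⟩
  let c (k : Fin n) : Perm (Fin n) := swap a b * swap b k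
  have ca : ∀ k, k ≠ a → k ≠ b → c k a = b := fun k h1 h2 => by
    simp [c, swap_apply_of_ne_of_ne hab h1.symm]
  have cb : ∀ k, k ≠ a → k ≠ b → c k b = k := fun k h1 h2 => by
    simp [c, swap_apply_of_ne_of_ne h1 h2]
  have co : ∀ k y, y ≠ a → y ≠ b → y ≠ k → c k y = y := fun k y h1 h2 h3 => by
    simp [c, swap_apply_of_ne_of_ne h2 h3, swap_apply_of_ne_of_ne h1 h2]
  have ht : ∀ x, ∃ g : K, g • a = x := by
    intro x
    obtain ⟨k, k1, k2, -⟩ := ex a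
    by_cases h1 : x = a
    · exact ⟨1, by rw [h1, one_smul]⟩
    by_cases h2 : x = b
    · exact ⟨⟨_, h k k1 k2⟩, by rw [h2]; exact ca k k1 k2⟩
    · refine ⟨⟨_, mul_mem (h x h1 h2) (h x h1 h2)⟩, ?_⟩
      change c x (c x a) = x
      rw [ca x h1 h2, cb x h1 h2]
  have : MulAction.IsPretransitive K (Fin n) := by
    refine ⟨fun x y => ?_⟩
    obtain ⟨g, rfl⟩ := ht x
    obtain ⟨k, rfl⟩ := ht y
    exact ⟨k * g⁻¹, by rw [mul_smul, inv_smul_smul]⟩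
  have hp : MulAction.IsPreprimitive K (Fin n) := by
    refine MulAction.IsPreprimitive.of_isTrivialBlock_base a ?_
    intro B haB hB
    have key : ∀ k, k ≠ a → k ≠ b → ∀ y ∈ B, c k y ∈ B → ∀ w ∈ B, c k w ∈ B := by
      intro k h1 h2 y hy hy' w hw
      have e : (⟨c k, h k h1 h2⟩ : K) • B = B := by
        rcases hB.smul_eq_or_disjoint (⟨c k, h k h1 h2⟩ : K) with e | e
        · exact e
        · exact absurd hy' (Set.disjoint_left.1 e ⟨y, hy, rfl⟩)
      rw [← e]; exact ⟨w, hw, rfl⟩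
    rcases B.subsingleton_or_nontrivial with h | h
    · exact Or.inl h
    obtain ⟨y, hy, hya⟩ := h.exists_ne a
    right
    have hb : b ∈ B := by
      by_cases hyb : y = b
      · exact hyb ▸ hy
      obtain ⟨k, k1, k2, k3⟩ := ex y
      have := key k k1 k2 y hy (by rwa [co k y hya hyb k3.symm]) a haB
      rwa [ca k k1 k2] at this
    ext k
    refine ⟨fun _ => trivial, fun _ => ?_⟩
    by_cases h1 : k = a
    · exact h1 ▸ haB
    by_cases h2 : k = b
    · exact h2 ▸ hb
    have := key k h1 h2 a haB (by rwa [ca k h1 h2]) b hb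
    rwa [cb k h1 h2] at this
  obtain ⟨k, k1, k2, -⟩ := ex a
  exact alternatingGroup_le_of_isPreprimitive_of_isThreeCycle_mem hp (c3_card hab k1 k2) (h k k1 k2)

theorem pair3 {n : ℕ} {c d : Perm (Fin n)} (hc : IsThreeCycle c) (hd : IsThreeCycle d)
    (h2 : c * d * (c * d) = 1) (h1 : c * d ≠ 1) : ∃ a, c a = d a ∧ c a ≠ a := by
  have c3 : c * c * c = 1 := by
    have := pow_orderOf_eq_one c
    rwa [hc.orderOf, pow_succ, pow_two] at this
  have hy : ∃ y, c y = y ∧ d y ≠ y := by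
    by_contra hcon
    push Not at hcon
    have hs : d.support = c.support := by
      refine Finset.eq_of_subset_of_card_le (fun y hy => ?_) (by rw [hc.card_support, hd.card_support])
      rw [mem_support] at hy ⊢
      exact fun h => hy (hcon y h)
    have hne : d.support.Nonempty := by rw [← Finset.card_pos, hd.card_support]; norm_num
    obtain ⟨y, hy⟩ := hne
    have n1 := hd.nodup_iff_mem_support.2 hy
    have e1 := hd.eq_swap_mul_swap_iff_mem_support.2 hy
    have e0 := hc.support_eq_iff_mem_support.2 (hs ▸ hy)
    have m1 : d y ∈ c.support := by rw [← hs, apply_mem_support]; exact hy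
    have m2 : d (d y) ∈ c.support := by rw [← hs, apply_mem_support, apply_mem_support]; exact hy
    rw [e0] at m1 m2
    have f0 := hc.eq_swap_mul_swap_iff_mem_support.2 (hs ▸ hy)
    have f1 := hc.isThreeCycle_sq.eq_swap_mul_swap_iff_mem_support (a := y) |>.2
      (by rw [mem_support]; have := hc.nodup_iff_mem_support.2 (hs ▸ hy); simp at this; simp [Ne.symm]; tauto)
    have g : c (c (c (c y))) = c y := by
      have := congrArg (fun p : Perm (Fin n) => p (c y)) c3
      simpa using this
    simp only [mul_apply] at f1
    rw [g] at f1
    simp at n1 m1 m2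
    have n2 : d (d y) ≠ d y := fun h => (mem_support.1 hy) (d.injective h)
    by_cases q : d y = c y
    · have q2 : d (d y) = c (c y) := by grind
      rw [q2, q, ← f0] at e1
      rw [e1] at h2
      have : c = 1 := by rw [← h2, ← mul_assoc, c3, one_mul]
      exact hc.ne_one this
    · have q1 : d y = c (c y) := by grind
      have q2 : d (d y) = c y := by grind
      rw [q2, q1, ← f1] at e1
      rw [e1, ← mul_assoc] at h1
      exact h1 c3
  obtain ⟨y, hy, hdy⟩ := hy
  have d3 : d (d (d y)) = y := by
    have := pow_orderOf_eq_one d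
    rw [hd.orderOf, pow_succ, pow_two] at this
    simpa using congrArg (fun p : Perm (Fin n) => p y) this
  have h : c (d (c (d y))) = y := by simpa using congrArg (fun p : Perm (Fin n) => p y) h2
  have h3 : d (c (d y)) = y := c.injective (by rw [h, hy])
  have h4 : c (d y) = d (d y) := d.injective (by rw [h3, d3])
  refine ⟨d y, h4, ?_⟩
  rw [h4]
  exact fun h => hdy (d.injective h)

theorem three3 {n : ℕ} {c d e : Perm (Fin n)} (hc : IsThreeCycle c) (hd : IsThreeCycle d)
    (he : IsThreeCycle e) (hcd : c ≠ d) {a : Fin n} (h : c a = d a) (ha : c a ≠ a)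
    (h1 : ∃ x, c x = e x ∧ c x ≠ x) (h2 : ∃ x, d x = e x ∧ d x ≠ x) : e a = c a := by
  obtain ⟨x, x1, x2⟩ := h1
  obtain ⟨y, y1, y2⟩ := h2
  have s1 := hc.support_eq_iff_mem_support.2 (mem_support.2 ha)
  have s2 := hd.support_eq_iff_mem_support.2 (mem_support.2 (h ▸ ha))
  have mx : x ∈ c.support := mem_support.2 x2
  have my : y ∈ d.support := mem_support.2 y2
  have c1 := hc.nodup_iff_mem_support.2 (mem_support.2 ha)
  have d1 := hd.nodup_iff_mem_support.2 (mem_support.2 (h ▸ ha))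
  have f1 := hc.eq_swap_mul_swap_iff_mem_support.2 (mem_support.2 ha)
  have f2 := hd.eq_swap_mul_swap_iff_mem_support.2 (mem_support.2 (h ▸ ha))
  have c3 : ∀ {c : Perm (Fin n)}, IsThreeCycle c → ∀ a, c (c (c a)) = a := by
    intro c hc a
    have := pow_orderOf_eq_one c
    rw [hc.orderOf, pow_succ, pow_two] at this
    simpa using congrArg (fun p : Perm (Fin n) => p a) this
  have g1 := c3 hc a
  have g2 := c3 hd a
  have hne : c (c a) ≠ d (d a) := by
    intro q
    rw [f1, f2, ← q, ← h] at hcd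
    exact hcd rfl
  have four : ¬ (a ∈ e.support ∧ c a ∈ e.support ∧ c (c a) ∈ e.support ∧ d (d a) ∈ e.support) := by
    rintro ⟨q1, q2, q3, q4⟩
    have : ({a, c a, c (c a), d (d a)} : Finset (Fin n)) ⊆ e.support := by
      intro z hz; simp at hz; rcases hz with rfl | rfl | rfl | rfl <;> assumption
    have := Finset.card_le_card this
    simp at c1 d1
    have c2 : c (c a) ≠ c a := fun h => ha (c.injective h)
    have d2 : d (d a) ≠ d a := fun h' => ha (h.trans (d.injective h'))
    rw [he.card_support, Finset.card_insert_of_notMem (by grind), Finset.card_insert_of_notMem (by grind),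
      Finset.card_pair hne] at this
    omega
  simp only [mem_support] at four
  simp [s1] at mx
  simp [s2] at my
  simp at c1 d1
  have inj := e.injective
  have ic := c.injective
  grind
end Reg

namespace Reg
open Subgroup Module Equiv Equiv.Perm

abbrev AG (n : ℕ) : Subgroup (Perm (Fin n)) := alternatingGroup (Fin n)

theorem ineq3 : ∀ k, 2 * 3 ^ (k + 2) * (k + 3).factorial < (3 * k + 6).factorial
  | 0 => by decide
  | k + 1 => by
    have ih := ineq3 k
    have e : 3 * (k + 1) + 6 = 3 * k + 6 + 1 + 1 + 1 := by ring
    rw [e, Nat.factorial_succ (3 * k + 6 + 1 + 1), Nat.factorial_succ (3 * k + 6 + 1), Nat.factorial_succ (3 * k + 6),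
      show k + 1 + 3 = k + 3 + 1 by omega, Nat.factorial_succ (k + 3)]
    calc 2 * 3 ^ (k + 1 + 2) * ((k + 3 + 1) * (k + 3).factorial)
        = (3 * (k + 4)) * (2 * 3 ^ (k + 2) * (k + 3).factorial) := by ring
      _ < (3 * (k + 4)) * (3 * k + 6).factorial := by
        exact Nat.mul_lt_mul_of_pos_left ih (by omega)
      _ ≤ ((3 * k + 6 + 1 + 1 + 1) * (3 * k + 6 + 1 + 1) * (3 * k + 6 + 1)) * (3 * k + 6).factorial := by
        refine Nat.mul_le_mul_right _ ?_
        have : 3 * (k + 4) ≤ (3 * k + 6 + 1 + 1 + 1) * (3 * k + 6 + 1 + 1) := by nlinarith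
        exact le_trans this (Nat.le_mul_of_pos_right _ (by omega))
      _ = _ := by ring

theorem ineq3' {n k : ℕ} (hn : 5 ≤ n) (hn6 : n ≠ 6) (h : 3 * (k + 1) ≤ n)
    (h2 : (n - 3).factorial * 3 ≤ 2 * ((n - 3 * (k + 1)).factorial * 3 ^ (k + 1) * (k + 1).factorial)) : k = 0 := by
  obtain ⟨m, rfl⟩ := Nat.exists_eq_add_of_le h
  rcases k with _ | _ | k
  · rfl
  · exfalso
    rw [show 3 * (0 + 1 + 1) + m - 3 = m + 3 by omega, show 3 * (0 + 1 + 1) + m - 3 * (0 + 1 + 1) = m by omega,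
      Nat.factorial_succ, Nat.factorial_succ, Nat.factorial_succ] at h2
    have hm : 1 ≤ m := by omega
    have hp := Nat.factorial_pos m
    have : 36 * m.factorial < (m + 2 + 1) * ((m + 1 + 1) * ((m + 1) * m.factorial)) * 3 := by
      have : 24 ≤ (m + 3) * (m + 2) * (m + 1) := by nlinarith [mul_self_nonneg m]
      nlinarith
    norm_num [Nat.factorial] at h2
    omega
  · exfalso
    rw [show 3 * (k + 1 + 1 + 1) + m - 3 = (3 * k + 6) + m by omega,
      show 3 * (k + 1 + 1 + 1) + m - 3 * (k + 1 + 1 + 1) = m by omega] at h2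
    have h3 := Nat.le_of_dvd (Nat.factorial_pos _) (Nat.factorial_mul_factorial_dvd_factorial_add (3 * k + 6) m)
    have h4 := Nat.mul_lt_mul_of_pos_right (ineq3 k) (Nat.factorial_pos m)
    have e : 2 * (m.factorial * 3 ^ (k + 1 + 1 + 1) * (k + 1 + 1 + 1).factorial)
      = 3 * (2 * 3 ^ (k + 2) * (k + 3).factorial * m.factorial) := by
      rw [show k + 1 + 1 + 1 = k + 3 by omega]; ring
    omega

theorem pres3 {n : ℕ} (hn : 5 ≤ n) (hn6 : n ≠ 6) {α : Al n →* Perm (Fin n)} (hα : Function.Injective α)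
    {c : Al n} (hc : IsThreeCycle (c : Perm (Fin n))) : IsThreeCycle (α c) := by
  have ho : orderOf (α c) = 3 := by
    rw [orderOf_injective α hα, ← Subgroup.orderOf_coe, hc.orderOf]
  obtain ⟨k, hk⟩ := cycleType_prime_order (σ := α c) (by rw [ho]; norm_num)
  rw [ho] at hk
  have hle : 3 * (k + 1) ≤ n := by
    have := sum_cycleType (α c)
    rw [hk, Multiset.sum_replicate, smul_eq_mul] at this
    have h2 := Finset.card_le_univ (α c).support
    rw [Fintype.card_fin] at h2
    omega
  have c1 : Nat.card (centralizer {(c : Perm (Fin n))}) = (n - 3).factorial * 3 := by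
    rw [nat_card_centralizer, hc.cycleType]; simp
  have c2 : Nat.card (centralizer {α c}) = (n - 3 * (k + 1)).factorial * 3 ^ (k + 1) * (k + 1).factorial := by
    rw [nat_card_centralizer, hk, Multiset.sum_replicate, Multiset.prod_replicate]
    have : (Multiset.replicate (k + 1) 3).toFinset = {3} := by
      rw [Multiset.toFinset_replicate, if_neg (by omega)]
    rw [this, Finset.prod_singleton, Multiset.count_replicate_self, smul_eq_mul, Fintype.card_fin, mul_comm 3 (k + 1)]
  let C := centralizer {(c : Perm (Fin n))}
  have hr : Nat.card C ≤ 2 * Nat.card ((AG n).subgroupOf C) := by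
    have h1 : (AG n).relIndex C ∣ 2 := by
      have := relIndex_dvd_index_of_normal (AG n) C
      have h2 : (AG n).index = 2 := by
        have : Nontrivial (Fin n) := Fin.nontrivial_iff_two_le.2 (by omega)
        exact alternatingGroup.index_eq_two
      rwa [h2] at this
    have h2 := ((AG n).subgroupOf C).card_mul_index
    have h3 := Nat.le_of_dvd (by norm_num) h1
    change ((AG n).subgroupOf C).index ≤ 2 at h3
    rw [← h2, mul_comm]
    exact Nat.mul_le_mul_right _ h3
  have hr2 : Nat.card ((AG n).subgroupOf C) ≤ Nat.card (centralizer {α c}) := by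
    refine Nat.card_le_card_of_injective (fun x => ⟨α ⟨x.1.1, x.2⟩, ?_⟩) ?_
    · rw [mem_centralizer_singleton_iff, ← map_mul, ← map_mul]
      congr 1
      exact Subtype.ext (mem_centralizer_singleton_iff.1 x.1.2)
    · intro x y h
      have := hα (congrArg Subtype.val h)
      have h3 := congrArg (fun z : Al n => (z : Perm (Fin n))) this
      exact Subtype.ext (Subtype.ext h3)
  have := ineq3' hn hn6 hle (c1 ▸ c2 ▸ le_trans hr (Nat.mul_le_mul_left 2 hr2))
  subst this
  rw [IsThreeCycle, hk]; rfl

theorem autA {n : ℕ} (hn : 5 ≤ n) (hn6 : n ≠ 6) (α : Al n →* Perm (Fin n)) (h1 : ∃ x, α x ≠ 1) :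
    ∃ s : Perm (Fin n), ∀ x, α x = s * x * s⁻¹ := by
  have : IsSimpleGroup (Al n) := al_simple hn
  have hα : Function.Injective α := by
    rw [← MonoidHom.ker_eq_bot_iff]
    refine (IsSimpleGroup.eq_bot_or_eq_top_of_normal α.ker inferInstance).resolve_right fun h => ?_
    obtain ⟨x, hx⟩ := h1
    exact hx (by rw [← MonoidHom.mem_ker, h]; trivial)
  let a : Fin n := ⟨0, by omega⟩
  let b : Fin n := ⟨1, by omega⟩
  have hab : a ≠ b := by simp [a, b]
  let c (k : Fin n) : Perm (Fin n) := swap a b * swap b k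
  have hc : ∀ k, k ≠ a → k ≠ b → IsThreeCycle (c k) := fun k h1 h2 => c3_card hab h1 h2
  have hcA : ∀ k, k ≠ a → k ≠ b → c k ∈ AG n := fun k h1 h2 => (hc k h1 h2).mem_alternatingGroup
  have hcc : ∀ k l, k ≠ a → k ≠ b → l ≠ a → l ≠ b → c k * c l = swap a k * swap b l := by
    intro k l k1 k2 l1 l2
    have := swap_mul_swap_mul_swap (x := k) (y := b) (z := a) k2 k1
    rw [swap_comm b a, swap_comm k b] at this
    simp only [c]
    rw [← this]
    simp only [mul_assoc]
  have h2 : ∀ k l, k ≠ a → k ≠ b → l ≠ a → l ≠ b → k ≠ l → c k * c l * (c k * c l) = 1 := by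
    intro k l k1 k2 l1 l2 hkl
    have hd : (swap a k).Disjoint (swap b l) := disjoint_swap_swap (by simp; tauto)
    have e := hd.commute.eq
    rw [hcc k l k1 k2 l1 l2]
    nth_rewrite 2 [e]
    rw [mul_assoc, ← mul_assoc (swap b l), swap_mul_self, one_mul, swap_mul_self]
  have h3 : ∀ k l, k ≠ a → k ≠ b → l ≠ a → l ≠ b → k ≠ l → c k * c l ≠ 1 := by
    intro k l k1 k2 l1 l2 hkl h
    have := congrArg (fun p : Perm (Fin n) => p b) h
    rw [hcc k l k1 k2 l1 l2] at this
    simp [swap_apply_of_ne_of_ne l1 hkl.symm] at this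
    exact l2 this
  have ht : ∀ k, ∃ t : Perm (Fin n), ∀ (h1 : k ≠ a) (h2 : k ≠ b), t = α ⟨c k, hcA k h1 h2⟩ := by
    intro k
    by_cases h : k ≠ a ∧ k ≠ b
    · exact ⟨α ⟨c k, hcA k h.1 h.2⟩, fun _ _ => rfl⟩
    · exact ⟨1, fun h1 h2 => absurd ⟨h1, h2⟩ h⟩
  choose t ht using ht
  have t3 : ∀ k, k ≠ a → k ≠ b → IsThreeCycle (t k) := fun k h1 h2 => by
    rw [ht k h1 h2]; exact pres3 hn hn6 hα (hc k h1 h2)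
  have tinj : ∀ k l, k ≠ a → k ≠ b → l ≠ a → l ≠ b → t k = t l → k = l := by
    intro k l k1 k2 l1 l2 h
    rw [ht k k1 k2, ht l l1 l2] at h
    have := congrArg (fun p : Perm (Fin n) => p b) (congrArg Subtype.val (hα h))
    simpa [c, swap_apply_of_ne_of_ne k1 k2, swap_apply_of_ne_of_ne l1 l2] using this
  have tp : ∀ k l, k ≠ a → k ≠ b → l ≠ a → l ≠ b → k ≠ l → ∃ x, t k x = t l x ∧ t k x ≠ x := by
    intro k l k1 k2 l1 l2 hkl
    refine pair3 (t3 k k1 k2) (t3 l l1 l2) ?_ ?_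
    · rw [ht k k1 k2, ht l l1 l2, ← map_mul, ← map_mul, ← map_one α]
      congr 1
      exact Subtype.ext (h2 k l k1 k2 l1 l2 hkl)
    · rw [ht k k1 k2, ht l l1 l2, ← map_mul, ← map_one α]
      exact fun h => h3 k l k1 k2 l1 l2 hkl (congrArg Subtype.val (hα h))
  let p : Fin n := ⟨2, by omega⟩
  let q : Fin n := ⟨3, by omega⟩
  have p1 : p ≠ a := by simp [p, a]
  have p2 : p ≠ b := by simp [p, b]
  have q1 : q ≠ a := by simp [q, a]
  have q2 : q ≠ b := by simp [q, b]
  have pq : p ≠ q := by simp [p, q]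
  obtain ⟨x, x1, x2⟩ := tp p q p1 p2 q1 q2 pq
  let y := t p x
  have ty : ∀ k, k ≠ a → k ≠ b → t k x = y := by
    intro k k1 k2
    by_cases e1 : k = p
    · rw [e1]
    by_cases e2 : k = q
    · rw [e2]; exact x1.symm
    exact three3 (t3 p p1 p2) (t3 q q1 q2) (t3 k k1 k2) (fun h => pq (tinj p q p1 p2 q1 q2 h)) x1 x2
      (tp p k p1 p2 k1 k2 (Ne.symm e1)) (tp q k q1 q2 k1 k2 (Ne.symm e2))
  have tx : ∀ k, k ≠ a → k ≠ b → x ∈ (t k).support := by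
    intro k k1 k2; rw [mem_support, ty k k1 k2]; exact x2
  have tf : ∀ k, k ≠ a → k ≠ b → t k = swap x y * swap y (t k y) := by
    intro k k1 k2
    have := (t3 k k1 k2).eq_swap_mul_swap_iff_mem_support.2 (tx k k1 k2)
    rwa [ty k k1 k2] at this
  have tn : ∀ k, k ≠ a → k ≠ b → t k y ≠ x ∧ t k y ≠ y := by
    intro k k1 k2
    have := (t3 k k1 k2).nodup_iff_mem_support.2 (tx k k1 k2)
    rw [ty k k1 k2] at this
    simp at this
    refine ⟨fun h => this.1.2 h.symm, fun h => x2 ?_⟩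
    have e := ty k k1 k2
    exact ((t k).injective (h.trans e.symm))
  let s0 : Fin n → Fin n := fun k => if k = a then x else if k = b then y else t k y
  have sa : s0 a = x := by simp [s0]
  have sb : s0 b = y := by simp [s0, hab.symm]
  have sk : ∀ k, k ≠ a → k ≠ b → s0 k = t k y := fun k h1 h2 => by simp [s0, h1, h2]
  have sinj : Function.Injective s0 := by
    intro k l h
    by_cases k1 : k = a <;> by_cases k2 : k = b <;> by_cases l1 : l = a <;> by_cases l2 : l = b
    all_goals try (first | (rw [k1, l1]) | (rw [k2, l2]))
    all_goals try (exfalso; subst k1; exact hab k2)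
    all_goals try (exfalso; subst l1; exact hab l2)
    · subst k1; subst l2; rw [sa, sb] at h; exact absurd h.symm x2
    · subst k1; rw [sa, sk l l1 l2] at h; exact absurd h.symm (tn l l1 l2).1
    · subst k2; subst l1; rw [sa, sb] at h; exact absurd h x2
    · subst k2; rw [sb, sk l l1 l2] at h; exact absurd h.symm (tn l l1 l2).2
    · subst l1; rw [sa, sk k k1 k2] at h; exact absurd h (tn k k1 k2).1
    · subst l2; rw [sb, sk k k1 k2] at h; exact absurd h (tn k k1 k2).2
    · rw [sk k k1 k2, sk l l1 l2] at h
      refine tinj k l k1 k2 l1 l2 ?_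
      rw [tf k k1 k2, tf l l1 l2, h]
  let s : Perm (Fin n) := Equiv.ofBijective s0 (Finite.injective_iff_bijective.1 sinj)
  refine ⟨s, ?_⟩
  let K : Subgroup (Perm (Fin n)) :=
    (α.eqLocus ((MulAut.conj s).toMonoidHom.comp (AG n).subtype)).map (AG n).subtype
  have hK : AG n ≤ K := by
    refine gen01 hn hab K fun k k1 k2 => ⟨⟨c k, hcA k k1 k2⟩, ?_, rfl⟩
    change α ⟨c k, hcA k k1 k2⟩ = s * (swap a b * swap b k) * s⁻¹
    rw [← ht k k1 k2, tf k k1 k2]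
    have e : s * (swap a b * swap b k) * s⁻¹ = (s * swap a b * s⁻¹) * (s * swap b k * s⁻¹) := by group
    rw [e, ← swap_apply_apply, ← swap_apply_apply]
    change _ = swap (s0 a) (s0 b) * swap (s0 b) (s0 k)
    rw [sa, sb, sk k k1 k2]
  intro x
  obtain ⟨w, hw, hwx⟩ := hK x.2
  have : w = x := Subtype.ext hwx
  exact this ▸ hw
end Reg

namespace Reg
open Subgroup Module Equiv Equiv.Perm

theorem cenA {n : ℕ} (hn : 5 ≤ n) {z : Perm (Fin n)} (h : ∀ x ∈ AG n, z * x = x * z) : z = 1 := by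
  by_contra hz
  obtain ⟨i, hi⟩ : ∃ i, z i ≠ i := by
    by_contra! h; exact hz (Perm.ext h)
  obtain ⟨k, hk⟩ := Finset.exists_mem_notMem_of_card_lt_card (s := {i, z i}) (t := Finset.univ)
    (by rw [Finset.card_fin]; exact lt_of_le_of_lt Finset.card_le_two (by omega))
  obtain ⟨l, hl⟩ := Finset.exists_mem_notMem_of_card_lt_card (s := {i, z i, k}) (t := Finset.univ)
    (by rw [Finset.card_fin]; exact lt_of_le_of_lt Finset.card_le_three (by omega))
  simp at hk hl
  have h1 := h _ (c3_card (a := z i) (b := k) (k := l) (Ne.symm hk.2) hl.2.1 hl.2.2).mem_alternatingGroup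
  have h2 := congrArg (fun p : Perm (Fin n) => p i) h1
  have e1 : swap k l i = i := swap_apply_of_ne_of_ne (Ne.symm hk.1) (Ne.symm hl.1)
  have e2 : swap (z i) k i = i := swap_apply_of_ne_of_ne (Ne.symm hi) (Ne.symm hk.1)
  have e3 : swap k l (z i) = z i := swap_apply_of_ne_of_ne (Ne.symm hk.2) (Ne.symm hl.2.1)
  simp only [Perm.mul_apply, e1, e2, e3, swap_apply_left] at h2
  exact hk.2 h2.symm

theorem conj_uniq {n : ℕ} (hn : 5 ≤ n) {s t : Perm (Fin n)} (h : ∀ x ∈ AG n, s * x * s⁻¹ = t * x * t⁻¹) :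
    s = t := by
  have : t⁻¹ * s = 1 := cenA hn fun x hx => by
    have := h x hx
    rw [mul_inv_eq_iff_eq_mul] at this
    rw [mul_assoc, this]; group
  exact (inv_mul_eq_one.1 this).symm

theorem autS {n : ℕ} (hn : 5 ≤ n) (hn6 : n ≠ 6) (β : Perm (Fin n) →* Perm (Fin n)) (h : ∃ x ∈ AG n, β x ≠ 1) :
    ∃ s, ∀ y, β y = s * y * s⁻¹ := by
  obtain ⟨x, hx, hx1⟩ := h
  obtain ⟨s, hs⟩ := autA hn hn6 (β.comp (AG n).subtype) ⟨⟨x, hx⟩, hx1⟩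
  have hs' : ∀ x ∈ AG n, β x = s * x * s⁻¹ := fun x hx => hs ⟨x, hx⟩
  refine ⟨s, fun y => ?_⟩
  have : β y * s = s * y := conj_uniq hn fun x hx => by
    have h2 : y * x * y⁻¹ ∈ AG n := Subgroup.Normal.conj_mem inferInstance x hx y
    have h3 := hs' _ h2
    rw [map_mul, map_mul, hs' x hx, map_inv] at h3
    rw [mul_inv_rev, mul_inv_rev]
    simpa only [mul_assoc] using h3
  rw [← this, mul_inv_cancel_right]

structure CH (G N : Type) [Group G] [Group N] where
  f : G →* MulAut N
  g : G → N
  bij : Function.Bijective g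
  mul : ∀ s t, g (s * t) = g s * f s (g t)

namespace CH
variable {G N : Type} [Group G] [Group N] (c : CH G N)

theorem one : c.g 1 = 1 := by
  have := c.mul 1 1
  rw [mul_one, map_one, MulAut.one_apply] at this
  exact left_eq_mul.1 this

theorem inv (s : G) : c.g s⁻¹ = c.f s⁻¹ (c.g s)⁻¹ := by
  have := c.mul s⁻¹ s
  rw [inv_mul_cancel, c.one] at this
  rw [_root_.map_inv (c.f s⁻¹)]
  exact eq_inv_of_mul_eq_one_left this.symm

def Hs : Subgroup G where
  carrier := {y | ∀ Φ : N →* M2, Φ (c.g y) = 1}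
  one_mem' := fun Φ => by rw [c.one, map_one]
  mul_mem' := fun {a b} ha hb Φ => by
    rw [c.mul, map_mul, ha Φ, one_mul]; exact hb (Φ.comp (c.f a).toMonoidHom)
  inv_mem' := fun {a} ha Φ => by
    rw [c.inv, map_inv, map_inv, inv_eq_one]; exact ha (Φ.comp (c.f a⁻¹).toMonoidHom)

theorem odd_mem {x : G} {m : ℕ} (hm : Odd m) (hx : x ^ m = 1) : ∃ s, s⁻¹ * x * s ∈ c.Hs := by
  have key : ∀ k, ∃ w : N, ∀ Φ : N →* M2, Φ (c.f x w) * Φ w = Φ (c.g x) ^ k * Φ (c.g (x ^ k)) := by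
    intro k
    induction k with
    | zero => exact ⟨1, fun Φ => by simp [c.one]⟩
    | succ k ih =>
      obtain ⟨w, hw⟩ := ih
      refine ⟨w * c.g (x ^ k), fun Φ => ?_⟩
      rw [pow_succ' x, c.mul, map_mul, map_mul, map_mul, map_mul, mul_mul_mul_comm, hw]
      have : Φ (c.g (x ^ k)) * Φ (c.g (x ^ k)) = 1 := M2.sq _
      calc _ = Φ (c.g x) ^ k * (Φ (c.g (x ^ k)) * Φ (c.g (x ^ k))) * Φ (c.f x (c.g (x ^ k))) := by
            simp only [mul_assoc, mul_comm, mul_left_comm]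
        _ = Φ (c.g x) ^ k * Φ (c.f x (c.g (x ^ k))) := by rw [this, mul_one]
        _ = Φ (c.g x) ^ k * (Φ (c.g x) * Φ (c.g x)) * Φ (c.f x (c.g (x ^ k))) := by
            rw [M2.sq, mul_one]
        _ = _ := by rw [pow_succ]; simp only [mul_assoc]
  obtain ⟨w, hw⟩ := key m
  obtain ⟨s, rfl⟩ := c.bij.2 w
  refine ⟨s, fun Φ => ?_⟩
  rw [mul_assoc, c.mul, c.mul, c.inv, ← map_mul]
  have h := hw (Φ.comp (c.f s⁻¹).toMonoidHom)
  rw [hx, c.one, map_one, mul_one] at h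
  obtain ⟨j, rfl⟩ := hm
  rw [pow_succ, pow_mul, sq, M2.sq, one_pow, one_mul] at h
  simp only [MonoidHom.comp_apply, MulEquiv.coe_toMonoidHom] at h
  simp only [map_mul, map_inv] at h ⊢
  rw [← h]
  have hs := M2.sq (Φ (c.f s⁻¹ (c.f x (c.g s))))
  calc _ = (Φ (c.f s⁻¹ (c.f x (c.g s))) * Φ (c.f s⁻¹ (c.f x (c.g s)))) * ((Φ (c.f s⁻¹ (c.g s)))⁻¹ * Φ (c.f s⁻¹ (c.g s))) := by
        simp only [map_inv, mul_assoc, mul_comm, mul_left_comm]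
    _ = 1 := by rw [hs, inv_mul_cancel, one_mul]
end CH
end Reg

namespace Reg
open Subgroup Module Equiv Equiv.Perm MulAction

theorem P2 {n : ℕ} (hn : 5 ≤ n) (hn6 : n ≠ 6) (K : Subgroup (Perm (Fin n)))
    (hK : ∀ x : Perm (Fin n), ∀ m, Odd m → x ^ m = 1 → ∃ s, s⁻¹ * x * s ∈ K) : AG n ≤ K := by
  have get : ∀ (m : Multiset ℕ) (M : ℕ), Odd M → (∀ a ∈ m, a ∣ M) → m.sum ≤ n → (∀ a ∈ m, 2 ≤ a) →
      ∃ g ∈ K, cycleType g = m := by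
    intro m M hM h1 h2 h3
    obtain ⟨g, hg⟩ := (exists_with_cycleType_iff (Fin n) (m := m)).2 ⟨by simpa using h2, h3⟩
    obtain ⟨s, hs⟩ := hK g M hM (by
      rw [← orderOf_dvd_iff_pow_eq_one, ← lcm_cycleType, hg, Multiset.lcm_dvd]; exact h1)
    exact ⟨_, hs, by rw [← hg]; simpa using cycleType_conj (σ := g) (τ := s⁻¹)⟩
  have gc : ∀ k, Odd k → 2 ≤ k → k ≤ n → ∃ g ∈ K, cycleType g = {k} := fun k h1 h2 h3 =>
    get {k} k h1 (by simp) (by simpa) (by simpa)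
  have sup : ∀ (g : Perm (Fin n)) k, cycleType g = {k} → g.IsCycle ∧ g.support.card = k := fun g k h => by
    refine ⟨card_cycleType_eq_one.1 (by rw [h]; rfl), ?_⟩
    rw [← sum_cycleType, h, Multiset.sum_singleton]
  have tr : ∀ c ∈ K, ∀ d ∈ K, c.IsCycle → n - 1 ≤ c.support.card → d.support.card = n →
      IsPretransitive K (Fin n) := by
    intro c hc d hd hcc hcn hdn
    obtain ⟨p, hp, -⟩ := id hcc
    have hp' : p ∈ c.support := by rwa [mem_support]
    have key : ∀ x ∈ c.support, ∃ k : K, k • p = x := by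
      intro x hx
      obtain ⟨i, hi⟩ := hcc.sameCycle hp (mem_support.1 hx)
      exact ⟨⟨c ^ i, K.zpow_mem hc i⟩, hi⟩
    have key2 : ∀ x, ∃ k : K, k • p = x := by
      intro x
      by_cases hx : x ∈ c.support
      · exact key x hx
      obtain ⟨k, hk⟩ := key (d x) (by
        by_contra h
        have hdx : d x ≠ x := by
          rw [← mem_support, Finset.eq_univ_of_card d.support (by simpa using hdn)]; simp
        have := Finset.card_le_card (show {x, d x} ⊆ c.supportᶜ by
          intro y hy; simp only [Finset.mem_insert, Finset.mem_singleton] at hy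
          rw [Finset.mem_compl]; rcases hy with rfl | rfl <;> assumption)
        rw [Finset.card_pair hdx.symm, Finset.card_compl, Fintype.card_fin] at this
        omega)
      refine ⟨⟨d, hd⟩⁻¹ * k, ?_⟩
      rw [mul_smul, hk, inv_smul_eq_iff]; rfl
    refine ⟨fun x y => ?_⟩
    obtain ⟨k, rfl⟩ := key2 x
    obtain ⟨l, rfl⟩ := key2 y
    exact ⟨l * k⁻¹, by rw [mul_smul, inv_smul_smul]⟩
  have htr : IsPretransitive K (Fin n) := by
    rcases Nat.even_or_odd n with he | ho
    · obtain ⟨r, hr⟩ := he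
      have o1 : Odd (n - 1) := ⟨r - 1, by omega⟩
      have o2 : Odd (n - 3) := ⟨r - 2, by omega⟩
      obtain ⟨c, hc, hc1⟩ := gc (n - 1) o1 (by omega) (by omega)
      obtain ⟨d, hd, hd1⟩ := get {3, n - 3} (3 * (n - 3)) (Odd.mul (by decide) o2)
        (by simp) (by simp; omega) (by simp; omega)
      refine tr c hc d hd (sup c _ hc1).1 (sup c _ hc1).2.ge ?_
      rw [← sum_cycleType, hd1]; simp; omega
    · obtain ⟨c, hc, hc1⟩ := gc n ho (by omega) le_rfl
      have := sup c _ hc1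
      exact tr c hc c hc this.1 (by omega) this.2
  obtain ⟨p, pp, p1, p2⟩ := Nat.exists_prime_lt_and_le_two_mul (n / 2) (by omega)
  obtain ⟨c, hc, hc1⟩ := gc p (pp.odd_of_ne_two (by omega)) pp.two_le (by omega)
  obtain ⟨t, ht, ht1⟩ := gc 3 (by decide) (by omega) (by omega)
  obtain ⟨cc, cs⟩ := sup c _ hc1
  obtain ⟨a, ha, -⟩ := id cc
  have ho : orbit (zpowers c) a = (c.support : Set (Fin n)) := by
    ext x
    rw [Finset.mem_coe, mem_support]
    constructor
    · rintro ⟨⟨_, i, rfl⟩, rfl⟩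
      change c ((c ^ i) a) ≠ (c ^ i) a
      rw [← Perm.mul_apply, ← zpow_one_add, add_comm, zpow_add, zpow_one, Perm.mul_apply]
      exact fun h => ha ((c ^ i).injective h)
    · intro hx
      obtain ⟨i, hi⟩ := cc.sameCycle ha hx
      exact ⟨⟨c ^ i, i, rfl⟩, hi⟩
  have hcard : Nat.card (orbit (zpowers c) a) = p := by
    rw [ho, ← cs, Nat.card_coe_set_eq, Set.ncard_coe_finset]
  have : IsPreprimitive (zpowers c) (orbit (zpowers c) a) := IsPreprimitive.of_prime_card (by rwa [hcard])
  let φ : zpowers c → K := fun x => ⟨x.1, (zpowers_le.2 hc) x.2⟩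
  let f : orbit (zpowers c) a →ₑ[φ] Fin n := { toFun := fun x => x.1, map_smul' := fun _ _ => rfl }
  have hp : IsPreprimitive K (Fin n) := IsPreprimitive.of_card_lt (f := f) (by
    have : Set.range f = orbit (zpowers c) a := Subtype.range_coe
    rw [this, ← Nat.card_coe_set_eq, hcard, Nat.card_fin]; omega)
  exact alternatingGroup_le_of_isPreprimitive_of_isThreeCycle_mem hp (show IsThreeCycle t from ht1) ht
end Reg

namespace Reg
open Subgroup Module Equiv Equiv.Perm

variable {n : ℕ} {N : Type} [Group N]

theorem HsA (hn : 5 ≤ n) (hn6 : n ≠ 6) (c : CH (Perm (Fin n)) N) (y : Al n) (Φ : N →* M2) : Φ (c.g y) = 1 :=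
  P2 hn hn6 c.Hs (fun x m hm hx => c.odd_mem hm hx) y.2 Φ

theorem HsAl (hn : 5 ≤ n) (hn6 : n ≠ 6) (c : CH (Al n) N) (Φ : N →* M2) (x : N) : Φ x = 1 := by
  obtain ⟨y, rfl⟩ := c.bij.2 x
  have := P2 hn hn6 (c.Hs.map (AG n).subtype) (fun x m hm hx => by
    have hs : sign x = 1 := by
      refine (Int.units_eq_one_or _).resolve_right fun h => ?_
      have := congrArg sign hx
      rw [map_pow, h, hm.neg_one_pow, map_one] at this
      exact absurd this (by decide)
    obtain ⟨s, hs⟩ := c.odd_mem (x := ⟨x, mem_alternatingGroup.2 hs⟩) hm (Subtype.ext hx)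
    exact ⟨s, _, hs, rfl⟩) y.2
  obtain ⟨w, hw, hwy⟩ := this
  rw [← Subtype.ext (a1 := w) (a2 := y) hwy]
  exact hw Φ

theorem MAl (hn : 5 ≤ n) (hn6 : n ≠ 6) (c : CH (Al n) N) : Nonempty (N ≃* Al n) := by
  have hc : Nat.card N = Nat.card (Al n) := (Nat.card_eq_of_bijective _ c.bij).symm
  have : Finite N := Finite.of_surjective _ c.bij.2
  have hI : Inv (Al n) N := by
    by_contra hI
    have h1 := MP hn hn6 N (by rw [hc, ← al_card hn]; exact dvd_mul_left _ _) hI (HsAl hn hn6 c) c.f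
    let h : Al n →* N := MonoidHom.mk' c.g fun s t => by rw [c.mul, h1]; rfl
    let e : Al n ≃* N := MulEquiv.ofBijective h c.bij
    exact hI ⟨⊤, e.symm.toMonoidHom.comp (Subgroup.subtype ⊤), fun s => ⟨⟨e s, trivial⟩, e.symm_apply_apply s⟩⟩
  obtain ⟨U, φ, hφ⟩ := hI
  have h1 := Nat.card_le_card_of_surjective φ hφ
  have h2 := U.card_le_card_group
  have hU : U = ⊤ := U.eq_top_of_card_eq (by omega)
  subst hU
  have hb : Function.Bijective φ := (Nat.bijective_iff_surjective_and_card φ).2 ⟨hφ, by omega⟩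
  exact ⟨topEquiv.symm.trans (MulEquiv.ofBijective φ hb)⟩

theorem isoN (hn : 5 ≤ n) (hn6 : n ≠ 6) (hc : Nat.card N = n.factorial) (Φ : N →* M2)
    (e : Φ.ker ≃* Al n) : Nonempty (N ≃* Perm (Fin n)) ∨ Nonempty (N ≃* Al n × M2) := by
  have hfin : Finite N := Nat.finite_of_card_ne_zero (by rw [hc]; exact Nat.factorial_ne_zero n)
  have : IsSimpleGroup (Al n) := al_simple hn
  have hs : ∀ x : N, ∃ s : Perm (Fin n), ∀ m : Φ.ker, (e (MulAut.conjNormal x m) : Perm (Fin n)) = s * e m * s⁻¹ := by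
    intro x
    let α : Al n →* Perm (Fin n) := (AG n).subtype.comp
      ((e.toMonoidHom.comp (MulAut.conjNormal x).toMonoidHom).comp e.symm.toMonoidHom)
    obtain ⟨s, hs⟩ := autA hn hn6 α (by
      obtain ⟨a, ha⟩ := exists_ne (1 : Al n)
      refine ⟨a, fun h => ha ?_⟩
      have h2 : e (MulAut.conjNormal x (e.symm a)) = 1 := Subtype.ext h
      simpa using h2)
    refine ⟨s, fun m => ?_⟩
    have := hs (e m)
    rw [← this]
    change _ = (e (MulAut.conjNormal x (e.symm (e m))) : Perm (Fin n))
    rw [e.symm_apply_apply]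
  choose θ hθ using hs
  have uq : ∀ s t : Perm (Fin n), (∀ m : Φ.ker, s * e m * s⁻¹ = t * e m * t⁻¹) → s = t := fun s t h =>
    conj_uniq hn fun x hx => by simpa using h (e.symm ⟨x, hx⟩)
  let Θ : N →* Perm (Fin n) := MonoidHom.mk' θ fun x y => uq _ _ fun m => by
    rw [← hθ, map_mul, MulAut.mul_apply, hθ, hθ]; group
  have hM : ∀ m : Φ.ker, Θ m = e m := fun m => uq _ _ fun a => by
    change θ m * _ * (θ m)⁻¹ = _
    rw [← hθ]
    have : MulAut.conjNormal (m : N) a = m * a * m⁻¹ := Subtype.ext rfl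
    rw [this, map_mul, map_mul, map_inv]; rfl
  have hM1 : ∀ x, Φ x = 1 → Θ x = 1 → x = 1 := fun x h1 h2 => by
    have := hM ⟨x, h1⟩
    rw [h2] at this
    have h3 : e ⟨x, h1⟩ = 1 := Subtype.ext this.symm
    rw [MulEquiv.map_eq_one_iff] at h3
    exact congrArg Subtype.val h3
  by_cases hi : Function.Injective Θ
  · left
    exact ⟨MulEquiv.ofBijective Θ ((Nat.bijective_iff_injective_and_card Θ).2 ⟨hi, by
      rw [hc, Nat.card_perm, Nat.card_fin]⟩)⟩
  · right
    rw [injective_iff_map_eq_one] at hi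
    push Not at hi
    obtain ⟨z, hz, hz1⟩ := hi
    have hzM : Φ z ≠ 1 := fun h => hz1 (hM1 z h hz)
    have hA : ∀ x, Θ x ∈ AG n := by
      have h0 : ∀ x, Φ x = 1 → Θ x ∈ AG n := fun x h => by rw [hM ⟨x, h⟩]; exact (e _).2
      intro x
      by_cases hx : Φ x = 1
      · exact h0 x hx
      · have := h0 (x * z⁻¹) (by rw [map_mul, map_inv, M2.ne_one hx hzM, mul_inv_cancel])
        rwa [map_mul, map_inv, hz, inv_one, mul_one] at this
    let Ψ : N →* Al n × M2 := (Θ.codRestrict (AG n) hA).prod Φ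
    refine ⟨MulEquiv.ofBijective Ψ ((Nat.bijective_iff_injective_and_card Ψ).2 ⟨?_, ?_⟩)⟩
    · rw [injective_iff_map_eq_one]
      intro x hx
      exact hM1 x (congrArg Prod.snd hx) (congrArg Subtype.val (congrArg Prod.fst hx))
    · rw [hc, Nat.card_prod, ← al_card hn, mul_comm]
      congr 1
      simp

theorem caseB (hn : 5 ≤ n) (hn6 : n ≠ 6) (c : CH (Perm (Fin n)) N) (Φ : N →* M2) (hΦ : ∃ x, Φ x ≠ 1) :
    Nonempty (N ≃* Perm (Fin n)) ∨ Nonempty (N ≃* Al n × M2) := by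
  have hc : Nat.card N = n.factorial := by
    rw [← Nat.card_eq_of_bijective _ c.bij, Nat.card_perm, Nat.card_fin]
  have hfin : Finite N := Finite.of_surjective _ c.bij.2
  have hi : Φ.ker.index = 2 := by
    rw [index_ker]
    obtain ⟨x, hx⟩ := hΦ
    have : Φ.range = ⊤ := by
      rw [MonoidHom.range_eq_top]
      intro y
      by_cases hy : y = 1
      · exact ⟨1, by rw [map_one, hy]⟩
      · exact ⟨x, M2.ne_one hx hy⟩
    rw [this]; simp
  have hk := Φ.ker.card_mul_index
  have ha := al_card hn
  have hb : Function.Bijective (fun y : Al n => (⟨c.g y, HsA hn hn6 c y Φ⟩ : Φ.ker)) := by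
    refine (Nat.bijective_iff_injective_and_card _).2 ⟨fun x y h => ?_, by rw [hi] at hk; omega⟩
    exact Subtype.ext (c.bij.1 (congrArg Subtype.val h))
  have hinv : ∀ s (m : Φ.ker), Φ (c.f s m) = 1 := by
    intro s m
    obtain ⟨y, rfl⟩ := hb.2 m
    exact HsA hn hn6 c y (Φ.comp (c.f s).toMonoidHom)
  let r : Al n →* MulAut Φ.ker := MonoidHom.mk' (fun s =>
    { toFun := fun m => ⟨c.f s m, hinv s m⟩
      invFun := fun m => ⟨c.f (s : Perm (Fin n))⁻¹ m, hinv _ m⟩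
      left_inv := fun m => Subtype.ext (by simp)
      right_inv := fun m => Subtype.ext (by simp)
      map_mul' := fun a b => Subtype.ext (map_mul (c.f s) a.1 b.1) }) fun s t => by
    ext m; change c.f (s * t : Perm (Fin n)) m = _; rw [map_mul]; rfl
  obtain ⟨e⟩ := MAl hn hn6 ⟨r, _, hb, fun s t => Subtype.ext (c.mul s t)⟩
  exact isoN hn hn6 hc Φ e
end Reg

namespace Reg
open Subgroup Module Equiv Equiv.Perm

theorem cent2 {n : ℕ} (hn : 5 ≤ n) (u : Perm (Fin n)) : Nat.card (centralizer {u}) ≠ 2 := by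
  intro h
  have h2 := (Nat.card_eq_two_iff' (1 : centralizer {u})).1 h
  obtain ⟨v, hv, hu⟩ := h2
  have uq : ∀ x y : Perm (Fin n), x * u = u * x → y * u = u * y → x ≠ 1 → y ≠ 1 → x = y := by
    intro x y h1 h2 h3 h4
    have e1 := hu ⟨x, mem_centralizer_singleton_iff.2 h1⟩ fun h => h3 (congrArg Subtype.val h)
    have e2 := hu ⟨y, mem_centralizer_singleton_iff.2 h2⟩ fun h => h4 (congrArg Subtype.val h)
    exact congrArg Subtype.val (e1.trans e2.symm)
  have sw : ∀ {a b : Fin n}, a ≠ b → swap a b ≠ 1 := fun h => by rwa [Ne, swap_eq_one_iff]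
  have key : ∀ {a b d : Fin n}, b ≠ d → swap a b ≠ swap a d := fun {a b d} h3 h =>
    h3 (by simpa using congrArg (fun p : Perm (Fin n) => p a) h)
  by_cases hu1 : u = 1
  · subst hu1
    have := uq (swap ⟨0, by omega⟩ ⟨1, by omega⟩) (swap ⟨0, by omega⟩ ⟨2, by omega⟩) (by simp) (by simp)
      (sw (by simp)) (sw (by simp))
    exact key (by simp) this
  obtain ⟨a, ha⟩ : ∃ a, u a ≠ a := by
    by_contra! h; exact hu1 (Perm.ext h)
  have hinv : u⁻¹ = u := uq _ _ (by simp) rfl (by simpa) hu1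
  have hba : u (u a) = a := by nth_rewrite 1 [← hinv]; simp
  have e1 : swap a (u a) = u := uq _ _ (by
    have := swap_apply_apply u a (u a)
    rw [hba, swap_comm] at this
    exact eq_mul_inv_iff_mul_eq.1 this) rfl (sw ha.symm) hu1
  obtain ⟨k, hk⟩ := Finset.exists_mem_notMem_of_card_lt_card (s := {a, u a}) (t := Finset.univ)
    (by rw [Finset.card_fin]; exact lt_of_le_of_lt Finset.card_le_two (by omega))
  obtain ⟨l, hl⟩ := Finset.exists_mem_notMem_of_card_lt_card (s := {a, u a, k}) (t := Finset.univ)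
    (by rw [Finset.card_fin]; exact lt_of_le_of_lt Finset.card_le_three (by omega))
  simp at hk hl
  have hd : (swap k l).Disjoint u := by
    rw [← e1]; exact disjoint_swap_swap (by simp; tauto)
  have e2 := uq (swap k l) u hd.commute.eq rfl (sw (Ne.symm hl.2.2)) hu1
  have := congrArg (fun p : Perm (Fin n) => p k) e2
  rw [← e1] at this
  simp [swap_apply_of_ne_of_ne hk.1 hk.2] at this
  exact hl.2.2 this

variable {n : ℕ} {N : Type} [Group N]

theorem noIdx (h2 : ∀ (Φ : N →* M2) x, Φ x = 1) (U : Subgroup N) : U.index ≠ 2 := by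
  intro h
  have := normal_of_index_eq_two h
  have e : N ⧸ U ≃* M2 := mulEquivOfPrimeCardEq (p := 2) h (by simp)
  have : U = ⊤ := by
    rw [eq_top_iff]
    intro x _
    have := h2 (e.toMonoidHom.comp (QuotientGroup.mk' U)) x
    rw [← QuotientGroup.eq_one_iff]
    exact (MulEquiv.map_eq_one_iff e).1 this
  rw [this, index_top] at h
  exact absurd h (by norm_num)

theorem caseA (hn : 5 ≤ n) (hn6 : n ≠ 6) (c : CH (Perm (Fin n)) N) (h2 : ∀ (Φ : N →* M2) x, Φ x = 1) : False := by
  have hc : Nat.card N = n.factorial := by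
    rw [← Nat.card_eq_of_bijective _ c.bij, Nat.card_perm, Nat.card_fin]
  have hfin : Finite N := Finite.of_surjective _ c.bij.2
  have : IsSimpleGroup (Al n) := al_simple hn
  have ha := al_card hn
  have hpos : 0 < Nat.card (Al n) := Nat.card_pos
  have noemb : ∀ h : Al n →* N, ¬ Function.Injective h := by
    intro h hi
    refine noIdx h2 h.range ?_
    have := h.range.card_mul_index
    rw [hc, ← ha, ← Nat.card_congr (MonoidHom.ofInjective hi).toEquiv, mul_comm] at this
    exact Nat.eq_of_mul_eq_mul_right hpos this
  have ginj : ∀ x y : Al n, c.g x = c.g y → x = y := fun x y h => Subtype.ext (c.bij.1 h)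
  have triv : ¬ ∀ s : Al n, c.f s = 1 := fun h1 =>
    noemb (MonoidHom.mk' (fun s => c.g s) fun s t => by
      change c.g (s * t : Perm (Fin n)) = _
      rw [c.mul, h1]; rfl) ginj
  have hI : Inv (Al n) N := by
    by_contra hI
    exact triv (MP hn hn6 N hc.dvd hI h2 (c.f.comp (AG n).subtype))
  obtain ⟨U, φ, hφ⟩ := hI
  obtain ⟨k, hk⟩ := card_dvd_of_surjective φ hφ
  have hki : k * U.index = 2 := by
    have := U.card_mul_index
    rw [hk, hc, ← ha, mul_assoc, mul_comm 2] at this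
    exact Nat.eq_of_mul_eq_mul_left hpos this
  have hU1 : U.index = 1 :=
    ((Nat.dvd_prime Nat.prime_two).1 (Dvd.intro_left _ hki)).resolve_right (noIdx h2 U)
  have hU : U = ⊤ := index_eq_one.1 hU1
  subst hU
  let π : N →* Al n := φ.comp topEquiv.symm.toMonoidHom
  have hπ : Function.Surjective π := hφ.comp topEquiv.symm.surjective
  have hker : Nat.card π.ker = 2 := by
    have h1 := π.ker.card_mul_index
    rw [index_ker, MonoidHom.range_eq_top.2 hπ, card_top, hc, ← ha] at h1
    exact Nat.eq_of_mul_eq_mul_right hpos h1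
  have e : π.ker ≃* M2 := mulEquivOfPrimeCardEq (p := 2) hker (by simp)
  have e1 : ∀ k : π.ker, e k = 1 ↔ k = 1 := fun k => MulEquiv.map_eq_one_iff e
  have cen : ∀ (k : π.ker) x, x * (k : N) * x⁻¹ = k := by
    intro k x
    by_cases hk : k = 1
    · rw [hk]; simp
    have := e.injective (M2.ne_one (a := e (MulAut.conjNormal x k)) (b := e k)
      (by rw [Ne, e1, MulEquiv.map_eq_one_iff]; exact hk) (by rwa [Ne, e1]))
    exact congrArg Subtype.val this
  have endo : ∀ θ : N →* N, (∀ x, π (θ x) = π x) → ∀ x, θ x = x := by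
    intro θ hθ x
    have hm : ∀ x, θ x * x⁻¹ ∈ π.ker := fun x => by rw [MonoidHom.mem_ker, map_mul, map_inv, hθ, mul_inv_cancel]
    let Φ : N →* M2 := MonoidHom.mk' (fun x => e ⟨θ x * x⁻¹, hm x⟩) fun x y => by
      rw [← map_mul]
      congr 1
      apply Subtype.ext
      change θ (x * y) * (x * y)⁻¹ = θ x * x⁻¹ * (θ y * y⁻¹)
      have := cen ⟨_, hm y⟩ x
      simp only at this
      rw [← this]
      rw [map_mul]; group
    have := (e1 _).1 (h2 Φ x)
    exact mul_inv_eq_one.1 (congrArg Subtype.val this)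
  have hF : ∀ s, ∃ F : Perm (Fin n), ∀ x, (π (c.f s x) : Perm (Fin n)) = F * π x * F⁻¹ := by
    intro s
    let ψ : N →* Al n := π.comp (c.f s).toMonoidHom
    have hψ : Function.Surjective ψ := hπ.comp (c.f s).surjective
    have hk : π.ker ≤ ψ.ker := by
      have hb : π.ker.map ψ = ⊥ := by
        refine (IsSimpleGroup.eq_bot_or_eq_top_of_normal _ (Normal.map inferInstance ψ hψ)).resolve_right fun h => ?_
        have h3 := Nat.card_le_card_of_surjective _ (ψ.subgroupMap_surjective π.ker)
        rw [h, card_top, hker] at h3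
        have := Nat.factorial_le hn
        have h5 : Nat.factorial 5 = 120 := rfl
        omega
      rwa [Subgroup.map_eq_bot_iff] at hb
    let α := MonoidHom.liftOfSurjective π hπ ⟨ψ, hk⟩
    have hα : ∀ x, α (π x) = ψ x := MonoidHom.liftOfRightInverse_comp_apply _ _ _ ⟨ψ, hk⟩
    obtain ⟨F, hF⟩ := autA hn hn6 ((AG n).subtype.comp α) (by
      obtain ⟨a, ha⟩ := exists_ne (1 : Al n)
      obtain ⟨x, rfl⟩ := hψ a
      exact ⟨π x, fun h => ha ((hα x).symm.trans (Subtype.ext h))⟩)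
    exact ⟨F, fun x => by rw [← hF (π x)]; exact congrArg Subtype.val (hα x).symm⟩
  choose F0 hF using hF
  let F : Perm (Fin n) →* Perm (Fin n) := MonoidHom.mk' F0 fun s t => conj_uniq hn fun x hx => by
    obtain ⟨y, hy⟩ := hπ ⟨x, hx⟩
    have hy' : (π y : Perm (Fin n)) = x := congrArg Subtype.val hy
    rw [← hy', ← hF, map_mul, MulAut.mul_apply, hF, hF]; group
  let H : Perm (Fin n) →* Perm (Fin n) := MonoidHom.mk' (fun s => π (c.g s) * F s) fun s t => by
    rw [c.mul, map_mul, map_mul, Subgroup.coe_mul, hF]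
    change _ * (F s * _ * (F s)⁻¹) * _ = _
    group
  obtain ⟨s, hs⟩ := autS hn hn6 F (by
    by_contra! h
    refine triv fun y => MulEquiv.ext fun x => endo (c.f y).toMonoidHom (fun x => Subtype.ext ?_) x
    refine (hF y x).trans ?_
    rw [show F0 y = 1 from h y y.2]; simp)
  obtain ⟨t, ht⟩ := autS hn hn6 H (by
    by_contra! h
    have h1 : ∀ (y : Al n) x, c.g y * c.f y x * (c.g y)⁻¹ = x := fun y x =>
      endo ((MulAut.conj (c.g y)).toMonoidHom.comp (c.f y).toMonoidHom) (fun x => Subtype.ext (by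
        change ((π (c.g y * c.f y x * (c.g y)⁻¹) : Al n) : Perm (Fin n)) = π x
        have h3 : (π (c.g y) : Perm (Fin n)) * F0 y = 1 := h y y.2
        rw [map_mul, map_mul, map_inv, Subgroup.coe_mul, Subgroup.coe_mul, Subgroup.coe_inv, hF,
          eq_inv_of_mul_eq_one_left h3]
        group)) x
    refine noemb (MonoidHom.mk' (fun s => c.g s⁻¹) fun s t => ?_) fun x y h => inv_injective (ginj x⁻¹ y⁻¹ h)
    rw [Subgroup.coe_mul, mul_inv_rev]
    change c.g (t⁻¹ * s⁻¹ : Perm (Fin n)) = c.g s⁻¹ * c.g t⁻¹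
    rw [c.mul]
    have := h1 t⁻¹ (c.g s⁻¹)
    exact mul_inv_eq_iff_eq_mul.1 this)
  have hst : ∀ y, c.g y ∈ π.ker ↔ y ∈ centralizer {s⁻¹ * t} := by
    intro y
    have h1 : (π (c.g y) : Perm (Fin n)) * F y = H y := rfl
    rw [hs, ht] at h1
    rw [mem_centralizer_singleton_iff, MonoidHom.mem_ker]
    constructor
    · intro h
      rw [h, Subgroup.coe_one, one_mul] at h1
      calc y * (s⁻¹ * t) = s⁻¹ * (s * y * s⁻¹) * t := by group
        _ = _ := by rw [h1]; group
    · intro h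
      refine Subtype.ext (mul_eq_right.1 (h1.trans ?_))
      calc t * y * t⁻¹ = s * ((s⁻¹ * t) * y) * t⁻¹ := by group
        _ = _ := by rw [← h]; group
  refine cent2 hn (s⁻¹ * t) ?_
  rw [← hker]
  exact Nat.card_congr ((Equiv.ofBijective c.g c.bij).subtypeEquiv fun y => (hst y).symm)

theorem main (hn : 5 ≤ n) (hn6 : n ≠ 6) (c : CH (Perm (Fin n)) N) :
    Nonempty (N ≃* Perm (Fin n)) ∨ Nonempty (N ≃* Al n × M2) := by
  by_cases h : ∀ (Φ : N →* M2) x, Φ x = 1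
  · exact (caseA hn hn6 c h).elim
  · push Not at h
    obtain ⟨Φ, h⟩ := h
    exact caseB hn hn6 c Φ h

theorem mkCH {G : Type} [Group G] (H : Subgroup (Perm G)) (hr : Function.Bijective fun η : H => (η : Perm G) 1)
    (hl : ∀ σ : G, ∀ η ∈ H, Equiv.mulLeft σ * η * (Equiv.mulLeft σ)⁻¹ ∈ H) : Nonempty (CH G H) := by
  let L : G →* Perm G := MonoidHom.mk' (fun s => Equiv.mulLeft s) fun s t => by ext x; simp [mul_assoc]
  have hl' : ∀ s, ∀ η : H, L s * η * (L s)⁻¹ ∈ H := fun s η => hl s η η.2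
  let f : G →* MulAut H := MonoidHom.mk' (fun s =>
    { toFun := fun η => ⟨L s * η * (L s)⁻¹, hl' s η⟩
      invFun := fun η => ⟨L s⁻¹ * η * (L s⁻¹)⁻¹, hl' _ η⟩
      left_inv := fun η => Subtype.ext (by simp [mul_assoc])
      right_inv := fun η => Subtype.ext (by simp [mul_assoc])
      map_mul' := fun a b => Subtype.ext (by simp [mul_assoc]) }) fun s t => by
    ext1 η
    apply Subtype.ext
    change L (s * t) * η * (L (s * t))⁻¹ = L s * (L t * η * (L t)⁻¹) * (L s)⁻¹
    rw [map_mul]; group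
  let E := Equiv.ofBijective _ hr
  have hE : ∀ s, (E.symm s : Perm G) 1 = s := fun s => E.apply_symm_apply s
  have key : ∀ s t, E.symm (s * t) = f s (E.symm t) * E.symm s := by
    intro s t
    rw [Equiv.symm_apply_eq]
    change _ = (L s * (E.symm t : Perm G) * (L s)⁻¹) ((E.symm s : Perm G) 1)
    rw [hE, ← map_inv]
    change _ = s * (E.symm t : Perm G) (s⁻¹ * s)
    rw [inv_mul_cancel, hE]
  refine ⟨⟨f, fun s => (E.symm s)⁻¹, (Equiv.inv H).bijective.comp E.symm.bijective, fun s t => ?_⟩⟩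
  rw [key, mul_inv_rev, map_inv]
end Reg

theorem stmt_2 (n : ℕ) (hn : 5 ≤ n) (hn6 : n ≠ 6) (N : Type*) [Group N]
    (hcard : Nat.card N = n.factorial)
    (hS : ¬ Nonempty (N ≃* Equiv.Perm (Fin n)))
    (hA : ¬ Nonempty (N ≃* (alternatingGroup (Fin n) × Multiplicative (ZMod 2)))) :
    ∀ H : Subgroup (Equiv.Perm (Equiv.Perm (Fin n))),
      IsRegularSubgroup H → IsNormalizedByLeft H → ¬ Nonempty (H ≃* N) := by
  rintro H hr hl ⟨e⟩
  obtain ⟨c⟩ := Reg.mkCH H hr hl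
  rcases Reg.main hn hn6 c with h | h
  · exact hS (h.map e.symm.trans)
  · exact hA (h.map e.symm.trans)
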